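/- Let φ be an injective endomorphism (monomorphism) of a free product G = G_1 * G_2 * ... * G_n of freely indecomposable groups G_1, ..., G_n. Then the fixed subgroup Fix(φ) = {g ∈ G : φ(g) = g} has Kurosh rank at most n with respect to this free product decomposition of G. -/

import Mathlib

universe u

open Monoid

instance sumElimGroup {α β : Type*} (A : α → Type u) (B : β → Type u)
    [∀ a, Group (A a)] [∀ b, Group (B b)] (x : α ⊕ β) : Group (Sum.elim A B x) :=
  match x with
  | .inl a => inferInstanceAs (Group (A a))
  | .inr b => inferInstanceAs (Group (B b))

/-- The free factor `G_i` of a free product, viewed as a subgroup. -/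
def factorSubgroup {ι : Type*} {M : ι → Type*} [∀ i, Group (M i)] (i : ι) :
    Subgroup (CoprodI M) := (CoprodI.of (i := i)).range

/-- The conjugate `g S g⁻¹` of a subgroup `S`. -/
def conjSubgroup {G : Type*} [Group G] (g : G) (S : Subgroup G) : Subgroup G :=
  S.map (MulAut.conj g).toMonoidHom

/-- The `n`-th iterate of an endomorphism. -/
def iterHom {G : Type*} [Group G] (φ : G →* G) : ℕ → (G →* G)
  | 0 => MonoidHom.id G
  | n + 1 => φ.comp (iterHom φ n)

/-- The stable image `φ^∞(G) = ⋂ₙ φⁿ(G)`. -/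
def stableImage {G : Type*} [Group G] (φ : G →* G) : Subgroup G :=
  ⨅ n : ℕ, (iterHom φ (n + 1)).range

/-- The fixed subgroup of an endomorphism. -/
def fixedSubgroup {G : Type*} [Group G] (φ : G →* G) : Subgroup G where
  carrier := {g | φ g = g}
  one_mem' := by simp
  mul_mem' := by intro a b ha hb; simp only [Set.mem_setOf_eq, map_mul] at *; rw [ha, hb]
  inv_mem' := by intro a ha; simp only [Set.mem_setOf_eq, map_inv] at *; rw [ha]

/-- `H` has Kurosh rank at most `k` with respect to the given splitting. -/
def HasKuroshRankLE {ι : Type} {M : ι → Type} [∀ i, Group (M i)]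
    (H : Subgroup (CoprodI M)) (k : ℕ) : Prop :=
  ∃ (m r : ℕ) (J : Fin m → ι) (g : Fin m → CoprodI M)
    (e : H ≃* CoprodI (Sum.elim
      (fun i : Fin m => ↥(conjSubgroup (g i) (factorSubgroup (J i)) ⊓ H))
      (fun _ : Fin r => Multiplicative ℤ))),
    m + r ≤ k ∧
    (∀ i : Fin m, Nontrivial ↥(conjSubgroup (g i) (factorSubgroup (J i)) ⊓ H)) ∧
    ∀ (i : Fin m) (x : ↥(conjSubgroup (g i) (factorSubgroup (J i)) ⊓ H)),
      ((e.symm (CoprodI.of (i := Sum.inl i) x) : H) : CoprodI M) = (x : CoprodI M)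

/-- A group is freely indecomposable if it is not isomorphic to a free product of two
nontrivial groups. -/
def FreelyIndecomposable (G : Type) [Group G] : Prop :=
  ¬ ∃ (A : Type) (B : Type) (_ : Group A) (_ : Group B),
      Nontrivial A ∧ Nontrivial B ∧ Nonempty (G ≃* Monoid.Coprod A B)

/-- A group `G` acting on the vertex set `V` of a tree, whose edges are the pairs `(g, i)`, joining
`g • o` to `g • t i`; the vertex `o` has trivial stabilizer.  Being a tree is expressed by
connectedness and the integrability of arbitrary edge cochains. -/
structure FreeTree (G V ι : Type) [Group G] [MulAction G V] where
  o : V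
  t : ι → V
  free : ∀ g : G, g • o = o → g = 1
  conn : ∀ Q : V → Prop, Q o → (∀ (g : G) i, Q (g • o) ↔ Q (g • t i)) → ∀ v, Q v
  integ : ∀ (N : Type) [Group N] (b : G → ι → N),
    ∃ β : V → N, ∀ g i, β (g • t i) = β (g • o) * b g i

namespace FreeTree

variable {G V ι : Type} [Group G] [MulAction G V] (T : FreeTree G V ι)

/-- The source of an edge. -/
def src (e : G × ι) : V := e.1 • T.o

/-- The target of an edge. -/
def tgt (e : G × ι) : V := e.1 • T.t e.2

theorem eq_of_edge {X : Type*} (ψ : V → X) (h : ∀ e, ψ (T.tgt e) = ψ (T.src e)) (v w : V) :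
    ψ v = ψ w := by
  have key : ∀ v, ψ v = ψ T.o :=
    T.conn (fun v => ψ v = ψ T.o) rfl fun g i => by
      have := h (g, i); simp only [src, tgt] at this; rw [this]
  rw [key v, key w]

theorem exists_pot : ∃ p : V → (G × ι →₀ ℝ), ∀ e,
    p (T.tgt e) = p (T.src e) + Finsupp.single e 1 := by
  obtain ⟨β, hβ⟩ := T.integ (Multiplicative (G × ι →₀ ℝ))
    (fun g i => Multiplicative.ofAdd (Finsupp.single (g, i) 1))
  exact ⟨fun v => (β v).toAdd, fun e => by
    have := hβ e.1 e.2
    simp only [src, tgt, this]; rfl⟩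

/-- A universal potential: it increases by the indicator of `e` along every edge `e`. -/
noncomputable def pot : V → (G × ι →₀ ℝ) := T.exists_pot.choose

theorem pot_tgt (e : G × ι) : T.pot (T.tgt e) = T.pot (T.src e) + Finsupp.single e 1 :=
  T.exists_pot.choose_spec e

theorem pot_tgt_of_ne {e e' : G × ι} (h : e' ≠ e) : T.pot (T.tgt e') e = T.pot (T.src e') e := by
  rw [pot_tgt]; simp [h]

theorem pot_tgt_self (e : G × ι) : T.pot (T.tgt e) e = T.pot (T.src e) e + 1 := by
  rw [pot_tgt]; simp

/-- The half-space beyond the edge `e`. -/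
def half (e : G × ι) : Set V := {v | T.pot v e ≠ T.pot (T.src e) e}

theorem src_notMem (e : G × ι) : T.src e ∉ T.half e := by simp [half]

theorem tgt_mem (e : G × ι) : T.tgt e ∈ T.half e := by simp [half, pot_tgt_self]

theorem half_edge {e e' : G × ι} (h : e' ≠ e) : T.tgt e' ∈ T.half e ↔ T.src e' ∈ T.half e := by
  simp [half, pot_tgt_of_ne T h]

theorem half_unique {e : G × ι} {A : Set V} (h1 : T.src e ∉ A) (h2 : T.tgt e ∈ A)
    (h3 : ∀ e', e' ≠ e → (T.tgt e' ∈ A ↔ T.src e' ∈ A)) : A = T.half e := by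
  classical
  have key := T.eq_of_edge (fun v => (v ∈ A ↔ v ∈ T.half e)) (fun e' => by
    by_cases h : e' = e
    · subst h; simp [h1, h2, src_notMem, tgt_mem]
    · simp only [h3 e' h, T.half_edge h])
  ext v
  have := key v (T.src e)
  simp only [h1, src_notMem] at this
  simpa using this

open Classical in
theorem pot_eq (e : G × ι) (v : V) :
    T.pot v e = T.pot (T.src e) e + if v ∈ T.half e then 1 else 0 := by
  have key := T.eq_of_edge (fun v => T.pot v e -
      (if T.pot v e ≤ T.pot (T.src e) e then T.pot (T.src e) e else T.pot (T.src e) e + 1))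
    (fun e' => by
      by_cases h : e' = e
      · subst h
        have : ¬ (T.pot (T.src e') e' + 1 ≤ T.pot (T.src e') e') := by simp
        rw [pot_tgt_self, if_neg this, if_pos le_rfl]
        simp
      · simp only [T.pot_tgt_of_ne h]) v (T.src e)
  simp only [le_refl, if_true, sub_self, sub_eq_zero] at key
  by_cases h : T.pot v e ≤ T.pot (T.src e) e
  · rw [if_pos h] at key
    simp [half, key]
  · rw [if_neg h] at key
    simp [half, key]

/-- The geodesic from `x` to `y` as a chain. -/
noncomputable def geo (x y : V) : G × ι →₀ ℝ := T.pot y - T.pot x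

open Classical in
theorem geo_apply (x y : V) (e : G × ι) :
    T.geo x y e = (if y ∈ T.half e then 1 else 0) - (if x ∈ T.half e then 1 else 0) := by
  rw [geo, Finsupp.sub_apply, T.pot_eq e x, T.pot_eq e y]; ring

theorem geo_apply_ne_zero {x y : V} {e : G × ι} :
    T.geo x y e ≠ 0 ↔ ¬ (x ∈ T.half e ↔ y ∈ T.half e) := by
  classical
  rw [geo_apply]
  by_cases h : y ∈ T.half e <;> by_cases h' : x ∈ T.half e <;> simp [h, h']

theorem geo_add (x y z : V) : T.geo x y + T.geo y z = T.geo x z := by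
  simp [geo]

theorem geo_self (x : V) : T.geo x x = 0 := by simp [geo]

theorem geo_edge (e : G × ι) : T.geo (T.src e) (T.tgt e) = Finsupp.single e 1 := by
  simp [geo, pot_tgt]

theorem finite_sep (x y : V) : {e | ¬ (x ∈ T.half e ↔ y ∈ T.half e)}.Finite := by
  refine (T.geo x y).hasFiniteSupport.subset fun e he => ?_
  exact T.geo_apply_ne_zero.2 he

/-- The boundary map from edge chains to vertex chains. -/
noncomputable def bd : (G × ι →₀ ℝ) →ₗ[ℝ] (V →₀ ℝ) :=
  Finsupp.linearCombination ℝ fun e => Finsupp.single (T.tgt e) 1 - Finsupp.single (T.src e) 1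

theorem bd_geo (x y : V) : T.bd (T.geo x y) = Finsupp.single y 1 - Finsupp.single x 1 := by
  have := T.eq_of_edge (fun v => T.bd (T.pot v) - Finsupp.single v 1) (fun e => by
    simp only [pot_tgt, map_add]
    simp only [bd, Finsupp.linearCombination_single, one_smul]
    abel) x y
  simp only [geo, map_sub]
  have h2 : T.bd (T.pot x) = T.bd (T.pot y) - Finsupp.single y 1 + Finsupp.single x 1 := by
    rw [← this]; abel
  rw [h2]; abel

theorem exists_sep_incident {x y : V} (h : x ≠ y) :
    ∃ e, ¬ (x ∈ T.half e ↔ y ∈ T.half e) ∧ (T.src e = x ∨ T.tgt e = x) := by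
  classical
  by_contra hc
  push Not at hc
  have h1 : T.bd (T.geo x y) x = -1 := by
    rw [bd_geo]; simp [h.symm]
  have h2 : T.bd (T.geo x y) x = 0 := by
    rw [bd, Finsupp.linearCombination_apply, Finsupp.sum, Finsupp.finsetSum_apply]
    refine Finset.sum_eq_zero fun e he => ?_
    have he' := T.geo_apply_ne_zero.1 (Finsupp.mem_support_iff.1 he)
    obtain ⟨h3, h4⟩ := hc e (by tauto)
    simp [h3, h4]
  rw [h1] at h2
  norm_num at h2


/-- The translate of an edge. -/
def esmul (g : G) (e : G × ι) : G × ι := (g * e.1, e.2)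

theorem esmul_esmul (g h : G) (e : G × ι) : esmul g (esmul h e) = esmul (g * h) e := by
  simp [esmul, mul_assoc]

theorem esmul_one (e : G × ι) : esmul 1 e = e := by simp [esmul]

theorem esmul_eq_self {g : G} {e : G × ι} : esmul g e = e ↔ g = 1 := by
  simp [esmul, Prod.ext_iff]

theorem esmul_injective (g : G) : Function.Injective (esmul g : G × ι → G × ι) := by
  intro e e' h
  simpa [esmul, Prod.ext_iff] using h

theorem smul_src (g : G) (e : G × ι) : g • T.src e = T.src (esmul g e) := by
  simp [src, esmul, mul_smul]

theorem smul_tgt (g : G) (e : G × ι) : g • T.tgt e = T.tgt (esmul g e) := by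
  simp [tgt, esmul, mul_smul]

theorem smul_mem_half {g : G} {e : G × ι} {v : V} :
    g • v ∈ T.half (esmul g e) ↔ v ∈ T.half e := by
  have : {v | g • v ∈ T.half (esmul g e)} = T.half e := by
    refine T.half_unique ?_ ?_ ?_
    · simp [smul_src, src_notMem]
    · simp [smul_tgt, tgt_mem]
    · intro e' he'
      simp only [Set.mem_ofPred_eq, smul_src, smul_tgt]
      exact T.half_edge fun h => he' (esmul_injective g h)
  rw [← this]; rfl

theorem geo_smul_apply (g : G) (x y : V) (e : G × ι) :
    T.geo (g • x) (g • y) (esmul g e) = T.geo x y e := by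
  classical
  simp only [geo_apply, smul_mem_half]

theorem half_const {e e' : G × ι} (hne : e ≠ e') {v w : V}
    (hv : v ∈ T.half e ↔ T.src e' ∉ T.half e) (hw : w ∈ T.half e ↔ T.src e' ∉ T.half e) :
    v ∈ T.half e' ↔ w ∈ T.half e' := by
  classical
  have key : {v | if (v ∈ T.half e ↔ T.src e' ∈ T.half e) then v ∈ T.half e'
      else T.src e ∈ T.half e'} = T.half e' := by
    refine T.half_unique ?_ ?_ ?_
    · simp [src_notMem]
    · simp [tgt_mem, T.half_edge hne.symm]
    · intro e'' he''
      by_cases h : e'' = e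
      · subst h
        simp only [Set.mem_ofPred_eq, T.half_edge he'', ite_self]
      · simp only [Set.mem_ofPred_eq, T.half_edge he'', T.half_edge h]
  have h1 : ∀ v, (v ∈ T.half e ↔ T.src e' ∉ T.half e) →
      (v ∈ T.half e' ↔ T.src e ∈ T.half e') := by
    intro v hv
    conv_lhs => rw [← key]
    have : ¬ (v ∈ T.half e ↔ T.src e' ∈ T.half e) := by tauto
    simp only [Set.mem_ofPred_eq, if_neg this]
  rw [h1 v hv, h1 w hw]

/-- The two sides of an edge. -/
def side (s : (G × ι) × Bool) : Set V := {v | v ∈ T.half s.1 ↔ s.2 = true}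

/-- The translate of a side. -/
def ssmul (g : G) (s : (G × ι) × Bool) : (G × ι) × Bool := (esmul g s.1, s.2)

/-- The opposite side. -/
def opp (s : (G × ι) × Bool) : (G × ι) × Bool := (s.1, !s.2)

theorem side_opp (s : (G × ι) × Bool) : T.side (opp s) = (T.side s)ᶜ := by
  obtain ⟨e, b⟩ := s
  ext v
  cases b <;> simp [side, opp]

theorem ssmul_ssmul (g h : G) (s : (G × ι) × Bool) : ssmul g (ssmul h s) = ssmul (g * h) s := by
  simp [ssmul, esmul_esmul]

theorem ssmul_one (s : (G × ι) × Bool) : ssmul 1 s = s := by simp [ssmul, esmul_one]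

theorem smul_mem_side {g : G} {s : (G × ι) × Bool} {v : V} :
    g • v ∈ T.side (ssmul g s) ↔ v ∈ T.side s := by
  simp [side, ssmul, smul_mem_half]

theorem mem_side_ssmul {g : G} {s : (G × ι) × Bool} {v : V} :
    v ∈ T.side (ssmul g s) ↔ g⁻¹ • v ∈ T.side s := by
  rw [← T.smul_mem_side (g := g) (v := g⁻¹ • v), smul_inv_smul]

theorem side_edge {s : (G × ι) × Bool} {e : G × ι} (h : e ≠ s.1) :
    T.tgt e ∈ T.side s ↔ T.src e ∈ T.side s := by
  simp [side, T.half_edge h]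

theorem side_edge_self (s : (G × ι) × Bool) :
    T.tgt s.1 ∈ T.side s ↔ ¬ T.src s.1 ∈ T.side s := by
  obtain ⟨e, b⟩ := s
  cases b <;> simp [side, src_notMem, tgt_mem]

theorem side_injective : Function.Injective T.side := by
  intro s s' h
  have h1 : s.1 = s'.1 := by
    by_contra hne
    have h2 := T.side_edge hne
    have h3 := T.side_edge_self s
    rw [h] at h3
    tauto
  obtain ⟨e, b⟩ := s
  obtain ⟨e', b'⟩ := s'
  simp only at h1
  subst h1
  have h1 := (Set.ext_iff.1 h (T.src e))
  have h2 := T.src_notMem e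
  have h3 : (false = b) ↔ (false = b') := by
    simp only [side, Set.mem_ofPred_eq, h2, false_iff] at h1
    cases b <;> cases b' <;> simp at h1 <;> simp
  cases b <;> cases b' <;> simp at h3 <;> rfl

theorem side_subset_ssmul {s s' : (G × ι) × Bool} (g : G) (h : T.side s ⊆ T.side s') :
    T.side (ssmul g s) ⊆ T.side (ssmul g s') := by
  intro v hv
  rw [mem_side_ssmul] at hv ⊢
  exact h hv

theorem side_ssubset_ssmul {s s' : (G × ι) × Bool} (g : G) (h : T.side s ⊂ T.side s') :
    T.side (ssmul g s) ⊂ T.side (ssmul g s') := by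
  refine ⟨T.side_subset_ssmul g h.1, fun h2 => h.2 ?_⟩
  have := T.side_subset_ssmul g⁻¹ h2
  simpa [ssmul_ssmul, ssmul_one] using this

theorem side_nested {s s' : (G × ι) × Bool} (h : s.1 ≠ s'.1) :
    T.side s ⊆ T.side s' ∨ T.side s ⊆ (T.side s')ᶜ ∨ (T.side s)ᶜ ⊆ T.side s' ∨
      T.side s' ⊆ T.side s := by
  have key : ∀ v w : V, (v ∈ T.side s ↔ T.src s'.1 ∉ T.side s) →
      (w ∈ T.side s ↔ T.src s'.1 ∉ T.side s) → (v ∈ T.side s' ↔ w ∈ T.side s') := by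
    intro v w hv hw
    have := T.half_const h (v := v) (w := w)
    obtain ⟨e, b⟩ := s
    obtain ⟨e', b'⟩ := s'
    cases b <;> cases b' <;> simp only [side, Set.mem_ofPred_eq] at * <;> grind
  by_cases hs : T.src s'.1 ∈ T.side s
  · by_cases hx : ∃ x, x ∉ T.side s ∧ x ∈ T.side s'
    · obtain ⟨x, hx1, hx2⟩ := hx
      right; right; left
      intro v hv
      exact (key v x (by simp only [Set.mem_compl_iff] at hv; tauto) (by tauto)).2 hx2
    · right; right; right
      intro v hv
      by_contra h1
      exact hx ⟨v, h1, hv⟩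
  · by_cases hx : ∃ x, x ∈ T.side s ∧ x ∈ T.side s'
    · obtain ⟨x, hx1, hx2⟩ := hx
      left
      intro v hv
      exact (key v x (by tauto) (by tauto)).2 hx2
    · right; left
      intro v hv h1
      exact hx ⟨v, hv, h1⟩

theorem finite_side_sep (x y : V) : {s | x ∈ T.side s ∧ y ∉ T.side s}.Finite := by
  refine (((T.finite_sep x y).prod (Set.finite_univ (α := Bool)))).subset ?_
  rintro ⟨e, b⟩ ⟨h1, h2⟩
  simp only [side, Set.mem_ofPred_eq, Set.mem_prod, Set.mem_univ, and_true] at *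
  tauto

theorem exists_side {x y : V} (h : x ≠ y) : ∃ s, x ∈ T.side s ∧ y ∉ T.side s ∧
    (T.src s.1 = y ∨ T.tgt s.1 = y) := by
  obtain ⟨e, he, hi⟩ := T.exists_sep_incident h.symm
  by_cases hx : x ∈ T.half e
  · exact ⟨(e, true), by simp [side, hx], by simp [side]; tauto, hi⟩
  · exact ⟨(e, false), by simp [side, hx], by simp [side]; tauto, hi⟩

theorem eq_one_of_ssmul {g : G} {s : (G × ι) × Bool} (h : T.side (ssmul g s) = T.side s) :
    g = 1 := by
  have := T.side_injective h
  exact esmul_eq_self.1 (congrArg Prod.fst this)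

theorem eq_one_of_fix_two (T : FreeTree G V ι) {g : G} {x y : V} (hx : g • x = x)
    (hy : g • y = y) (hxy : x ≠ y) :
    g = 1 := by
  obtain ⟨s0, hs0⟩ := T.exists_side hxy.symm
  have hfin : (T.side '' {s | y ∈ T.side s ∧ x ∉ T.side s}).Finite :=
    (T.finite_side_sep y x).image _
  obtain ⟨A, hA⟩ := hfin.exists_minimal ⟨_, s0, ⟨hs0.1, hs0.2.1⟩, rfl⟩
  obtain ⟨⟨s, hs, rfl⟩, hmin⟩ := hA
  have hmem : ∀ {k : G}, k • x = x → k • y = y → T.side (ssmul k s) ∈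
      T.side '' {s | y ∈ T.side s ∧ x ∉ T.side s} := by
    intro k hkx hky
    refine ⟨_, ⟨?_, ?_⟩, rfl⟩
    · rw [← hky, smul_mem_side]; exact hs.1
    · rw [← hkx, smul_mem_side]; exact hs.2
  by_cases hne : (ssmul g s).1 = s.1
  · exact esmul_eq_self.1 hne
  have h1 := hmem hx hy
  have hgx : g⁻¹ • x = x := by rw [inv_smul_eq_iff, hx]
  have hgy : g⁻¹ • y = y := by rw [inv_smul_eq_iff, hy]
  have h2 := hmem hgx hgy
  rcases T.side_nested hne with h | h | h | h
  · exact T.eq_one_of_ssmul (h.antisymm (hmin h1 h))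
  · obtain ⟨-, -⟩ := h1
    have : y ∈ T.side (ssmul g s) := by rw [← hy, smul_mem_side]; exact hs.1
    exact absurd hs.1 (h this)
  · have : x ∉ T.side (ssmul g s) := by rw [← hx, smul_mem_side]; exact hs.2
    exact absurd (h this) hs.2
  · have h3 := T.side_subset_ssmul g⁻¹ h
    simp only [ssmul_ssmul, inv_mul_cancel, ssmul_one] at h3
    exact inv_eq_one.1 (T.eq_one_of_ssmul (h3.antisymm (hmin h2 h3)))

theorem pow_ssubset {g : G} {s : (G × ι) × Bool} (h : T.side (ssmul g s) ⊂ T.side s) :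
    ∀ N : ℕ, T.side (ssmul (g ^ (N + 1)) s) ⊂ T.side s := by
  intro N
  induction N with
  | zero => simpa using h
  | succ N ih =>
    have := T.side_ssubset_ssmul g ih
    rw [ssmul_ssmul, ← pow_succ'] at this
    exact this.trans h

theorem pow_ne_one_of_ssubset {g : G} {s : (G × ι) × Bool}
    (h : T.side (ssmul g s) ⊂ T.side s) (N : ℕ) : g ^ (N + 1) ≠ 1 := by
  intro h1
  have := T.pow_ssubset h N
  rw [h1, ssmul_one] at this
  exact this.2 subset_rfl

theorem zpow_subset {g : G} {s : (G × ι) × Bool} (h : T.side (ssmul g s) ⊂ T.side s)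
    {a b : ℤ} (hab : a ≤ b) : T.side (ssmul (g ^ b) s) ⊆ T.side (ssmul (g ^ a) s) := by
  obtain ⟨N, rfl⟩ := Int.le.dest hab
  rcases N with _ | N
  · simp
  · have := T.side_subset_ssmul (g ^ a) (T.pow_ssubset h N).1
    rw [ssmul_ssmul] at this
    rw [zpow_add, zpow_natCast]
    exact this

theorem zpow_injective {g : G} {s : (G × ι) × Bool} (h : T.side (ssmul g s) ⊂ T.side s) :
    Function.Injective fun a : ℤ => ssmul (g ^ a) s := by
  have hinf : ¬ IsOfFinOrder g := by
    rw [isOfFinOrder_iff_pow_eq_one]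
    rintro ⟨n, hn, h1⟩
    obtain ⟨N, rfl⟩ : ∃ N, n = N + 1 := ⟨n - 1, by omega⟩
    exact T.pow_ne_one_of_ssubset h N h1
  intro a b hab
  have h1 : g ^ a = g ^ b := by
    have := congrArg (fun s => s.1.1) hab
    simpa [ssmul, esmul] using this
  exact injective_zpow_iff_not_isOfFinOrder.2 hinf h1

theorem exists_zpow_mem {g : G} {s : (G × ι) × Bool} (h : T.side (ssmul g s) ⊂ T.side s) (x : V) :
    (∃ N : ℕ, x ∈ T.side (ssmul (g ^ (-(N : ℤ))) s)) ∧ ∃ N : ℕ, x ∉ T.side (ssmul (g ^ N) s) := by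
  obtain ⟨b, hb, hb'⟩ := Set.exists_of_ssubset h
  have hgb : g • b ∈ T.side (ssmul g s) := T.smul_mem_side.2 hb
  constructor
  · by_contra hc
    push Not at hc
    have hinf : (Set.range fun N : ℕ => ssmul (g ^ (-(N : ℤ))) s).Infinite :=
      Set.infinite_range_of_injective fun N M hNM => by
        have := T.zpow_injective h hNM
        omega
    refine hinf ((T.finite_side_sep b x).subset ?_)
    rintro _ ⟨N, rfl⟩
    refine ⟨?_, hc N⟩
    have := T.zpow_subset h (a := -(N : ℤ)) (b := 0) (by omega)
    simp only [zpow_zero, ssmul_one] at this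
    exact this hb
  · by_contra hc
    push Not at hc
    have hinf : (Set.range fun N : ℕ => ssmul (g ^ (N + 1)) s).Infinite :=
      Set.infinite_range_of_injective fun N M hNM => by
        have := T.zpow_injective h (a₁ := (N + 1 : ℕ)) (a₂ := (M + 1 : ℕ))
          (by simpa only [zpow_natCast] using hNM)
        omega
    refine hinf ((T.finite_side_sep x b).subset ?_)
    rintro _ ⟨N, rfl⟩
    refine ⟨hc _, fun h1 => hb' ?_⟩
    have := T.zpow_subset h (a := 1) (b := (N + 1 : ℕ)) (by push_cast; omega)
    simp only [zpow_one, zpow_natCast] at this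
    exact this h1

theorem not_fix_of_ssubset {g : G} {s : (G × ι) × Bool} (h : T.side (ssmul g s) ⊂ T.side s)
    (x : V) : g • x ≠ x := by
  intro hx
  obtain ⟨⟨N, hN⟩, M, hM⟩ := T.exists_zpow_mem h x
  have hz : ∀ z : ℤ, (g ^ z) • x = x := fun z =>
    (MulAction.stabilizer G x).zpow_mem (MulAction.mem_stabilizer_iff.2 hx) z
  have h1 : x ∈ T.side s := by
    rw [mem_side_ssmul, ← zpow_neg, hz] at hN
    exact hN
  rw [mem_side_ssmul, ← zpow_natCast, ← zpow_neg, hz] at hM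
  exact hM h1

theorem eventually_mem_side {g : G} {s : (G × ι) × Bool} (h : T.side (ssmul g s) ⊂ T.side s)
    (x : V) : ∃ N₀ : ℕ, ∀ N : ℕ, N₀ ≤ N →
      (g ^ N) • x ∈ T.side s ∧ (g⁻¹ ^ N) • x ∉ T.side s := by
  obtain ⟨⟨N, hN⟩, M, hM⟩ := T.exists_zpow_mem h x
  refine ⟨max N M, fun k hk => ⟨?_, fun hk' => hM ?_⟩⟩
  · have := T.zpow_subset h (a := -(k : ℤ)) (b := -(N : ℤ)) (by omega) hN
    simpa [mem_side_ssmul] using this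
  · have h1 : x ∈ T.side (ssmul (g ^ (k : ℤ)) s) := by
      simpa [mem_side_ssmul] using hk'
    have := T.zpow_subset h (a := (M : ℤ)) (b := (k : ℤ)) (by omega) h1
    simpa using this

theorem exists_ssubset_of_not_fix {g : G} (hg : ∀ v : V, g • v ≠ v) :
    ∃ s, T.side (ssmul g s) ⊂ T.side s := by
  classical
  set F : V → Set (G × ι) := fun v => {e | ¬ (v ∈ T.half e ↔ g • v ∈ T.half e)} with hF
  have hfin : ∀ v, (F v).Finite := fun v => T.finite_sep _ _
  have hmin : ∃ v, ∀ v', (F v).ncard ≤ (F v').ncard := by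
    have := (measure fun v => (F v).ncard).wf.has_min Set.univ ⟨T.o, trivial⟩
    obtain ⟨v, -, hv⟩ := this
    exact ⟨v, fun v' => not_lt.1 (hv v' trivial)⟩
  obtain ⟨v, hv⟩ := hmin
  obtain ⟨s, hs1, hs2, hs3⟩ := T.exists_side (hg v)
  have hg1 : g ≠ 1 := fun h => hg v (by simp [h])
  have hne : (ssmul g s).1 ≠ s.1 := fun h => hg1 (esmul_eq_self.1 h)
  obtain ⟨v1, hv1, hsame⟩ : ∃ v1, v1 ∈ T.side s ∧ ∀ s' : (G × ι) × Bool, s'.1 ≠ s.1 →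
      (v1 ∈ T.side s' ↔ v ∈ T.side s') := by
    have h1 := T.side_edge_self s
    rcases hs3 with h | h
    · refine ⟨T.tgt s.1, ?_, fun s' hs' => ?_⟩
      · rw [h] at h1; tauto
      · rw [T.side_edge hs'.symm, h]
    · refine ⟨T.src s.1, ?_, fun s' hs' => ?_⟩
      · rw [h] at h1; tauto
      · rw [← T.side_edge hs'.symm, h]
  have hsame' : ∀ s' : (G × ι) × Bool, s'.1 ≠ (ssmul g s).1 →
      (g • v1 ∈ T.side s' ↔ g • v ∈ T.side s') := by
    intro s' hs'
    have h1 : (ssmul g⁻¹ s').1 ≠ s.1 := by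
      intro h
      apply hs'
      have : s' = ssmul g (ssmul g⁻¹ s') := by simp [ssmul_ssmul, ssmul_one]
      rw [this]
      simp only [ssmul] at h ⊢
      rw [h]
    have := hsame _ h1
    rwa [mem_side_ssmul, mem_side_ssmul, inv_inv] at this
  have hgv1 : g • v1 ∈ T.side (ssmul g s) := T.smul_mem_side.2 hv1
  have hgv : g • v ∉ T.side (ssmul g s) := fun h => hs2 (T.smul_mem_side.1 h)
  rcases T.side_nested hne.symm with h | h | h | h
  · exact absurd (h hs1) hgv
  · have h1 := (hsame' s hne.symm).2 hs1
    exact absurd hgv1 (h h1)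
  · exfalso
    have hvg : v ∈ T.side (ssmul g s) := h hs2
    have hsub : F v1 ⊆ F v \ {s.1} := by
      intro e he
      have he2 : ¬ (v1 ∈ T.side (e, true) ↔ g • v1 ∈ T.side (e, true)) := by
        simpa [side, hF] using he
      have hes : e ≠ s.1 := by
        rintro rfl
        have h1 : g • v1 ∈ T.side s := (hsame' s hne.symm).2 hs1
        apply he2
        revert h1 hv1
        obtain ⟨e, b⟩ := s
        cases b <;> simp [side] <;> tauto
      refine ⟨?_, hes⟩
      by_cases heg : e = (ssmul g s).1
      · subst heg
        intro h2
        revert hvg hgv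
        generalize ssmul g s = r at *
        obtain ⟨e, b⟩ := r
        cases b <;> simp [side] <;> tauto
      · have h1 := hsame (e, true) hes
        have h2 := hsame' (e, true) heg
        rw [h1, h2] at he2
        simpa [side, hF] using he2
    have hmem : s.1 ∈ F v := by
      revert hs1 hs2
      obtain ⟨e, b⟩ := s
      cases b <;> simp [side, hF] <;> tauto
    have h1 := Set.ncard_le_ncard hsub ((hfin v).sdiff)
    have h2 := Set.ncard_sdiff_singleton_lt_of_mem hmem (hfin v)
    have := hv v1
    omega
  · exact ⟨s, h, fun h2 => hgv (h2 hs1)⟩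

theorem disjoint_ssmul_of_fix {g : G} (hg : g ≠ 1) {x : V} (hx : g • x = x)
    {s : (G × ι) × Bool} (hs : x ∉ T.side s) : T.side (ssmul g s) ⊆ (T.side s)ᶜ := by
  have hne : (ssmul g s).1 ≠ s.1 := fun h => hg (esmul_eq_self.1 h)
  have hxs : x ∉ T.side (ssmul g s) := by rw [← hx, smul_mem_side]; exact hs
  rcases T.side_nested hne with h | h | h | h
  · exact absurd hx (T.not_fix_of_ssubset
      (h.ssubset_of_ne fun h' => hne (congrArg Prod.fst (T.side_injective h'))) x)
  · exact h
  · exact absurd (h hxs) hs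
  · have h3 := T.side_ssubset_ssmul g⁻¹
      (h.ssubset_of_ne fun h' => hne (congrArg Prod.fst (T.side_injective h'.symm)))
    simp only [ssmul_ssmul, inv_mul_cancel, ssmul_one] at h3
    exact absurd (by rw [inv_smul_eq_iff, hx]) (T.not_fix_of_ssubset h3 x)

theorem mul_not_fix (T : FreeTree G V ι) {g g' : G} (hg : g ≠ 1) (hg' : g' ≠ 1) {x y : V}
    (hx : g • x = x)
    (hy : g' • y = y) (hxy : x ≠ y) (z : V) : (g * g') • z ≠ z := by
  obtain ⟨s, hs1, hs2, -⟩ := T.exists_side hxy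
  have h1 : T.side (ssmul g' s) ⊆ T.side (opp s) := by
    rw [side_opp]; exact T.disjoint_ssmul_of_fix hg' hy hs2
  have h2 : T.side (ssmul g (opp s)) ⊆ T.side s := by
    have := T.disjoint_ssmul_of_fix hg hx (s := opp s) (by simp [side_opp, hs1])
    simpa [side_opp] using this
  have h3 : T.side (ssmul (g * g') s) ⊆ T.side s := by
    rw [← ssmul_ssmul]
    exact (T.side_subset_ssmul g h1).trans h2
  refine T.not_fix_of_ssubset (h3.ssubset_of_ne fun h => ?_) z
  have h4 := T.eq_one_of_ssmul h
  have h5 : g' = g⁻¹ := (inv_eq_of_mul_eq_one_right h4).symm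
  rw [h5, inv_smul_eq_iff] at hy
  exact hg (T.eq_one_of_fix_two hx hy.symm hxy)

end FreeTree

namespace FreeTree

variable {G V ι : Type} [Group G] [MulAction G V]

/-- A connected transversal for the orbits of a subgroup acting on a tree. -/
structure Transversal (T : FreeTree G V ι) (H : Subgroup G) where
  Y : Set V
  τ : V → G
  rep : V → V
  o_mem : T.o ∈ Y
  inj : ∀ y ∈ Y, ∀ y' ∈ Y, ∀ h ∈ H, h • y = y' → y = y'
  conn : ∀ Q : V → Prop, Q T.o →
    (∀ e, T.src e ∈ Y → T.tgt e ∈ Y → (Q (T.src e) ↔ Q (T.tgt e))) → ∀ y ∈ Y, Q y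
  τ_mem : ∀ v, τ v ∈ H
  rep_mem : ∀ v, rep v ∈ Y
  τ_smul_rep : ∀ v, τ v • rep v = v
  τ_of_mem : ∀ y ∈ Y, τ y = 1

theorem exists_transversal (T : FreeTree G V ι) (H : Subgroup G) : Nonempty (T.Transversal H) := by
  classical
  let S : Set (Set V) := {Y | T.o ∈ Y ∧ (∀ y ∈ Y, ∀ y' ∈ Y, ∀ h ∈ H, h • y = y' → y = y') ∧
    ∀ Q : V → Prop, Q T.o →
    (∀ e, T.src e ∈ Y → T.tgt e ∈ Y → (Q (T.src e) ↔ Q (T.tgt e))) → ∀ y ∈ Y, Q y}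
  have h0 : {T.o} ∈ S := by
    refine ⟨rfl, ?_, ?_⟩
    · rintro y rfl y' rfl; simp
    · rintro Q hQ - y rfl; exact hQ
  obtain ⟨Y, hYo, hY⟩ := zorn_subset_nonempty S (fun c hc hchain hne => by
    refine ⟨⋃₀ c, ⟨?_, ?_, ?_⟩, fun s hs => Set.subset_sUnion_of_mem hs⟩
    · obtain ⟨A, hA⟩ := hne
      exact ⟨A, hA, (hc hA).1⟩
    · rintro y ⟨A, hA, hy⟩ y' ⟨B, hB, hy'⟩ h hh heq
      rcases hchain.total hA hB with hAB | hAB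
      · exact (hc hB).2.1 y (hAB hy) y' hy' h hh heq
      · exact (hc hA).2.1 y hy y' (hAB hy') h hh heq
    · rintro Q hQ hQe y ⟨A, hA, hy⟩
      exact (hc hA).2.2 Q hQ (fun e h1 h2 => hQe e ⟨A, hA, h1⟩ ⟨A, hA, h2⟩) y hy) _ h0
  obtain ⟨⟨hYo', hYinj, hYconn⟩, hmax⟩ := hY
  have hadd : ∀ e, (T.src e ∈ Y ∨ T.tgt e ∈ Y) → ∀ v, (v = T.src e ∨ v = T.tgt e) →
      ∃ h ∈ H, ∃ y ∈ Y, h • y = v := by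
    intro e he v hv
    by_contra hc
    push Not at hc
    have hvY : v ∉ Y := fun h => hc 1 H.one_mem v h (one_smul _ _)
    have hS : insert v Y ∈ S := by
      refine ⟨Or.inr hYo', ?_, ?_⟩
      · rintro y (rfl | hy) y' (rfl | hy') h hh heq
        · rfl
        · exact absurd (by rw [← heq, inv_smul_smul]) (hc h⁻¹ (H.inv_mem hh) y' hy')
        · exact absurd heq (hc h hh y hy)
        · exact hYinj y hy y' hy' h hh heq
      · rintro Q hQ hQe
        have h1 : ∀ y ∈ Y, Q y := hYconn Q hQ fun e h1 h2 => hQe e (Or.inr h1) (Or.inr h2)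
        rintro y (rfl | hy)
        · rcases hv with hv | hv
          · rw [hv]
            have h2 : T.tgt e ∈ Y := by
              rcases he with he | he
              · exact absurd (hv ▸ he) hvY
              · exact he
            exact (hQe e (Or.inl hv.symm) (Or.inr h2)).2 (h1 _ h2)
          · rw [hv]
            have h2 : T.src e ∈ Y := by
              rcases he with he | he
              · exact he
              · exact absurd (hv ▸ he) hvY
            exact (hQe e (Or.inr h2) (Or.inl hv.symm)).1 (h1 _ h2)
        · exact h1 y hy
    exact hvY (hmax hS (Set.subset_insert _ _) (Set.mem_insert _ _))
  have hall : ∀ v, ∃ h ∈ H, ∃ y ∈ Y, h • y = v := by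
    refine T.conn _ ⟨1, H.one_mem, T.o, hYo', one_smul _ _⟩ fun g i => ?_
    have key : ∀ h ∈ H, (h • T.src (esmul h⁻¹ (g, i)) = g • T.o) ∧
        (h • T.tgt (esmul h⁻¹ (g, i)) = g • T.t i) := by
      intro h _
      rw [smul_src, smul_tgt, esmul_esmul]
      simp [esmul_one, src, tgt]
    constructor
    · rintro ⟨h, hh, y, hy, heq⟩
      have hk := key h hh
      have h1 : T.src (esmul h⁻¹ (g, i)) = y := by
        rw [← heq] at hk
        exact smul_left_cancel h hk.1
      obtain ⟨h', hh', y', hy', h2⟩ := hadd _ (Or.inl (h1 ▸ hy)) _ (Or.inr rfl)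
      exact ⟨h * h', H.mul_mem hh hh', y', hy', by rw [mul_smul, h2, hk.2]⟩
    · rintro ⟨h, hh, y, hy, heq⟩
      have hk := key h hh
      have h1 : T.tgt (esmul h⁻¹ (g, i)) = y := by
        rw [← heq] at hk
        exact smul_left_cancel h hk.2
      obtain ⟨h', hh', y', hy', h2⟩ := hadd _ (Or.inr (h1 ▸ hy)) _ (Or.inl rfl)
      exact ⟨h * h', H.mul_mem hh hh', y', hy', by rw [mul_smul, h2, hk.1]⟩
  have hall' : ∀ v, ∃ h ∈ H, ∃ y ∈ Y, h • y = v ∧ (v ∈ Y → h = 1) := by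
    intro v
    by_cases hv : v ∈ Y
    · exact ⟨1, H.one_mem, v, hv, one_smul _ _, fun _ => rfl⟩
    · obtain ⟨h, hh, y, hy, heq⟩ := hall v
      exact ⟨h, hh, y, hy, heq, fun h => absurd h hv⟩
  choose τ hτ rep hrep heq h1 using hall'
  exact ⟨⟨Y, τ, rep, hYo', hYinj, hYconn, hτ, hrep, heq, h1⟩⟩

namespace Transversal

variable {T : FreeTree G V ι} {H : Subgroup G} (R : T.Transversal H)

theorem rep_smul {h : G} (hh : h ∈ H) (v : V) : R.rep (h • v) = R.rep v := by
  refine (R.inj _ (R.rep_mem v) _ (R.rep_mem (h • v)) ((R.τ (h • v))⁻¹ * (h * R.τ v))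
    (H.mul_mem (H.inv_mem (R.τ_mem _)) (H.mul_mem hh (R.τ_mem v))) ?_).symm
  rw [mul_smul, mul_smul, R.τ_smul_rep, inv_smul_eq_iff, R.τ_smul_rep]

theorem rep_of_mem {y : V} (hy : y ∈ R.Y) : R.rep y = y := by
  have := R.τ_smul_rep y
  rwa [R.τ_of_mem y hy, one_smul] at this

theorem τ_smul_src {h : G} (hh : h ∈ H) (e : G × ι) :
    R.τ (h • T.src e) = h * R.τ (T.src e) := by
  have h1 : R.τ (h • T.src e) • R.rep (T.src e) = h • T.src e := by
    rw [← R.rep_smul hh, R.τ_smul_rep]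
  have h2 : (h * R.τ (T.src e)) • R.rep (T.src e) = h • T.src e := by
    rw [mul_smul, R.τ_smul_rep]
  set k := R.τ (T.src e)
  have h3 : R.rep (T.src e) = k⁻¹ • T.src e := by rw [eq_inv_smul_iff, R.τ_smul_rep]
  have h4 : (e.1⁻¹ * k * (h * k)⁻¹ * R.τ (h • T.src e) * k⁻¹ * e.1) • T.o = T.o := by
    have : e.1 • T.o = T.src e := rfl
    simp only [mul_smul, this]
    rw [← h3, h1, ← h2, inv_smul_smul, R.τ_smul_rep, ← this, inv_smul_smul]
  have h5 := T.free _ h4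
  have : R.τ (h • T.src e) = (h * k) * k⁻¹ * e.1 *
      (e.1⁻¹ * k * (h * k)⁻¹ * R.τ (h • T.src e) * k⁻¹ * e.1) * e.1⁻¹ * k := by group
  rw [this, h5]; group

theorem o_eq : T.o = R.rep T.o := (R.rep_of_mem R.o_mem).symm

theorem τ_o {h : G} (hh : h ∈ H) : R.τ (h • T.o) = h := by
  have h1 := R.τ_smul_rep (h • T.o)
  rw [R.rep_smul hh, R.rep_of_mem R.o_mem] at h1
  have h2 : (h⁻¹ * R.τ (h • T.o)) • T.o = T.o := by rw [mul_smul, h1, inv_smul_smul]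
  have := T.free _ h2
  rw [inv_mul_eq_one] at this
  exact this.symm

theorem mem_stab (v : V) {h : G} (hh : h ∈ H) : (R.τ v)⁻¹ * h⁻¹ * R.τ (h • v) ∈ H ∧
    ((R.τ v)⁻¹ * h⁻¹ * R.τ (h • v)) • R.rep v = R.rep v := by
  refine ⟨H.mul_mem (H.mul_mem (H.inv_mem (R.τ_mem _)) (H.inv_mem hh)) (R.τ_mem _), ?_⟩
  rw [mul_smul, mul_smul]
  conv_lhs => rw [← R.rep_smul hh v, R.τ_smul_rep]
  rw [inv_smul_smul, inv_smul_eq_iff, R.τ_smul_rep]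

theorem le_of_generators (S : Subgroup G)
    (h1 : ∀ y ∈ R.Y, ∀ a ∈ H, a • y = y → a ∈ S)
    (h2 : ∀ l, T.src l ∈ R.Y → R.τ (T.tgt l) ∈ S) : H ≤ S := by
  have key : ∀ v, R.τ v ∈ S := by
    refine T.conn _ ?_ fun g i => ?_
    · rw [R.τ_of_mem _ R.o_mem]; exact S.one_mem
    · set k := R.τ (g • T.o) with hk
      set l : G × ι := esmul k⁻¹ (g, i) with hl
      have hsrc : T.src l ∈ R.Y := by
        rw [hl, ← smul_src]
        have : k⁻¹ • T.src (g, i) = R.rep (g • T.o) := by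
          rw [inv_smul_eq_iff, R.τ_smul_rep]; rfl
        rw [this]; exact R.rep_mem _
      have htgt : k • T.tgt l = g • T.t i := by
        rw [hl, smul_tgt, esmul_esmul]; simp [esmul_one, tgt]
      have h3 := R.mem_stab (T.tgt l) (R.τ_mem (g • T.o))
      rw [← hk, htgt] at h3
      have h4 := h1 _ (R.rep_mem _) _ h3.1 h3.2
      have h5 := h2 l hsrc
      have h6 : R.τ (g • T.t i) = k * (R.τ (T.tgt l) *
        ((R.τ (T.tgt l))⁻¹ * k⁻¹ * R.τ (g • T.t i))) := by group
      rw [h6]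
      exact (S.mul_mem_cancel_right (S.mul_mem h5 h4)).symm
  intro h hh
  rw [← R.τ_o hh]
  exact key _

theorem exists_hom {K : Type} [Group K] (j : V → G → K)
    (hj : ∀ y ∈ R.Y, ∀ a ∈ H, ∀ b ∈ H, a • y = y → b • y = y → j y (a * b) = j y a * j y b)
    (x : G × ι → K) (hx : ∀ e, T.src e ∈ R.Y → T.tgt e ∈ R.Y → x e = 1) :
    ∃ μ : H →* K, (∀ y ∈ R.Y, ∀ a : H, (a : G) • y = y → μ a = j y a) ∧
      ∀ l, T.src l ∈ R.Y → μ ⟨R.τ (T.tgt l), R.τ_mem _⟩ = x l := by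
  have hj1 : ∀ y ∈ R.Y, j y 1 = 1 := by
    intro y hy
    have := hj y hy 1 H.one_mem 1 H.one_mem (one_smul _ _) (one_smul _ _)
    simpa using this
  let l' : G → ι → G × ι := fun g i => esmul (R.τ (g • T.o))⁻¹ (g, i)
  let b : G → ι → K := fun g i => x (l' g i) * j (R.rep (T.tgt (l' g i)))
    ((R.τ (T.tgt (l' g i)))⁻¹ * (R.τ (g • T.o))⁻¹ * R.τ (g • T.t i))
  obtain ⟨β₀, hβ₀⟩ := T.integ K b
  let β : V → K := fun v => (β₀ T.o)⁻¹ * β₀ v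
  have hβo : β T.o = 1 := by simp [β]
  have hβ : ∀ g i, β (g • T.t i) = β (g • T.o) * b g i := by
    intro g i; simp only [β, hβ₀, mul_assoc]
  clear_value β
  have hl'tgt : ∀ g i, R.τ (g • T.o) • T.tgt (l' g i) = g • T.t i := by
    intro g i
    simp only [l', smul_tgt, esmul_esmul]; simp [esmul_one, tgt]
  have key : ∀ h ∈ H, ∀ v, β (h • v) = β (h • T.o) * β v *
      j (R.rep v) ((R.τ v)⁻¹ * h⁻¹ * R.τ (h • v)) := by
    intro h hh
    refine T.conn _ ?_ fun g i => ?_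
    · rw [R.τ_o hh, R.τ_of_mem _ R.o_mem, hβo]
      simp [hj1 _ (R.rep_mem _)]
    · have hτ : R.τ (h • g • T.o) = h * R.τ (g • T.o) := R.τ_smul_src hh (g, i)
      have hl : l' (h * g) i = l' g i := by
        simp only [l', mul_smul, hτ]
        simp [esmul, mul_assoc]
      have h1 : (R.τ (g • T.o))⁻¹ * h⁻¹ * R.τ (h • g • T.o) = 1 := by rw [hτ]; group
      have h2 := hβ (h * g) i
      simp only [mul_smul] at h2
      have h3 := hβ g i
      have hrep : R.rep (T.tgt (l' g i)) = R.rep (g • T.t i) := by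
        rw [← hl'tgt g i, R.rep_smul (R.τ_mem _)]
      have h4 : b (h * g) i = b g i * j (R.rep (g • T.t i))
          ((R.τ (g • T.t i))⁻¹ * h⁻¹ * R.τ (h • g • T.t i)) := by
        have h5 := R.mem_stab (g • T.t i) hh
        have h6 := R.mem_stab (T.tgt (l' g i)) (R.τ_mem (g • T.o))
        rw [hl'tgt] at h6
        simp only [b, hl, mul_smul, hτ, mul_assoc (x _)]
        congr 1
        rw [hrep] at h6 ⊢
        rw [← hj _ (R.rep_mem _) _ h6.1 _ h5.1 h6.2 h5.2]
        congr 1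
        group
      rw [h1, hj1 _ (R.rep_mem _), mul_one, h2, h3, h4]
      have aux : ∀ a b c B J : K, a = b * c ↔ a * (B * J) = b * (c * B) * J := by
        intro a b c B J
        rw [mul_assoc b, mul_assoc c, ← mul_assoc b c, mul_left_inj]
      exact aux _ _ _ _ _
  have hY : ∀ y ∈ R.Y, β y = 1 := by
    refine R.conn _ hβo fun e h1 h2 => ?_
    have h3 := hβ e.1 e.2
    have h4 : b e.1 e.2 = 1 := by
      have hs : R.τ (e.1 • T.o) = 1 := R.τ_of_mem _ h1
      have hl : l' e.1 e.2 = e := by simp [l', hs, esmul_one]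
      have ht : R.τ (e.1 • T.t e.2) = 1 := R.τ_of_mem _ h2
      have ht' : R.τ (T.tgt e) = 1 := R.τ_of_mem _ h2
      simp only [b, hl, hs, ht, ht', hx e h1 h2]
      simp [hj1 _ (R.rep_mem _)]
    rw [h4, mul_one] at h3
    simp only [src, tgt, h3]
  refine ⟨{ toFun := fun h => β ((h : G) • T.o), map_one' := by simp [hβo],
            map_mul' := fun h h' => ?_ }, ?_, ?_⟩
  · have := key h h.2 ((h' : G) • T.o)
    rw [R.τ_o h'.2, ← mul_smul, R.τ_o (H.mul_mem h.2 h'.2)] at this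
    simp only [Subgroup.coe_mul, this]
    have h1 : ((h' : G)⁻¹ * (h : G)⁻¹ * (h * h')) = 1 := by group
    rw [h1, hj1 _ (R.rep_mem _), mul_one]
  · intro y hy a ha
    have h1 := key a a.2 y
    rw [ha, hY y hy, R.τ_of_mem y hy, R.rep_of_mem hy] at h1
    simp only [inv_one, one_mul, mul_one] at h1
    have h2 := hj y hy a a.2 (a⁻¹ : H) (a⁻¹ : H).2 ha (by simp [inv_smul_eq_iff, ha])
    simp only [InvMemClass.coe_inv, mul_inv_cancel, hj1 y hy] at h2
    simp only [MonoidHom.coe_mk, OneHom.coe_mk]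
    rw [eq_comm, mul_eq_one_iff_eq_inv] at h1
    rw [eq_comm, mul_eq_one_iff_eq_inv] at h2
    rw [h1, h2]
  · intro l hl
    simp only [MonoidHom.coe_mk, OneHom.coe_mk]
    have h1 := key _ (R.τ_mem (T.tgt l)) (R.rep (T.tgt l))
    rw [R.τ_smul_rep, R.τ_of_mem _ (R.rep_mem _), hY _ (R.rep_mem _)] at h1
    have h2 : (1 : G)⁻¹ * (R.τ (T.tgt l))⁻¹ * R.τ (T.tgt l) = 1 := by group
    rw [h2, hj1 _ (R.rep_mem _), mul_one, mul_one] at h1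
    rw [← h1]
    have h3 := hβ l.1 l.2
    have hs : R.τ (l.1 • T.o) = 1 := R.τ_of_mem _ hl
    have hs' : β (l.1 • T.o) = 1 := hY _ hl
    have hl' : l' l.1 l.2 = l := by simp [l', hs, esmul_one]
    rw [hs', one_mul] at h3
    have h4 : β (T.tgt l) = b l.1 l.2 := h3
    rw [h4]
    simp only [b, hl', hs]
    have h5 : (R.τ (T.tgt l))⁻¹ * (1 : G)⁻¹ * R.τ (l.1 • T.t l.2) = 1 := by
      change (R.τ (T.tgt l))⁻¹ * (1 : G)⁻¹ * R.τ (T.tgt l) = 1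
      group
    rw [h5, hj1 _ (R.rep_mem _), mul_one]

open Classical in
theorem exists_mulEquiv {α β : Type} (A : α → Type) [∀ a, Group (A a)] (y : α → V)
    (hy : Function.Injective y) (hyY : ∀ a, y a ∈ R.Y)
    (hsurj : ∀ v ∈ R.Y, (∃ h ∈ H, h ≠ 1 ∧ h • v = v) → ∃ a, y a = v)
    (ε : ∀ a, A a →* G) (hε : ∀ a, Function.Injective (ε a))
    (hrange : ∀ a g, g ∈ (ε a).range ↔ g ∈ H ∧ g • y a = y a)
    (l : β → G × ι) (hl : Function.Injective l)
    (hlL : ∀ e, (∃ b, l b = e) ↔ T.src e ∈ R.Y ∧ T.tgt e ∉ R.Y) :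
    ∃ e : H ≃* Monoid.CoprodI (Sum.elim A (fun _ : β => Multiplicative ℤ)),
      ∀ a x, (e.symm (Monoid.CoprodI.of (i := Sum.inl a) x) : G) = ε a x := by
  set C := Monoid.CoprodI (Sum.elim A (fun _ : β => Multiplicative ℤ)) with hC
  have hεH : ∀ a x, ε a x ∈ H := fun a x => ((hrange a _).1 ⟨x, rfl⟩).1
  have hεy : ∀ a x, ε a x • y a = y a := fun a x => ((hrange a _).1 ⟨x, rfl⟩).2
  let j : V → G → C := fun v g =>
    if h : ∃ k : C, ∃ a x, y a = v ∧ ε a x = g ∧ k = Monoid.CoprodI.of (i := Sum.inl a) x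
    then h.choose else 1
  have hja : ∀ a x, j (y a) (ε a x) = Monoid.CoprodI.of (i := Sum.inl a) x := by
    intro a x
    have h : ∃ k : C, ∃ a' x', y a' = y a ∧ ε a' x' = ε a x ∧
      k = Monoid.CoprodI.of (i := Sum.inl a') x' := ⟨_, a, x, rfl, rfl, rfl⟩
    have h1 : j (y a) (ε a x) = h.choose := dif_pos h
    obtain ⟨a', x', h2, h3, h4⟩ := h.choose_spec
    have h5 := hy h2
    subst h5
    have h6 := hε _ h3
    subst h6
    rw [h1, h4]
  have hj : ∀ v ∈ R.Y, ∀ a ∈ H, ∀ b ∈ H, a • v = v → b • v = v →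
      j v (a * b) = j v a * j v b := by
    intro v hv a ha b hb hav hbv
    by_cases hs : ∃ c, y c = v
    · obtain ⟨c, rfl⟩ := hs
      obtain ⟨x, rfl⟩ := (hrange c a).2 ⟨ha, hav⟩
      obtain ⟨x', rfl⟩ := (hrange c b).2 ⟨hb, hbv⟩
      rw [← map_mul, hja, hja, hja]
      exact map_mul (Monoid.CoprodI.of (M := Sum.elim A (fun _ : β => Multiplicative ℤ))
        (i := Sum.inl c)) x x'
    · have h1 : ∀ g, j v g = 1 := by
        intro g
        refine dif_neg ?_
        rintro ⟨_, c, _, hc, -⟩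
        exact hs ⟨c, hc⟩
      simp [h1]
  let x : G × ι → C := fun e => if h : ∃ b, l b = e then
    Monoid.CoprodI.of (M := Sum.elim A (fun _ : β => Multiplicative ℤ)) (i := Sum.inr h.choose)
      (Multiplicative.ofAdd (1 : ℤ)) else 1
  have hx : ∀ e, T.src e ∈ R.Y → T.tgt e ∈ R.Y → x e = 1 := by
    intro e h1 h2
    refine dif_neg fun h => ?_
    exact ((hlL e).1 h).2 h2
  have hxl : ∀ b, x (l b) = Monoid.CoprodI.of (M := Sum.elim A (fun _ : β => Multiplicative ℤ))
      (i := Sum.inr b) (Multiplicative.ofAdd (1 : ℤ)) := by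
    intro b
    have h : ∃ b', l b' = l b := ⟨b, rfl⟩
    have h1 : x (l b) = _ := dif_pos h
    have h2 : h.choose = b := hl h.choose_spec
    rw [h1, h2]
  obtain ⟨μ, hμ1, hμ2⟩ := R.exists_hom j hj x hx
  let ψi : ∀ s : α ⊕ β, Sum.elim A (fun _ : β => Multiplicative ℤ) s →* H := fun s =>
    match s with
    | Sum.inl a => (ε a).codRestrict H (hεH a)
    | Sum.inr b => zpowersHom H ⟨R.τ (T.tgt (l b)), R.τ_mem _⟩
  let ψ : C →* H := Monoid.CoprodI.lift ψi
  have hψμ : ∀ h : H, ψ (μ h) = h := by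
    have : H ≤ (MonoidHom.eqLocus (ψ.comp μ) (MonoidHom.id H)).map H.subtype := by
      refine R.le_of_generators _ ?_ ?_
      · intro v hv a ha hav
        refine ⟨⟨a, ha⟩, ?_, rfl⟩
        change ψ (μ ⟨a, ha⟩) = ⟨a, ha⟩
        by_cases ha1 : a = 1
        · subst ha1
          have : (⟨1, ha⟩ : H) = 1 := rfl
          simp [this]
        · obtain ⟨c, rfl⟩ := hsurj v hv ⟨a, ha, ha1, hav⟩
          obtain ⟨x, rfl⟩ := (hrange c a).2 ⟨ha, hav⟩
          rw [hμ1 _ hv _ hav, hja]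
          exact Monoid.CoprodI.lift_of (fi := ψi) (i := Sum.inl c) x
      · intro e he
        refine ⟨⟨_, R.τ_mem (T.tgt e)⟩, ?_, rfl⟩
        change ψ (μ ⟨_, R.τ_mem (T.tgt e)⟩) = ⟨_, R.τ_mem (T.tgt e)⟩
        by_cases ht : T.tgt e ∈ R.Y
        · have : (⟨_, R.τ_mem (T.tgt e)⟩ : H) = 1 := Subtype.ext (R.τ_of_mem _ ht)
          simp [this]
        · obtain ⟨b, rfl⟩ := (hlL e).2 ⟨he, ht⟩
          rw [hμ2 _ he, hxl]
          refine (Monoid.CoprodI.lift_of (fi := ψi) (i := Sum.inr b) _).trans ?_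
          exact zpow_one (⟨R.τ (T.tgt (l b)), R.τ_mem _⟩ : H)
    intro h
    obtain ⟨h', hh', heq⟩ := this h.2
    have : h' = h := Subtype.ext heq
    subst this
    exact hh'
  have hμψ : μ.comp ψ = MonoidHom.id C := by
    refine Monoid.CoprodI.ext_hom _ _ fun s => ?_
    rcases s with a | b
    · ext x
      change μ (ψ (Monoid.CoprodI.of (i := Sum.inl a) x)) = Monoid.CoprodI.of (i := Sum.inl a) x
      have h1 : ψ (Monoid.CoprodI.of (i := Sum.inl a) x) = ⟨ε a x, hεH a x⟩ :=
        Monoid.CoprodI.lift_of (fi := ψi) (i := Sum.inl a) x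
      rw [h1, hμ1 (y a) (hyY a) _ (hεy a x)]
      exact hja a x
    · refine MonoidHom.ext_mint ?_
      change μ (ψ (Monoid.CoprodI.of (i := Sum.inr b) (Multiplicative.ofAdd (1 : ℤ)))) =
        Monoid.CoprodI.of (M := Sum.elim A (fun _ : β => Multiplicative ℤ))
          (i := Sum.inr b) (Multiplicative.ofAdd (1 : ℤ))
      have h1 : ψ (Monoid.CoprodI.of (i := Sum.inr b) (Multiplicative.ofAdd (1 : ℤ))) =
          ⟨R.τ (T.tgt (l b)), R.τ_mem _⟩ := by
        refine (Monoid.CoprodI.lift_of (fi := ψi) (i := Sum.inr b) _).trans ?_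
        exact zpow_one (⟨R.τ (T.tgt (l b)), R.τ_mem _⟩ : H)
      rw [h1, hμ2 _ ((hlL _).1 ⟨b, rfl⟩).1]
      exact hxl b
  refine ⟨{ toFun := μ, invFun := ψ, left_inv := hψμ,
            right_inv := fun c => DFunLike.congr_fun hμψ c,
            map_mul' := map_mul μ }, fun a x => ?_⟩
  have h1 : ψ (Monoid.CoprodI.of (i := Sum.inl a) x) = ⟨ε a x, hεH a x⟩ :=
    Monoid.CoprodI.lift_of (fi := ψi) (i := Sum.inl a) x
  exact congrArg Subtype.val h1

end Transversal

end FreeTree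

/-- The real Hilbert space of square-summable functions on a type. -/
abbrev L2 (X : Type) := lp (fun _ : X => ℝ) 2

namespace L2

open Filter Topology

variable {X Y Z : Type}

open Classical in
/-- The standard unit vectors. -/
noncomputable def δ (x : X) : L2 X := lp.single 2 x (1 : ℝ)

open Classical in
theorem δ_apply (x y : X) : δ x y = if y = x then (1 : ℝ) else 0 := by
  simp [δ, Pi.single_apply]

theorem inner_δ_left (x : X) (z : L2 X) : inner ℝ (δ x) z = z x := by
  classical
  have := lp.inner_single_left (𝕜 := ℝ) (G := fun _ : X => ℝ) x (1 : ℝ) z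
  simp only [δ]
  convert this using 1
  simp

theorem inner_δ_right (x : X) (z : L2 X) : inner ℝ z (δ x) = z x := by
  rw [real_inner_comm, inner_δ_left]

theorem norm_sq (z : L2 X) : ‖z‖ ^ 2 = ∑' x, z x ^ 2 := by
  rw [← real_inner_self_eq_norm_sq, lp.inner_eq_tsum]
  refine tsum_congr fun x => ?_
  rw [real_inner_self_eq_norm_sq]
  simp

theorem summable_sq (z : L2 X) : Summable fun x => z x ^ 2 := by
  have := lp.summable_inner (𝕜 := ℝ) z z
  simpa [sq] using this

theorem ext_δ {E : Type*} [NormedAddCommGroup E] [NormedSpace ℝ E] {S T : L2 X →L[ℝ] E}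
    (h : ∀ x, S (δ x) = T (δ x)) : S = T := by
  classical
  ext z
  have h1 := (lp.hasSum_single (E := fun _ : X => ℝ) (p := 2) (by simp) z)
  have h2 : ∀ x, S (lp.single 2 x (z x)) = T (lp.single 2 x (z x)) := by
    intro x
    have : lp.single (E := fun _ : X => ℝ) 2 x (z x) = z x • δ x := by
      rw [δ]
      have := lp.single_smul (𝕜 := ℝ) (E := fun _ : X => ℝ) 2 x (z x) (1 : ℝ)
      rw [smul_eq_mul, mul_one] at this
      convert this
    rw [this, map_smul, map_smul, h]
  have h3 := h1.mapL S
  have h4 := h1.mapL T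
  simp only [h2] at h3
  exact h3.unique h4

theorem memℓp_comp (z : L2 Y) {p : X → Y} (hp : Function.Injective p) :
    Memℓp (fun x => z (p x)) 2 := by
  refine memℓp_gen ?_
  have := (summable_sq z).comp_injective hp
  simpa [Function.comp_def] using this

/-- Restriction of functions along an injection. -/
noncomputable def pull (p : X → Y) (hp : Function.Injective p) : L2 Y →L[ℝ] L2 X :=
  LinearMap.mkContinuous
    { toFun := fun z => (⟨fun x => z (p x), memℓp_comp z hp⟩ : L2 X)
      map_add' := fun _ _ => rfl
      map_smul' := fun _ _ => rfl } 1 (fun z => by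
    rw [one_mul]
    refine le_of_sq_le_sq ?_ (norm_nonneg _)
    rw [norm_sq, norm_sq]
    exact tsum_comp_le_tsum_of_inj (summable_sq z) (fun x => sq_nonneg _) hp)

theorem pull_apply (p : X → Y) (hp : Function.Injective p) (z : L2 Y) (x : X) :
    pull p hp z x = z (p x) := rfl

/-- Extension of functions by zero along an injection. -/
noncomputable def push (p : X → Y) (hp : Function.Injective p) : L2 X →L[ℝ] L2 Y :=
  ContinuousLinearMap.adjoint (pull p hp)

theorem push_δ (p : X → Y) (hp : Function.Injective p) (x : X) :
    push p hp (δ x) = δ (p x) := by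
  classical
  ext y
  rw [← inner_δ_left y, push, ContinuousLinearMap.adjoint_inner_right, inner_δ_right,
    pull_apply, δ_apply, δ_apply]
  simp [eq_comm]

theorem pull_push (p : X → Y) (hp : Function.Injective p) (z : L2 X) :
    pull p hp (push p hp z) = z := by
  have : (pull p hp).comp (push p hp) = ContinuousLinearMap.id ℝ _ := by
    refine ext_δ fun x => ?_
    classical
    ext x'
    simp [push_δ, pull_apply, δ_apply, hp.eq_iff]
  exact DFunLike.congr_fun this z

theorem push_apply (p : X → Y) (hp : Function.Injective p) (z : L2 X) (x : X) :
    push p hp z (p x) = z x := by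
  conv_rhs => rw [← pull_push p hp z]
  rfl

theorem push_apply_of_notMem (p : X → Y) (hp : Function.Injective p) (z : L2 X) {y : Y}
    (hy : ∀ x, p x ≠ y) : push p hp z y = 0 := by
  rw [← inner_δ_left, push, ContinuousLinearMap.adjoint_inner_right]
  have : pull p hp (δ y) = 0 := by
    classical
    ext x
    simp [pull_apply, δ_apply, hy x]
  simp [this]

theorem inner_push_push (p : X → Y) (hp : Function.Injective p) (z w : L2 X) :
    inner ℝ (push p hp z) (push p hp w) = inner ℝ z w := by
  conv_lhs => rw [push, ContinuousLinearMap.adjoint_inner_left, ← push, pull_push]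

theorem finite_level (z : L2 X) {c : ℝ} (hc : c ≠ 0) : {x | z x = c}.Finite := by
  have h := (summable_sq z).tendsto_cofinite_zero
  have h1 : ∀ᶠ x in cofinite, z x ^ 2 < c ^ 2 := h.eventually_lt_const (by positivity)
  refine (Filter.eventually_cofinite.1 h1).subset fun x hx => ?_
  have hx' : z x = c := hx
  simp [hx']

variable {G κ ι : Type} [Group G]

/-- Left translation by a group element. -/
noncomputable def trans (κ : Type) (g : G) : L2 (G × κ) →L[ℝ] L2 (G × κ) :=
  push (fun x => (g * x.1, x.2)) (fun x y h => by simpa [Prod.ext_iff] using h)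

theorem trans_δ (g h : G) (k : κ) : trans κ g (δ (h, k)) = δ (g * h, k) := push_δ _ _ _

theorem trans_trans (g h : G) (z : L2 (G × κ)) : trans κ g (trans κ h z) = trans κ (g * h) z := by
  have : (trans κ g).comp (trans κ h) = trans κ (g * h) :=
    ext_δ fun x => by
      obtain ⟨x, k⟩ := x
      simp [trans_δ, mul_assoc]
  exact DFunLike.congr_fun this z

theorem trans_one (z : L2 (G × κ)) : trans κ (1 : G) z = z := by
  have : trans κ (1 : G) = ContinuousLinearMap.id ℝ _ :=
    ext_δ fun x => by
      obtain ⟨x, k⟩ := x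
      simp [trans_δ]
  exact DFunLike.congr_fun this z

theorem inner_trans (g : G) (z w : L2 (G × κ)) :
    inner ℝ (trans κ g z) (trans κ g w) = inner ℝ z w := inner_push_push _ _ _ _

/-- Operators commuting with left translations. -/
def Equi (X : L2 (G × κ) →L[ℝ] L2 (G × ι)) : Prop :=
  ∀ g z, X (trans κ g z) = trans ι g (X z)

theorem Equi.adjoint {X : L2 (G × κ) →L[ℝ] L2 (G × ι)} (hX : Equi X) :
    Equi (ContinuousLinearMap.adjoint X) := by
  intro g z
  refine ext_inner_right ℝ fun w => ?_
  have hw : w = trans κ g (trans κ g⁻¹ w) := by rw [trans_trans, mul_inv_cancel, trans_one]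
  rw [ContinuousLinearMap.adjoint_inner_left]
  conv_lhs => rw [hw, hX, inner_trans, ← ContinuousLinearMap.adjoint_inner_left]
  conv_rhs => rw [hw, inner_trans]

theorem Equi.inner_eq {X : L2 (G × κ) →L[ℝ] L2 (G × ι)} (hX : Equi X) (g h h' : G) (i : ι) (k : κ) :
    inner ℝ (δ (g * h, i)) (X (δ (g * h', k))) = inner ℝ (δ (h, i)) (X (δ (h', k))) := by
  rw [← trans_δ, ← trans_δ, hX, inner_trans]

theorem Equi.comp {κ' : Type} {X : L2 (G × κ) →L[ℝ] L2 (G × ι)} {Y : L2 (G × κ') →L[ℝ] L2 (G × κ)}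
    (hX : Equi X) (hY : Equi Y) : Equi (X.comp Y) := by
  intro g z
  simp [hY g z, hX g]

theorem Equi.pow {X : L2 (G × κ) →L[ℝ] L2 (G × κ)} (hX : Equi X) (n : ℕ) : Equi (X ^ n) := by
  induction n with
  | zero => intro g z; simp
  | succ n ih =>
    rw [pow_succ]
    exact ih.comp hX

/-- The trace of an operator commuting with left translations. -/
noncomputable def tr [Fintype κ] (X : L2 (G × κ) →L[ℝ] L2 (G × κ)) : ℝ :=
  ∑ k, inner ℝ (δ ((1 : G), k)) (X (δ ((1 : G), k)))

theorem hasSum_comp (X : L2 Y →L[ℝ] L2 Z) (W : L2 Z →L[ℝ] L2 Y) (y : Y) :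
    HasSum (fun z => inner ℝ (δ y) (W (δ z)) * inner ℝ (δ z) (X (δ y)))
      (inner ℝ (δ y) (W (X (δ y)))) := by
  have h := lp.hasSum_inner (𝕜 := ℝ) (ContinuousLinearMap.adjoint W (δ y)) (X (δ y))
  rw [ContinuousLinearMap.adjoint_inner_left] at h
  refine h.congr_fun ?_
  intro z
  rw [← ContinuousLinearMap.adjoint_inner_left, inner_δ_right, inner_δ_left]
  simp [mul_comm]

theorem tr_comm [Fintype κ] [Fintype ι] {X : L2 (G × κ) →L[ℝ] L2 (G × ι)}
    {W : L2 (G × ι) →L[ℝ] L2 (G × κ)} (hX : Equi X) (hW : Equi W) :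
    tr (W.comp X) = tr (X.comp W) := by
  have key : ∀ {κ ι : Type} [Fintype ι] (X : L2 (G × κ) →L[ℝ] L2 (G × ι))
    (W : L2 (G × ι) →L[ℝ] L2 (G × κ)) (k : κ), inner ℝ (δ ((1 : G), k)) (W (X (δ ((1 : G), k)))) =
      ∑ i, ∑' g : G, inner ℝ (δ ((1 : G), k)) (W (δ (g, i))) *
        inner ℝ (δ (g, i)) (X (δ ((1 : G), k))) := by
    intro κ ι _ X W k
    have h := hasSum_comp X W ((1 : G), k)
    have h2 := (Equiv.prodComm ι G).hasSum_iff.2 h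
    rw [← h2.tsum_eq, h2.summable.tsum_prod, tsum_fintype]
    rfl
  simp only [tr, ContinuousLinearMap.comp_apply]
  simp only [key]
  rw [Finset.sum_comm]
  refine Finset.sum_congr rfl fun i _ => Finset.sum_congr rfl fun k _ => ?_
  rw [← (Equiv.inv G).tsum_eq]
  refine tsum_congr fun g => ?_
  have h1 := hW.inner_eq g 1 g⁻¹ k i
  have h2 := hX.inner_eq g g⁻¹ 1 i k
  simp only [mul_one, mul_inv_cancel] at h1 h2
  simp only [Equiv.inv_apply]
  rw [← h1, ← h2, mul_comm]

theorem tr_one [Fintype κ] : tr (1 : L2 (G × κ) →L[ℝ] L2 (G × κ)) = Fintype.card κ := by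
  classical
  simp only [tr, inner_δ_left, one_apply_eq_self, δ_apply]
  simp

theorem tr_sub [Fintype κ] (X W : L2 (G × κ) →L[ℝ] L2 (G × κ)) : tr (X - W) = tr X - tr W := by
  simp [tr, inner_sub_right]

section Defect

variable {E F : Type*} [NormedAddCommGroup E] [InnerProductSpace ℝ E] [CompleteSpace E]
  [NormedAddCommGroup F] [InnerProductSpace ℝ F] [CompleteSpace F]

/-- The defect operator `1 - A* A`. -/
noncomputable def defect (A : E →L[ℝ] F) : E →L[ℝ] E := 1 - (ContinuousLinearMap.adjoint A).comp A

theorem defect_apply (A : E →L[ℝ] F) (x : E) :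
    defect A x = x - ContinuousLinearMap.adjoint A (A x) := by simp [defect]

theorem defect_symm (A : E →L[ℝ] F) (x y : E) :
    inner ℝ (defect A x) y = inner ℝ x (defect A y) := by
  simp [defect_apply, inner_sub_left, inner_sub_right, ContinuousLinearMap.adjoint_inner_left,
    ContinuousLinearMap.adjoint_inner_right]

theorem defect_pow_symm (A : E →L[ℝ] F) (n : ℕ) (x y : E) :
    inner ℝ ((defect A ^ n) x) y = inner ℝ x ((defect A ^ n) y) := by
  induction n generalizing x y with
  | zero => simp
  | succ n ih =>
    rw [pow_succ']
    conv_rhs => rw [← pow_succ', pow_succ]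
    simp only [mul_apply_eq_comp, defect_symm, ih]

theorem inner_defect (A : E →L[ℝ] F) (x : E) :
    inner ℝ x (defect A x) = ‖x‖ ^ 2 - ‖A x‖ ^ 2 := by
  rw [defect_apply, inner_sub_right, ContinuousLinearMap.adjoint_inner_right,
    real_inner_self_eq_norm_sq, real_inner_self_eq_norm_sq]

theorem inner_defect_pow_nonneg (A : E →L[ℝ] F) (hA : ‖A‖ ≤ 1) (n : ℕ) (x : E) :
    0 ≤ inner ℝ x ((defect A ^ n) x) := by
  rcases Nat.even_or_odd' n with ⟨m, rfl | rfl⟩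
  · rw [two_mul, pow_add, mul_apply_eq_comp, ← defect_pow_symm]
    exact real_inner_self_nonneg
  · have : defect A ^ (2 * m + 1) = defect A ^ m * (defect A * defect A ^ m) := by
      rw [← pow_succ', ← pow_add]; congr 1; omega
    rw [this, mul_apply_eq_comp, ← defect_pow_symm, mul_apply_eq_comp,
      inner_defect]
    have h1 := A.le_of_opNorm_le hA ((defect A ^ m) x)
    rw [one_mul] at h1
    have := pow_le_pow_left₀ (norm_nonneg _) h1 2
    linarith

theorem norm_defect_le (A : E →L[ℝ] F) (hA : ‖A‖ ≤ 1) : ‖defect A‖ ≤ 1 := by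
  refine ContinuousLinearMap.opNorm_le_bound _ zero_le_one fun x => ?_
  rw [one_mul]
  refine le_of_sq_le_sq ?_ (norm_nonneg _)
  have h1 : ‖defect A x‖ ^ 2 = ‖x‖ ^ 2 - 2 * ‖A x‖ ^ 2 +
      ‖ContinuousLinearMap.adjoint A (A x)‖ ^ 2 := by
    rw [defect_apply, norm_sub_sq_real, ContinuousLinearMap.adjoint_inner_right,
      real_inner_self_eq_norm_sq]
  have h2 : ‖ContinuousLinearMap.adjoint A (A x)‖ ≤ ‖A x‖ := by
    have := (ContinuousLinearMap.adjoint A).le_of_opNorm_le (c := 1)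
      (by rw [LinearIsometryEquiv.norm_map]; exact hA) (A x)
    rwa [one_mul] at this
  have := pow_le_pow_left₀ (norm_nonneg _) h2 2
  nlinarith [sq_nonneg ‖A x‖]

theorem birkhoff_defect (A : E →L[ℝ] F) (hA : ‖A‖ ≤ 1) (hinj : ∀ x, A x = 0 → x = 0) (x : E) :
    Tendsto (birkhoffAverage ℝ (defect A) _root_.id · x) atTop (𝓝 0) := by
  have h := ContinuousLinearMap.tendsto_birkhoffAverage_orthogonalProjection (defect A)
    (norm_defect_le A hA) x
  generalize ((defect A).eqLocus (1 : E →L[ℝ] E)).orthogonalProjectionOnto x = w at h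
  have h0 : (w : E) = 0 := by
    refine hinj _ ?_
    have h2 : defect A (w : E) = w := w.2
    have h3 := inner_defect A (w : E)
    rw [h2, real_inner_self_eq_norm_sq] at h3
    have h4 : ‖A w‖ ^ 2 = 0 := by linarith
    simpa using h4
  rwa [h0] at h

end Defect

theorem card_le_of_injective [Fintype κ] [Fintype ι] {A : L2 (G × κ) →L[ℝ] L2 (G × ι)}
    (hA : Equi A) (hinj : ∀ x, A x = 0 → x = 0) : Fintype.card κ ≤ Fintype.card ι := by
  wlog hn : ‖A‖ ≤ 1 generalizing A
  · have hpos : 0 < ‖A‖ := lt_trans one_pos (not_le.1 hn)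
    refine this (A := ‖A‖⁻¹ • A) ?_ ?_ ?_
    · intro g z; simp [hA g z]
    · intro x hx
      refine hinj x ?_
      simpa [hpos.ne'] using hx
    · rw [norm_smul, norm_inv, norm_norm, inv_mul_cancel₀ hpos.ne']
  set B := ContinuousLinearMap.adjoint A with hB
  have hBE : Equi B := hA.adjoint
  have hBn : ‖B‖ ≤ 1 := by rw [hB, LinearIsometryEquiv.norm_map]; exact hn
  have hsub : ∀ {κ ι : Type} {X : L2 (G × κ) →L[ℝ] L2 (G × ι)}, Equi X → Equi (defect X) := by
    intro κ ι X hX g z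
    rw [defect_apply, defect_apply, hX, hX.adjoint, map_sub]
  have hcomm : ∀ n x, A ((defect A ^ n) x) = (defect B ^ n) (A x) := by
    intro n
    induction n with
    | zero => simp
    | succ n ih =>
      intro x
      rw [pow_succ, pow_succ, mul_apply_eq_comp, mul_apply_eq_comp, ih]
      simp [defect_apply, hB]
  have htr : ∀ n, tr (defect A ^ n) - tr (defect B ^ n) =
      (Fintype.card κ : ℝ) - Fintype.card ι := by
    intro n
    induction n with
    | zero => simp [tr_one]
    | succ n ih =>
      have h1 : defect A ^ (n + 1) = defect A ^ n - ((defect A ^ n).comp B).comp A := by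
        ext1 x
        rw [pow_succ, mul_apply_eq_comp, defect_apply, map_sub]; rfl
      have h2 : defect B ^ (n + 1) = defect B ^ n - A.comp ((defect A ^ n).comp B) := by
        ext1 x
        rw [pow_succ, mul_apply_eq_comp, defect_apply, map_sub]
        rw [hB, ContinuousLinearMap.adjoint_adjoint, ← hB, ← hcomm]; rfl
      rw [h1, h2, tr_sub, tr_sub, tr_comm hA (((hsub hA).pow n).comp hBE)]
      linarith
  have hge : ∀ n, (Fintype.card κ : ℝ) - Fintype.card ι ≤ tr (defect A ^ n) := by
    intro n
    have : 0 ≤ tr (defect B ^ n) :=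
      Finset.sum_nonneg fun i _ => inner_defect_pow_nonneg B hBn n _
    have := htr n
    linarith
  have hlim : Tendsto (fun N => ∑ k, inner ℝ (δ ((1 : G), k))
      (birkhoffAverage ℝ (defect A) _root_.id N (δ ((1 : G), k)))) atTop (𝓝 (∑ _k : κ, 0)) := by
    refine tendsto_finsetSum _ fun k _ => ?_
    have h1 := birkhoff_defect A hn hinj (δ ((1 : G), k))
    have h2 := (innerSL ℝ (δ ((1 : G), k))).continuous.tendsto 0
    rw [map_zero] at h2
    exact h2.comp h1
  rw [Finset.sum_const_zero] at hlim
  have hfin : (Fintype.card κ : ℝ) - Fintype.card ι ≤ 0 := by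
    refine ge_of_tendsto hlim ?_
    filter_upwards [eventually_gt_atTop 0] with N hN
    have h1 : ∑ k, inner ℝ (δ ((1 : G), k))
        (birkhoffAverage ℝ (defect A) _root_.id N (δ ((1 : G), k))) =
        (N : ℝ)⁻¹ * ∑ n ∈ Finset.range N, tr (defect A ^ n) := by
      simp only [tr]
      rw [Finset.sum_comm, Finset.mul_sum]
      refine Finset.sum_congr rfl fun k _ => ?_
      rw [birkhoffAverage, birkhoffSum, inner_smul_right, inner_sum]
      congr 1
      refine Finset.sum_congr rfl fun n _ => ?_
      congr 1
      simp
    rw [h1]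
    have hN' : (0 : ℝ) < N := by exact_mod_cast hN
    have h2 : (N : ℝ) * ((Fintype.card κ : ℝ) - Fintype.card ι) ≤
        ∑ n ∈ Finset.range N, tr (defect A ^ n) := by
      have := Finset.card_nsmul_le_sum (Finset.range N) (fun n => tr (defect A ^ n)) _
        (fun n _ => hge n)
      simpa using this
    rw [inv_mul_eq_div, le_div_iff₀ hN']
    linarith
  have : (Fintype.card κ : ℝ) ≤ Fintype.card ι := by linarith
  exact_mod_cast this

end L2

namespace FreeTree

variable {G V ι : Type} [Group G] [MulAction G V] (T : FreeTree G V ι)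

theorem geo_smul (g : G) (x y : V) :
    T.geo (g • x) (g • y) = Finsupp.mapDomain (esmul g) (T.geo x y) := by
  ext e
  obtain ⟨e', rfl⟩ : ∃ e', esmul g e' = e := ⟨esmul g⁻¹ e, by simp [esmul_esmul, esmul_one]⟩
  rw [geo_smul_apply, Finsupp.mapDomain_apply (esmul_injective g)]

/-- The action on edge chains induced by an equivariant map on vertices. -/
noncomputable def chainMap (φ : G →* G) (f : V → V) : (G × ι →₀ ℝ) →ₗ[ℝ] (G × ι →₀ ℝ) :=
  Finsupp.linearCombination ℝ fun e => Finsupp.mapDomain (esmul (φ e.1)) (T.geo T.o (f (T.t e.2)))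

theorem chainMap_geo {φ : G →* G} {f : V → V} (hf : ∀ g v, f (g • v) = φ g • f v)
    (hfo : f T.o = T.o) (x y : V) : T.chainMap φ f (T.geo x y) = T.geo (f x) (f y) := by
  have key := T.eq_of_edge (fun y => T.chainMap φ f (T.geo x y) - T.geo (f x) (f y)) (fun e => by
    have h1 := T.geo_add x (T.src e) (T.tgt e)
    have h2 := T.geo_add (f x) (f (T.src e)) (f (T.tgt e))
    have h3 : T.chainMap φ f (T.geo (T.src e) (T.tgt e)) = T.geo (f (T.src e)) (f (T.tgt e)) := by
      rw [geo_edge, chainMap, Finsupp.linearCombination_single, one_smul, ← geo_smul, src, tgt, hf,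
        hf, hfo]
    change T.chainMap φ f (T.geo x (T.tgt e)) - T.geo (f x) (f (T.tgt e)) =
      T.chainMap φ f (T.geo x (T.src e)) - T.geo (f x) (f (T.src e))
    rw [← h1, ← h2, map_add, h3]
    abel)
  have := key y x
  simp only [geo_self, map_zero, sub_zero] at this
  exact sub_eq_zero.1 this

end FreeTree

namespace L2

open FreeTree

variable {G κ ι : Type} [Group G]

/-- The finitely supported functions as elements of the Hilbert space. -/
noncomputable def emb (X : Type) : (X →₀ ℝ) →ₗ[ℝ] L2 X := Finsupp.linearCombination ℝ δ

theorem emb_mapDomain {X Y : Type} (p : X → Y) (w : X →₀ ℝ) :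
    emb Y (Finsupp.mapDomain p w) = ∑ x ∈ w.support, w x • δ (p x) := by
  rw [emb, Finsupp.linearCombination_mapDomain, Finsupp.linearCombination_apply]
  rfl

/-- Right multiplication by the `ι`-component of an edge. -/
noncomputable def pushEdge (ψ : G → G) (hψ : Function.Injective ψ) (e : G × ι) :
    L2 G →L[ℝ] L2 (G × ι) :=
  push (fun x => esmul (ψ x) e) (fun x y h => by
    simp only [esmul, Prod.mk.injEq, mul_left_inj, and_true] at h
    exact hψ h)

/-- The operator sending the basis vector `(h, k)` to the translate of `c k` by `ψ h`. -/
noncomputable def op [Fintype κ] (ψ : G → G) (hψ : Function.Injective ψ) (c : κ → (G × ι →₀ ℝ)) :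
    L2 (G × κ) →L[ℝ] L2 (G × ι) :=
  ∑ k, (∑ e ∈ (c k).support, c k e • pushEdge ψ hψ e).comp
    (pull (fun x => (x, k)) (fun _ _ h => (Prod.mk.inj h).1))

theorem op_δ [Fintype κ] (ψ : G → G) (hψ : Function.Injective ψ) (c : κ → (G × ι →₀ ℝ)) (h : G)
    (k : κ) : op ψ hψ c (δ (h, k)) = emb _ (Finsupp.mapDomain (esmul (ψ h)) (c k)) := by
  classical
  have h1 : ∀ k', pull (fun x : G => (x, k')) (fun _ _ h => (Prod.mk.inj h).1) (δ (h, k)) =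
      if k' = k then δ h else 0 := by
    intro k'
    refine lp.ext (funext fun x => ?_)
    change (δ (h, k) : L2 (G × κ)) (x, k') = _
    rw [δ_apply]
    by_cases hk : k' = k
    · subst hk
      simp [δ_apply]
    · simp [hk]
  simp only [op, FunLike.coe_sum, Finset.sum_apply, ContinuousLinearMap.comp_apply, h1]
  rw [Finset.sum_eq_single k (fun k' _ hk => by simp [hk]) (by simp)]
  rw [if_pos rfl, emb_mapDomain]
  refine Finset.sum_congr rfl fun e _ => ?_
  simp only [FunLike.coe_smul, Pi.smul_apply]
  exact congrArg _ (push_δ _ _ _)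

open Classical in
theorem op_apply [Fintype κ] (c : κ → (G × ι →₀ ℝ)) (z : L2 (G × κ)) (x : G) (i : ι) :
    op _root_.id Function.injective_id c z (x, i) =
      ∑ k, ∑ e ∈ (c k).support, c k e * if e.2 = i then z (x * e.1⁻¹, k) else 0 := by
  obtain ⟨ev, hev⟩ : ∃ ev : L2 (G × ι) →L[ℝ] ℝ, ∀ w : L2 (G × ι), w (x, i) = ev w :=
    ⟨innerSL ℝ (δ (x, i)), fun w => (inner_δ_left _ _).symm⟩
  rw [hev]
  rw [op, FunLike.coe_sum, Finset.sum_apply, map_sum]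
  refine Finset.sum_congr rfl fun k _ => ?_
  rw [ContinuousLinearMap.comp_apply, FunLike.coe_sum, Finset.sum_apply, map_sum]
  refine Finset.sum_congr rfl fun e _ => ?_
  rw [FunLike.coe_smul, Pi.smul_apply, map_smul, ← hev, smul_eq_mul]
  congr 1
  split_ifs with h
  · have : (x, i) = esmul (_root_.id (x * e.1⁻¹)) e := by
      subst h; simp [esmul]
    rw [this]
    exact push_apply _ _ _ _
  · refine push_apply_of_notMem _ _ _ ?_
    intro y hy
    exact h (Prod.mk.inj hy).2

theorem op_equi [Fintype κ] (c : κ → (G × ι →₀ ℝ)) :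
    Equi (op _root_.id Function.injective_id c) := by
  have h1 : ∀ (g : G) (w : G × ι →₀ ℝ), trans ι g (emb _ w) =
      emb _ (Finsupp.mapDomain (esmul g) w) := by
    intro g w
    rw [emb_mapDomain, emb, Finsupp.linearCombination_apply, Finsupp.sum, map_sum]
    refine Finset.sum_congr rfl fun e _ => ?_
    rw [map_smul]
    exact congrArg _ (push_δ _ _ _)
  intro g z
  have : (op _root_.id Function.injective_id c).comp (trans κ g) =
      (trans ι g).comp (op _root_.id Function.injective_id c) := by
    refine ext_δ fun x => ?_
    obtain ⟨x, k⟩ := x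
    simp only [ContinuousLinearMap.comp_apply, trans_δ, op_δ, h1, ← Finsupp.mapDomain_comp, id]
    congr 2
    ext e : 1
    simp [esmul_esmul]
  exact DFunLike.congr_fun this z

/-- Vectors fixed by `f` whose geodesics from `o` admit no nontrivial relation supported on the
`φ`-periodic elements are at most as numerous as the orbits of edges. -/
theorem card_le_card {V : Type} [MulAction G V] [Fintype κ] [Fintype ι] (T : FreeTree G V ι)
    {φ : G →* G} (hφ : Function.Injective φ) {f : V → V} (hf : ∀ g v, f (g • v) = φ g • f v)
    (hfo : f T.o = T.o) (v : κ → V) (hv : ∀ k, f (v k) = v k)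
    (hrel : ∀ q : G → κ → ℝ, (∀ g k, q g k ≠ 0 → ∃ N, 0 < N ∧ φ^[N] g = g) →
      (∀ (x : G) (i : ι), ∑ k, ∑ e ∈ (T.geo T.o (v k)).support, T.geo T.o (v k) e *
        (open Classical in if e.2 = i then q (x * e.1⁻¹) k else 0) = 0) → q = 0) :
    Fintype.card κ ≤ Fintype.card ι := by
  set A := op _root_.id Function.injective_id (fun k => T.geo T.o (v k)) with hA
  have hAE : Equi A := op_equi _
  set J := op φ hφ (fun i => T.geo T.o (f (T.t i))) with hJ
  have hp : Function.Injective fun x : G × κ => (φ x.1, x.2) := by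
    rintro ⟨a, k⟩ ⟨b, k'⟩ h
    simp only [Prod.mk.injEq] at h
    exact Prod.ext (hφ h.1) h.2
  have hJe : ∀ w, J (emb _ w) = emb _ (T.chainMap φ f w) := by
    intro w
    have : J.toLinearMap.comp (emb (G × ι)) = (emb (G × ι)).comp (T.chainMap φ f) := by
      refine Finsupp.lhom_ext fun e r => ?_
      simp only [LinearMap.comp_apply, emb, Finsupp.linearCombination_single, map_smul, chainMap]
      congr 1
      exact op_δ _ _ _ _ _
    exact DFunLike.congr_fun this w
  have hAJ : ∀ z, A (push _ hp z) = J (A z) := by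
    intro z
    have : A.comp (push _ hp) = J.comp A := by
      refine ext_δ fun x => ?_
      obtain ⟨x, k⟩ := x
      simp only [ContinuousLinearMap.comp_apply, push_δ, hA, op_δ, hJe, id, ← geo_smul,
        T.chainMap_geo hf hfo, hf, hfo, hv]
    exact DFunLike.congr_fun this z
  have hker : ∀ k, ∃ q : L2 (G × κ), A q = 0 ∧ ∀ z, A z = 0 → inner ℝ z (δ ((1 : G), k)) =
      inner ℝ z q := by
    intro k
    set K := LinearMap.ker A.toLinearMap with hK
    have : CompleteSpace K := A.isClosed_ker.completeSpace_coe
    refine ⟨K.starProjection (δ ((1 : G), k)), ?_, fun z hz => ?_⟩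
    · have := K.starProjection_apply_mem (δ ((1 : G), k))
      exact this
    · have := K.starProjection_inner_eq_zero (δ ((1 : G), k)) z hz
      rw [inner_sub_left, real_inner_comm, real_inner_comm z] at this
      linarith
  have hq0 : ∀ k (q : L2 (G × κ)), A q = 0 → (∀ z, A z = 0 → inner ℝ z (δ ((1 : G), k)) =
      inner ℝ z q) → q = 0 := by
    intro k q hq hqz
    have h1 : push _ hp q = q := by
      have h2 : A (push _ hp q) = 0 := by rw [hAJ, hq, map_zero]
      have h3 := hqz _ h2
      have h4 := hqz _ hq
      rw [inner_δ_right] at h3 h4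
      have h5 : push _ hp q (1, k) = q (1, k) := by
        have := push_apply _ hp q (1, k)
        simpa using this
      have h6 : ‖push _ hp q - q‖ ^ 2 = 0 := by
        rw [norm_sub_sq_real, ← real_inner_self_eq_norm_sq, ← real_inner_self_eq_norm_sq,
          inner_push_push, ← h3, ← h4, h5]
        ring
      exact sub_eq_zero.1 (by simpa using h6)
    have h2 : ∀ g k', q (φ g, k') = q (g, k') := by
      intro g k'
      have := push_apply _ hp q (g, k')
      rwa [h1] at this
    have h3 := hrel (fun g k' => q (g, k')) (fun g k' hg => by
      have h4 : ∀ N, q (φ^[N] g, k') = q (g, k') := by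
        intro N
        induction N with
        | zero => rfl
        | succ N ih => rw [Function.iterate_succ_apply', h2, ih]
      have h5 := finite_level q hg
      obtain ⟨a, b, hab, heq⟩ : ∃ a b, a < b ∧ φ^[a] g = φ^[b] g := by
        have hm : ∀ N : ℕ, (φ^[N] g, k') ∈ {x | q x = q (g, k')} := h4
        obtain ⟨a, b, hne, he⟩ : ∃ a b, a ≠ b ∧ (φ^[a] g, k') = (φ^[b] g, k') := by
          by_contra hc
          push Not at hc
          exact Set.infinite_of_injective_forall_mem
            (fun a b hab => by_contra fun h => hc a b h hab) hm h5
        have he := (Prod.mk.inj he).1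
        rcases lt_or_gt_of_ne hne with h | h
        · exact ⟨a, b, h, he⟩
        · exact ⟨b, a, h, he.symm⟩
      refine ⟨b - a, by omega, ?_⟩
      apply (hφ.iterate a)
      rw [← Function.iterate_add_apply, heq]
      congr 1
      omega) (fun x i => by
        rw [← op_apply, ← hA, hq]; rfl)
    ext x
    exact congr_fun (congr_fun h3 x.1) x.2
  refine card_le_of_injective hAE fun z hz => ?_
  ext x
  obtain ⟨g, k⟩ := x
  obtain ⟨q, hq, hqz⟩ := hker k
  have h0 := hq0 k q hq hqz
  have h1 := hqz (trans κ g⁻¹ z) (by rw [hAE, hz, map_zero])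
  rw [h0, inner_zero_right, inner_δ_right] at h1
  have h2 := push_apply (fun x : G × κ => (g⁻¹ * x.1, x.2))
    (fun x y h => by simpa [Prod.ext_iff] using h) z (g, k)
  simp only [inv_mul_cancel] at h2
  rw [← h2]
  exact h1

end L2

/-- The subgroup of periodic elements of an endomorphism. -/
def perSubgroup {G : Type*} [Group G] (φ : G →* G) : Subgroup G where
  carrier := Function.periodicPts φ
  one_mem' := ⟨1, one_pos, by simp [Function.IsPeriodicPt, Function.IsFixedPt]⟩
  mul_mem' := by
    rintro a b ⟨m, hm, ha⟩ ⟨n, hn, hb⟩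
    refine ⟨m * n, Nat.mul_pos hm hn, ?_⟩
    have h1 := ha.mul_const n
    have h2 := hb.const_mul m
    simp only [Function.IsPeriodicPt, Function.IsFixedPt] at *
    rw [iterate_map_mul, h1, h2]
  inv_mem' := by
    rintro a ⟨m, hm, ha⟩
    refine ⟨m, hm, ?_⟩
    simp only [Function.IsPeriodicPt, Function.IsFixedPt] at *
    rw [iterate_map_inv, ha]

namespace FreeTree

variable {G V ι : Type} [Group G] [MulAction G V]

/-- The coefficient at the edge `e'` of the convolution of a function on the group and a chain. -/
noncomputable def conv (q : G → ℝ) (e' : G × ι) : (G × ι →₀ ℝ) →ₗ[ℝ] ℝ :=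
  Finsupp.linearCombination ℝ fun e =>
    open Classical in if e.2 = e'.2 then q (e'.1 * e.1⁻¹) else 0

theorem conv_eq {q : G → ℝ} {g : G} {e₀ : G × ι} {w : G × ι →₀ ℝ}
    (h : ∀ e, w e ≠ 0 → ∀ x, q x ≠ 0 → esmul x e = esmul g e₀ → e = e₀) :
    conv q (esmul g e₀) w = w e₀ * q g := by
  classical
  rw [conv, Finsupp.linearCombination_apply, Finsupp.sum]
  rw [Finset.sum_eq_single e₀]
  · simp [esmul]
  · intro e he hne
    rw [Finsupp.mem_support_iff] at he
    split_ifs with h2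
    · by_cases hq : q ((esmul g e₀).1 * e.1⁻¹) = 0
      · simp [hq]
      · exact absurd (h e he _ hq (Prod.ext (by simp [esmul]) h2)) hne
    · simp
  · intro h
    simp [Finsupp.notMem_support_iff.1 h]

theorem src_stab (T : FreeTree G V ι) {g : G} {e : G × ι} (h : g • T.src e = T.src e) : g = 1 := by
  rw [src, ← inv_smul_eq_iff, smul_smul, smul_smul] at h
  have := T.free _ h
  simpa [mul_assoc, inv_mul_eq_one, eq_comm] using this

namespace Transversal

variable {T : FreeTree G V ι} {H : Subgroup G} (R : T.Transversal H)

theorem orbit_unique {e e' : G × ι} (he : T.src e ∈ R.Y) (he' : T.src e' ∈ R.Y) {h : G}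
    (hh : h ∈ H) (heq : esmul h e = e') : e = e' := by
  have h1 : h • T.src e = T.src e' := by rw [smul_src, heq]
  have h2 := R.inj _ he _ he' h hh h1
  rw [← h2] at h1
  rw [T.src_stab h1, esmul_one] at heq
  exact heq

theorem geo_o_support : ∀ y ∈ R.Y, ∀ e, T.geo T.o y e ≠ 0 → T.src e ∈ R.Y ∧ T.tgt e ∈ R.Y := by
  refine R.conn _ (fun e he => absurd (by rw [geo_self]; rfl) he) fun e hs ht => ?_
  have h1 : T.geo T.o (T.tgt e) = T.geo T.o (T.src e) + Finsupp.single e 1 := by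
    rw [← T.geo_edge, geo_add]
  constructor
  · intro h e' he'
    by_cases hee : e' = e
    · rw [hee]; exact ⟨hs, ht⟩
    · refine h e' ?_
      rw [h1] at he'
      simpa [Ne.symm hee] using he'
  · intro h e' he'
    by_cases hee : e' = e
    · rw [hee]; exact ⟨hs, ht⟩
    · refine h e' ?_
      rw [h1]
      simpa [Ne.symm hee] using he'

theorem geo_support {y y' : V} (hy : y ∈ R.Y) (hy' : y' ∈ R.Y) {e : G × ι}
    (he : T.geo y y' e ≠ 0) : T.src e ∈ R.Y ∧ T.tgt e ∈ R.Y := by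
  have h1 := DFunLike.congr_fun (T.geo_add T.o y y') e
  rw [Finsupp.add_apply] at h1
  by_contra hc
  have h2 : T.geo T.o y e = 0 := by_contra fun h => hc (R.geo_o_support y hy e h)
  have h3 : T.geo T.o y' e = 0 := by_contra fun h => hc (R.geo_o_support y' hy' e h)
  rw [h2, h3, zero_add] at h1
  exact he h1

/-- The vertices of the transversal other than `o` and the edges leaving it; they index the
generators of the subgroup. -/
def IsIndex (k : V ⊕ (G × ι)) : Prop :=
  Sum.elim (fun y => y ∈ R.Y ∧ y ≠ T.o) (fun l => T.src l ∈ R.Y ∧ T.tgt l ∉ R.Y) k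

/-- The vertex attached to an index. -/
def vert (k : V ⊕ (G × ι)) : V := Sum.elim (fun y => y) (fun l => R.τ (T.tgt l) • T.o) k

theorem geo_vert_inr (l : G × ι) : T.geo T.o (R.vert (Sum.inr l)) =
    T.geo T.o (T.src l) + Finsupp.single l 1 +
      Finsupp.mapDomain (esmul (R.τ (T.tgt l))) (T.geo (R.rep (T.tgt l)) T.o) := by
  rw [← T.geo_edge, ← geo_smul, R.τ_smul_rep, geo_add, geo_add]
  rfl

theorem geo_vert_inr_of_ne {l : G × ι} (hl : T.src l ∈ R.Y) {e : G × ι} (hel : e ≠ l)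
    (he : T.geo T.o (R.vert (Sum.inr l)) e ≠ 0) :
    ∃ h ∈ H, T.src (esmul h e) ∈ R.Y ∧ T.tgt (esmul h e) ∈ R.Y := by
  rw [geo_vert_inr, Finsupp.add_apply, Finsupp.add_apply, Finsupp.single_eq_of_ne hel] at he
  by_cases h1 : T.geo T.o (T.src l) e = 0
  · obtain ⟨e', rfl⟩ : ∃ e', esmul (R.τ (T.tgt l)) e' = e :=
      ⟨esmul (R.τ (T.tgt l))⁻¹ e, by simp [esmul_esmul, esmul_one]⟩
    rw [h1, Finsupp.mapDomain_apply (esmul_injective _)] at he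
    refine ⟨(R.τ (T.tgt l))⁻¹, H.inv_mem (R.τ_mem _), ?_⟩
    rw [esmul_esmul, inv_mul_cancel, esmul_one]
    exact R.geo_support (R.rep_mem _) R.o_mem (by simpa using he)
  · refine ⟨1, H.one_mem, ?_⟩
    rw [esmul_one]
    exact R.geo_support R.o_mem hl h1

theorem geo_vert_inr_self {l : G × ι} (hl : T.src l ∈ R.Y) (hl' : T.tgt l ∉ R.Y) :
    T.geo T.o (R.vert (Sum.inr l)) l = 1 := by
  rw [geo_vert_inr, Finsupp.add_apply, Finsupp.add_apply, Finsupp.single_eq_same]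
  have h1 : T.geo T.o (T.src l) l = 0 :=
    by_contra fun h => hl' (R.geo_support R.o_mem hl h).2
  obtain ⟨e', he'⟩ : ∃ e', esmul (R.τ (T.tgt l)) e' = l :=
      ⟨esmul (R.τ (T.tgt l))⁻¹ l, by simp [esmul_esmul, esmul_one]⟩
  have h2 : Finsupp.mapDomain (esmul (R.τ (T.tgt l))) (T.geo (R.rep (T.tgt l)) T.o) l = 0 := by
    by_contra h
    have h4 : (Finsupp.mapDomain (esmul (R.τ (T.tgt l))) (T.geo (R.rep (T.tgt l)) T.o))
        (esmul (R.τ (T.tgt l)) e') ≠ 0 := by rwa [he']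
    rw [Finsupp.mapDomain_apply (esmul_injective _)] at h4
    have h3 := R.geo_support (R.rep_mem _) R.o_mem h4
    have := R.orbit_unique h3.1 hl (R.τ_mem _) he'
    exact hl' (this ▸ h3.2)
  rw [h1, h2]; simp

theorem no_relation (s : Finset (V ⊕ (G × ι))) (hs : ∀ k ∈ s, R.IsIndex k) (q : G → s → ℝ)
    (hq : ∀ g k, q g k ≠ 0 → g ∈ H)
    (hrel : ∀ e' : G × ι, ∑ k : s, conv (fun g => q g k) e' (T.geo T.o (R.vert k)) = 0) :
    q = 0 := by
  classical
  have hL : ∀ l (hl : Sum.inr l ∈ s) g, q g ⟨_, hl⟩ = 0 := by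
    intro l hl g
    by_contra hc
    have hg := hq _ _ hc
    have hl' : T.src l ∈ R.Y ∧ T.tgt l ∉ R.Y := hs _ hl
    have h1 := hrel (esmul g l)
    have key : ∀ e, (∃ h ∈ H, T.src (esmul h e) ∈ R.Y ∧ T.tgt (esmul h e) ∈ R.Y) →
        ∀ x ∈ H, esmul x e ≠ esmul g l := by
      rintro e ⟨h, hh, h1, h2⟩ x hx heq
      have h3 : esmul (h * x⁻¹ * g) l = esmul h e := by
        rw [← esmul_esmul, ← heq, esmul_esmul, inv_mul_cancel_right]
      have h4 := R.orbit_unique hl'.1 h1 (H.mul_mem (H.mul_mem hh (H.inv_mem hx)) hg) h3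
      rw [← h4] at h2
      exact hl'.2 h2
    rw [Finset.sum_eq_single ⟨_, hl⟩] at h1
    · rw [conv_eq] at h1
      · rw [R.geo_vert_inr_self hl'.1 hl'.2, one_mul] at h1
        exact hc h1
      · intro e he x hx heq
        by_contra hne
        exact key e (R.geo_vert_inr_of_ne hl'.1 hne he) x (hq _ _ hx) heq
    · rintro ⟨k, hk⟩ - hne
      have hk' := hs k hk
      rcases k with y | l₂
      · have hy : y ∈ R.Y ∧ y ≠ T.o := hk'
        have h3 : ∀ e, T.geo T.o y e ≠ 0 →
            ∃ h ∈ H, T.src (esmul h e) ∈ R.Y ∧ T.tgt (esmul h e) ∈ R.Y := fun e he =>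
          ⟨1, H.one_mem, by rw [esmul_one]; exact R.geo_support R.o_mem hy.1 he⟩
        have h2 : T.geo T.o y l = 0 := by_contra fun h =>
          hl'.2 (R.geo_support R.o_mem hy.1 h).2
        change conv (fun g => q g ⟨_, hk⟩) (esmul g l) (T.geo T.o y) = 0
        rw [conv_eq, h2, zero_mul]
        intro e he x hx heq
        exact absurd heq (key e (h3 e he) x (hq _ _ hx))
      · have hl₂ : T.src l₂ ∈ R.Y ∧ T.tgt l₂ ∉ R.Y := hk'
        have hne' : l ≠ l₂ := fun h => hne (by subst h; rfl)
        have h2 : T.geo T.o (R.vert (Sum.inr l₂)) l = 0 := by_contra fun h =>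
          key l (R.geo_vert_inr_of_ne hl₂.1 hne' h) g hg rfl
        change conv (fun g => q g ⟨_, hk⟩) (esmul g l) (T.geo T.o (R.vert (Sum.inr l₂))) = 0
        rw [conv_eq, h2, zero_mul]
        intro e he x hx heq
        by_cases hel : e = l₂
        · subst hel
          have h5 : esmul (g⁻¹ * x) e = l := by
            rw [← esmul_esmul, heq, esmul_esmul, inv_mul_cancel, esmul_one]
          exact R.orbit_unique hl₂.1 hl'.1 (H.mul_mem (H.inv_mem hg) (hq _ _ hx)) h5
        · exact absurd heq (key e (R.geo_vert_inr_of_ne hl₂.1 hel he) x (hq _ _ hx))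
    · simp
  have hgeo : ∀ g, ∑ k : s, q g k • T.geo T.o (R.vert k) = 0 := by
    intro g
    by_cases hg : g ∈ H
    · ext e
      simp only [Finsupp.coe_finsetSum, Finset.sum_apply, Finsupp.smul_apply, smul_eq_mul,
        Finsupp.zero_apply]
      by_cases heY : T.src e ∈ R.Y
      · rw [← hrel (esmul g e)]
        refine Finset.sum_congr rfl ?_
        rintro ⟨k, hk⟩ -
        rcases k with y | l
        · have hy : y ∈ R.Y ∧ y ≠ T.o := hs _ hk
          rw [conv_eq, mul_comm]
          intro e' he' x hx heq
          have h5 : esmul (g⁻¹ * x) e' = e := by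
            rw [← esmul_esmul, heq, esmul_esmul, inv_mul_cancel, esmul_one]
          exact R.orbit_unique (R.geo_support R.o_mem hy.1 he').1 heY
            (H.mul_mem (H.inv_mem hg) (hq _ _ hx)) h5
        · simp only [hL l hk, zero_mul]
          simp [conv, Finsupp.linearCombination_apply]
      · refine Finset.sum_eq_zero ?_
        rintro ⟨k, hk⟩ -
        rcases k with y | l
        · have hy : y ∈ R.Y ∧ y ≠ T.o := hs _ hk
          have : T.geo T.o y e = 0 := by_contra fun h => heY (R.geo_support R.o_mem hy.1 h).1
          simp [vert, this]
        · simp [hL l hk]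
    · refine Finset.sum_eq_zero fun k _ => ?_
      have : q g k = 0 := by_contra fun h => hg (hq _ _ h)
      simp [this]
  funext g ⟨k, hk⟩
  rcases k with y | l
  · have hy : y ∈ R.Y ∧ y ≠ T.o := hs _ hk
    have h1 := congrArg (fun w => T.bd w y) (hgeo g)
    simp only [map_sum, map_smul, bd_geo, map_zero, Finsupp.coe_finsetSum, Finset.sum_apply,
      Finsupp.smul_apply, Finsupp.sub_apply, smul_eq_mul, Finsupp.zero_apply] at h1
    rw [Finset.sum_eq_single ⟨_, hk⟩] at h1
    · simpa [vert, hy.2] using h1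
    · rintro ⟨k, hk'⟩ - hne
      rcases k with y' | l
      · have hne' : y ≠ y' := fun h => hne (by subst h; rfl)
        simp [vert, hy.2, hne']
      · simp [hL l hk']
    · simp
  · exact hL l hk g

end Transversal

/-- The indices of a transversal for the periodic elements are at most as many as the orbits of
edges. -/
theorem card_index_le [Fintype ι] (T : FreeTree G V ι) {φ : G →* G} (hφ : Function.Injective φ)
    {f : V → V} (hf : ∀ g v, f (g • v) = φ g • f v) (hfo : f T.o = T.o)
    (R : T.Transversal (perSubgroup φ)) (s : Finset (V ⊕ (G × ι)))
    (hs : ∀ k ∈ s, R.IsIndex k ∧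
      ∀ y, k = Sum.inl y → ∃ g ∈ perSubgroup φ, g ≠ 1 ∧ g • y = y) :
    s.card ≤ Fintype.card ι := by
  have hfN : ∀ N g v, f^[N] (g • v) = φ^[N] g • f^[N] v := by
    intro N
    induction N with
    | zero => intro g v; rfl
    | succ N ih => intro g v; rw [Function.iterate_succ_apply, hf, ih]; rfl
  have hfoN : ∀ N, f^[N] T.o = T.o := fun N => Function.iterate_fixed hfo N
  have hper : ∀ k : s, ∃ N, 0 < N ∧ f^[N] (R.vert k) = R.vert k := by
    rintro ⟨k, hk⟩
    rcases k with y | l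
    · obtain ⟨g, ⟨N, hN, hg⟩, hg1, hgy⟩ := (hs _ hk).2 y rfl
      refine ⟨N, hN, ?_⟩
      by_contra hne
      refine hg1 (T.eq_one_of_fix_two (x := f^[N] y) (y := y) ?_ hgy hne)
      have := hfN N g y
      rw [hgy] at this
      have hg' : φ^[N] g = g := hg
      rw [hg'] at this
      exact this.symm
    · obtain ⟨N, hN, hg⟩ := R.τ_mem (T.tgt l)
      refine ⟨N, hN, ?_⟩
      have hg' : φ^[N] (R.τ (T.tgt l)) = R.τ (T.tgt l) := hg
      change f^[N] (R.τ (T.tgt l) • T.o) = R.τ (T.tgt l) • T.o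
      rw [hfN, hfoN, hg']
  choose n hn hfix using hper
  set N := ∏ k, n k with hN
  have hNpos : 0 < N := Finset.prod_pos fun k _ => hn k
  have hfixN : ∀ k : s, f^[N] (R.vert k) = R.vert k := by
    intro k
    obtain ⟨m, hm⟩ := Finset.dvd_prod_of_mem n (Finset.mem_univ k)
    have : Function.IsPeriodicPt f (n k) (R.vert k) := hfix k
    have := this.mul_const m
    rw [← hm] at this
    exact this
  obtain ⟨ψ, hφN⟩ : ∃ ψ : G →* G, ⇑ψ = φ^[N] :=
    ⟨(show Monoid.End G from φ) ^ N, Monoid.End.coe_pow G φ N⟩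
  have := L2.card_le_card (κ := s) T (φ := ψ)
    (by rw [hφN]; exact hφ.iterate N) (f := f^[N])
    (by intro g v; rw [hφN]; exact hfN N g v) (hfoN N) (fun k => R.vert k) hfixN
    (fun q hq hrel => R.no_relation s (fun k hk => (hs k hk).1) q (fun g k hg => by
      obtain ⟨m, hm, h⟩ := hq g k hg
      rw [hφN, ← Function.iterate_mul] at h
      exact ⟨N * m, Nat.mul_pos hNpos hm, h⟩) (fun e' => hrel e'.1 e'.2))
  simpa using this

end FreeTree

/-- Edge cuts of a graph given by a relation. -/
structure CutGraph (W : Type) where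
  R : W → W → Prop
  symm : ∀ x y, R x y → R y x

namespace CutGraph

variable {W : Type} (Γ : CutGraph W)

/-- The directed edges leaving a set of vertices. -/
def bdry (A : Set W) : Set (W × W) := {p | p.1 ∈ A ∧ p.2 ∉ A ∧ Γ.R p.1 p.2}

/-- The set `A` spans a connected subgraph. -/
def Conn (A : Set W) : Prop :=
  ∀ B ⊆ A, B.Nonempty → (A \ B).Nonempty → ∃ a ∈ B, ∃ b ∈ A \ B, Γ.R a b

/-- Both sides of the cut are connected, and at most `n` edges are cut. -/
structure Tight (n : ℕ) (A : Set W) : Prop where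
  conn : Γ.Conn A
  conn_compl : Γ.Conn Aᶜ
  card : (Γ.bdry A).encard ≤ n

theorem bdry_compl (A : Set W) : Γ.bdry Aᶜ = Prod.swap '' Γ.bdry A := by
  ext ⟨x, y⟩
  rw [Set.image_swap_eq_preimage_swap]
  constructor
  · rintro ⟨h1, h2, h3⟩
    exact ⟨not_not.1 h2, h1, Γ.symm _ _ h3⟩
  · rintro ⟨h1, h2, h3⟩
    exact ⟨h2, not_not.2 h1, Γ.symm _ _ h3⟩

theorem encard_bdry_compl (A : Set W) : (Γ.bdry Aᶜ).encard = (Γ.bdry A).encard := by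
  rw [bdry_compl, Prod.swap_injective.encard_image]

variable {Γ}

theorem Tight.finite {n : ℕ} {A : Set W} (h : Γ.Tight n A) : (Γ.bdry A).Finite :=
  Set.finite_of_encard_le_coe h.card

theorem Conn.subset_of_bdry_empty {A B : Set W} (hA : Γ.Conn A) (hB : Γ.bdry B = ∅) {x : W}
    (hxA : x ∈ A) (hxB : x ∈ B) : A ⊆ B := by
  by_contra hc
  obtain ⟨y, hy, hyB⟩ := Set.not_subset.1 hc
  obtain ⟨a, ha, b, hb, hab⟩ := hA (A ∩ B) Set.inter_subset_left ⟨x, hxA, hxB⟩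
    ⟨y, hy, fun h => hyB h.2⟩
  have : (a, b) ∈ Γ.bdry B := ⟨ha.2, fun h => hb.2 ⟨hb.1, h⟩, hab⟩
  rw [hB] at this
  exact this

theorem Tight.eq_of_bdry_empty {n : ℕ} {A B : Set W} (hA : Γ.Tight n A) (hB : Γ.bdry B = ∅)
    {x y : W} (hxA : x ∈ A) (hyA : y ∉ A) (hxB : x ∈ B) (hyB : y ∉ B) : A = B := by
  refine (hA.conn.subset_of_bdry_empty hB hxA hxB).antisymm ?_
  have h1 : Γ.bdry Bᶜ = ∅ := by rw [bdry_compl, hB, Set.image_empty]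
  exact Set.compl_subset_compl.1 (hA.conn_compl.subset_of_bdry_empty h1 hyA hyB)

variable (Γ)

/-- Removal of an edge. -/
def erase (p : W × W) : CutGraph W where
  R x y := Γ.R x y ∧ (x, y) ≠ p ∧ (y, x) ≠ p
  symm _ _ h := ⟨Γ.symm _ _ h.1, h.2.2, h.2.1⟩

variable {Γ}

theorem Conn.erase {A : Set W} (hA : Γ.Conn A) {p : W × W} (hp : p.1 ∈ A → p.2 ∈ A → False) :
    (Γ.erase p).Conn A := by
  intro B hB h1 h2
  obtain ⟨a, ha, b, hb, hab⟩ := hA B hB h1 h2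
  refine ⟨a, ha, b, hb, hab, ?_, ?_⟩
  · rintro rfl; exact hp (hB ha) hb.1
  · rintro rfl; exact hp hb.1 (hB ha)

theorem Tight.erase {n : ℕ} {A : Set W} (hA : Γ.Tight (n + 1) A) {p : W × W} (hp : p ∈ Γ.bdry A) :
    (Γ.erase p).Tight n A := by
  refine ⟨hA.conn.erase fun _ h => hp.2.1 h, hA.conn_compl.erase fun h _ => h hp.1, ?_⟩
  have h1 : (Γ.erase p).bdry A ⊆ Γ.bdry A \ {p} := by
    rintro ⟨x, y⟩ ⟨h1, h2, h3⟩
    exact ⟨⟨h1, h2, h3.1⟩, h3.2.1⟩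
  refine (Set.encard_le_encard h1).trans ?_
  have h2 := Set.encard_sdiff_singleton_add_one hp
  have h3 := hA.card
  rw [← h2] at h3
  push_cast at h3
  exact (ENat.add_le_add_iff_right ENat.one_ne_top).1 h3

theorem exists_finite_crossed {x y : W} (h : Relation.ReflTransGen Γ.R x y) :
    ∃ F : Set (W × W), F.Finite ∧ ∀ A : Set W, x ∈ A → y ∉ A → ∃ p ∈ F, p ∈ Γ.bdry A := by
  induction h with
  | refl => exact ⟨∅, Set.finite_empty, fun A h1 h2 => absurd h1 h2⟩
  | @tail b c hb hbc ih =>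
    obtain ⟨F, hF, h⟩ := ih
    refine ⟨insert (b, c) F, hF.insert _, fun A h1 h2 => ?_⟩
    by_cases hbA : b ∈ A
    · exact ⟨(b, c), Set.mem_insert _ _, hbA, h2, hbc⟩
    · obtain ⟨p, hp, hpA⟩ := h A h1 hbA
      exact ⟨p, Or.inr hp, hpA⟩

theorem finite_tight_sep (n : ℕ) (Γ : CutGraph W) (x y : W) :
    {A | Γ.Tight n A ∧ x ∈ A ∧ y ∉ A}.Finite := by
  induction n generalizing Γ with
  | zero =>
    refine Set.Subsingleton.finite ?_
    rintro A ⟨hA, hx, hy⟩ B ⟨hB, hx', hy'⟩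
    refine hA.eq_of_bdry_empty ?_ hx hy hx' hy'
    have := hB.card
    simpa using this
  | succ n ih =>
    by_cases h : Relation.ReflTransGen Γ.R x y
    · obtain ⟨F, hF, hc⟩ := exists_finite_crossed h
      refine (hF.biUnion fun p _ => ih (Γ.erase p)).subset ?_
      rintro A ⟨hA, hx, hy⟩
      obtain ⟨p, hp, hpA⟩ := hc A hx hy
      exact Set.mem_biUnion hp ⟨hA.erase hpA, hx, hy⟩
    · refine Set.Subsingleton.finite ?_
      have h0 : Γ.bdry {z | Relation.ReflTransGen Γ.R x z} = ∅ := by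
        refine Set.eq_empty_of_forall_notMem ?_
        rintro ⟨a, b⟩ ⟨h1, h2, h3⟩
        exact h2 (Relation.ReflTransGen.tail h1 h3)
      rintro A ⟨hA, hx, hy⟩ B ⟨hB, hx', hy'⟩
      rw [hA.eq_of_bdry_empty h0 hx hy Relation.ReflTransGen.refl h,
        hB.eq_of_bdry_empty h0 hx' hy' Relation.ReflTransGen.refl h]

/-- All four corners are nonempty. -/
def Cross (A B : Set W) : Prop :=
  (A ∩ B).Nonempty ∧ (A ∩ Bᶜ).Nonempty ∧ (Aᶜ ∩ B).Nonempty ∧ (Aᶜ ∩ Bᶜ).Nonempty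

theorem Cross.symm {A B : Set W} (h : Cross A B) : Cross B A := by
  obtain ⟨h1, h2, h3, h4⟩ := h
  exact ⟨by rwa [Set.inter_comm], by rwa [Set.inter_comm], by rwa [Set.inter_comm],
    by rwa [Set.inter_comm]⟩

theorem Cross.compl_left {A B : Set W} (h : Cross A B) : Cross Aᶜ B := by
  obtain ⟨h1, h2, h3, h4⟩ := h
  exact ⟨h3, h4, by rwa [compl_compl], by rwa [compl_compl]⟩

theorem Cross.compl_right {A B : Set W} (h : Cross A B) : Cross A Bᶜ := h.symm.compl_left.symm

theorem cross_compl_left {A B : Set W} : Cross Aᶜ B ↔ Cross A B :=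
  ⟨fun h => by have := h.compl_left; rwa [compl_compl] at this, Cross.compl_left⟩

variable (Γ)

/-- The tight cuts crossing a given one. -/
def crossing (n : ℕ) (A : Set W) : Set (Set W) := {B | Γ.Tight n B ∧ Cross A B}

/-- The number of tight cuts crossing a given one. -/
noncomputable def crossNum (n : ℕ) (A : Set W) : ℕ := (Γ.crossing n A).ncard

theorem crossing_compl (n : ℕ) (A : Set W) : Γ.crossing n Aᶜ = Γ.crossing n A := by
  ext B; simp only [crossing, Set.mem_ofPred_eq, cross_compl_left]

theorem crossNum_compl (n : ℕ) (A : Set W) : Γ.crossNum n Aᶜ = Γ.crossNum n A := by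
  rw [crossNum, crossing_compl]; rfl

variable {Γ}

theorem finite_crossing (n : ℕ) {A : Set W} (hA : (Γ.bdry A).Finite) :
    (Γ.crossing n A).Finite := by
  have hF := (hA.image Prod.fst).union (hA.image Prod.snd)
  refine ((hF.prod hF).biUnion fun p _ => finite_tight_sep n Γ p.1 p.2).subset ?_
  rintro B ⟨hB, hc⟩
  have key : ∀ B : Set W, Γ.Conn B → (A ∩ B).Nonempty → (Aᶜ ∩ B).Nonempty →
      ∃ z ∈ Prod.fst '' Γ.bdry A ∪ Prod.snd '' Γ.bdry A, z ∈ B := by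
    rintro B hB h1 ⟨y, hy⟩
    obtain ⟨a, ha, b, hb, hab⟩ := hB (A ∩ B) Set.inter_subset_right h1
      ⟨y, hy.2, fun h => hy.1 h.1⟩
    exact ⟨a, Or.inl ⟨(a, b), ⟨ha.1, fun h => hb.2 ⟨h, hb.1⟩, hab⟩, rfl⟩, ha.2⟩
  obtain ⟨u, hu, huB⟩ := key B hB.conn hc.1 hc.2.2.1
  obtain ⟨v, hv, hvB⟩ := key Bᶜ hB.conn_compl hc.2.1 hc.2.2.2
  exact Set.mem_biUnion (show (u, v) ∈ _ from ⟨hu, hv⟩) ⟨hB, huB, hvB⟩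

theorem bdry_submodular (A B : Set W) :
    (Γ.bdry (A ∩ B)).encard + (Γ.bdry (A ∪ B)).encard ≤
      (Γ.bdry A).encard + (Γ.bdry B).encard := by
  rw [← Set.encard_union_add_encard_inter, ← Set.encard_union_add_encard_inter (Γ.bdry A)]
  refine add_le_add (Set.encard_le_encard ?_) (Set.encard_le_encard ?_)
  · rintro p (⟨h1, h2, h3⟩ | ⟨h1, h2, h3⟩)
    · by_cases h : p.2 ∈ A
      · exact Or.inr ⟨h1.2, fun h' => h2 ⟨h, h'⟩, h3⟩
      · exact Or.inl ⟨h1.1, h, h3⟩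
    · rcases h1 with h1 | h1
      · exact Or.inl ⟨h1, fun h => h2 (Or.inl h), h3⟩
      · exact Or.inr ⟨h1, fun h => h2 (Or.inr h), h3⟩
  · rintro p ⟨⟨h1, -, h3⟩, ⟨-, h2, -⟩⟩
    exact ⟨⟨h1.1, fun h => h2 (Or.inl h), h3⟩, ⟨h1.2, fun h => h2 (Or.inr h), h3⟩⟩

theorem cross_inter_imp {A B F : Set W} (hAB : Cross A B) (h : Cross (A ∩ B) F) :
    Cross A F ∨ Cross B F := by
  obtain ⟨⟨a, ha⟩, ⟨b, hb⟩, ⟨c, hc⟩, ⟨d, hd⟩⟩ := h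
  by_cases h1 : (Aᶜ ∩ F).Nonempty
  · by_cases h2 : (Aᶜ ∩ Fᶜ).Nonempty
    · exact Or.inl ⟨⟨a, ha.1.1, ha.2⟩, ⟨b, hb.1.1, hb.2⟩, h1, h2⟩
    · have hd' : d ∈ Bᶜ ∩ Fᶜ := ⟨fun hB => h2 ⟨d, fun hA => hd.1 ⟨hA, hB⟩, hd.2⟩, hd.2⟩
      by_cases h3 : (Bᶜ ∩ F).Nonempty
      · exact Or.inr ⟨⟨a, ha.1.2, ha.2⟩, ⟨b, hb.1.2, hb.2⟩, h3, ⟨d, hd'⟩⟩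
      · obtain ⟨z, hz⟩ := hAB.2.2.2
        by_cases hzF : z ∈ F
        · exact absurd ⟨z, hz.2, hzF⟩ h3
        · exact absurd ⟨z, hz.1, hzF⟩ h2
  · have hc' : c ∈ Bᶜ ∩ F := ⟨fun hB => h1 ⟨c, fun hA => hc.1 ⟨hA, hB⟩, hc.2⟩, hc.2⟩
    by_cases h3 : (Bᶜ ∩ Fᶜ).Nonempty
    · exact Or.inr ⟨⟨a, ha.1.2, ha.2⟩, ⟨b, hb.1.2, hb.2⟩, ⟨c, hc'⟩, h3⟩
    · obtain ⟨z, hz⟩ := hAB.2.2.2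
      by_cases hzF : z ∈ F
      · exact absurd ⟨z, hz.1, hzF⟩ h1
      · exact absurd ⟨z, hz.2, hzF⟩ h3

theorem cross_union_imp {A B F : Set W} (hAB : Cross A B) (h : Cross (A ∪ B) F) :
    Cross A F ∨ Cross B F := by
  rw [← cross_compl_left, Set.compl_union] at h
  have := cross_inter_imp hAB.compl_left.compl_right h
  rwa [cross_compl_left, cross_compl_left] at this

theorem crossNum_lt (n : ℕ) {A B : Set W} (hA : Γ.Tight n A) (hB : Γ.Tight n B) (h : Cross A B) :
    Γ.crossNum n (A ∩ B) + Γ.crossNum n (A ∪ B) < Γ.crossNum n A + Γ.crossNum n B := by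
  have hsub := Γ.bdry_submodular A B
  have hfin : (Γ.bdry A).encard + (Γ.bdry B).encard < ⊤ := by
    rw [ENat.add_lt_top]
    exact ⟨Set.encard_lt_top_iff.2 hA.finite, Set.encard_lt_top_iff.2 hB.finite⟩
  have hfC : (Γ.bdry (A ∩ B)).Finite :=
    Set.encard_lt_top_iff.1 ((le_self_add.trans hsub).trans_lt hfin)
  have hfD : (Γ.bdry (A ∪ B)).Finite :=
    Set.encard_lt_top_iff.1 ((le_add_self.trans hsub).trans_lt hfin)
  have fA := finite_crossing n hA.finite
  have fB := finite_crossing n hB.finite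
  simp only [crossNum]
  rw [← Set.ncard_union_add_ncard_inter _ _ (finite_crossing n hfC) (finite_crossing n hfD),
    ← Set.ncard_union_add_ncard_inter _ _ fA fB]
  refine add_lt_add_of_lt_of_le (Set.ncard_lt_ncard ?_ (fA.union fB))
    (Set.ncard_le_ncard ?_ (fA.inter_of_left _))
  · rw [Set.ssubset_iff_of_subset]
    · refine ⟨A, Or.inr ⟨hA, h.symm⟩, ?_⟩
      rintro (⟨-, h1⟩ | ⟨-, h1⟩)
      · obtain ⟨z, hz⟩ := h1.2.1
        exact hz.2 hz.1.1
      · obtain ⟨z, hz⟩ := h1.2.2.1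
        exact hz.1 (Or.inl hz.2)
    · rintro F (⟨hF, h1⟩ | ⟨hF, h1⟩)
      · rcases cross_inter_imp h h1 with h2 | h2
        · exact Or.inl ⟨hF, h2⟩
        · exact Or.inr ⟨hF, h2⟩
      · rcases cross_union_imp h h1 with h2 | h2
        · exact Or.inl ⟨hF, h2⟩
        · exact Or.inr ⟨hF, h2⟩
  · rintro F ⟨⟨hF, ⟨a, ha⟩, ⟨b, hb⟩, -, -⟩, ⟨-, -, -, ⟨c, hc⟩, ⟨d, hd⟩⟩⟩
    exact ⟨⟨hF, ⟨a, ha.1.1, ha.2⟩, ⟨b, hb.1.1, hb.2⟩, ⟨c, fun h => hc.1 (Or.inl h), hc.2⟩,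
      ⟨d, fun h => hd.1 (Or.inl h), hd.2⟩⟩, ⟨hF, ⟨a, ha.1.2, ha.2⟩, ⟨b, hb.1.2, hb.2⟩,
      ⟨c, fun h => hc.1 (Or.inr h), hc.2⟩, ⟨d, fun h => hd.1 (Or.inr h), hd.2⟩⟩⟩

variable (Γ)

/-- Among the cuts separating two ultrafilters, `A` has the fewest edges and, among those, the
fewest crossings. -/
structure IsMin (n : ℕ) (𝒰 𝒲 : Ultrafilter W) (A : Set W) : Prop where
  mem : A ∈ 𝒰
  notMem : A ∉ 𝒲
  card : (Γ.bdry A).encard ≤ n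
  le : ∀ B, B ∈ 𝒰 → B ∉ 𝒲 → (Γ.bdry A).encard ≤ (Γ.bdry B).encard
  le' : ∀ B, B ∈ 𝒰 → B ∉ 𝒲 → (Γ.bdry B).encard ≤ (Γ.bdry A).encard →
    Γ.crossNum n A ≤ Γ.crossNum n B

/-- A nested family of cuts. -/
def nest (n : ℕ) : Set (Set W) := {A | ∃ 𝒰 𝒲, Γ.IsMin n 𝒰 𝒲 A}

variable {Γ} {n : ℕ}

theorem IsMin.compl {𝒰 𝒲 : Ultrafilter W} {A : Set W} (h : Γ.IsMin n 𝒰 𝒲 A) :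
    Γ.IsMin n 𝒲 𝒰 Aᶜ := by
  refine ⟨Ultrafilter.compl_mem_iff_notMem.2 h.notMem, ?_, ?_, ?_, ?_⟩
  · rw [Ultrafilter.compl_notMem_iff]; exact h.mem
  · rw [encard_bdry_compl]; exact h.card
  · intro B h1 h2
    rw [encard_bdry_compl, ← encard_bdry_compl Γ B]
    exact h.le _ (Ultrafilter.compl_mem_iff_notMem.2 h2) (by rwa [Ultrafilter.compl_notMem_iff])
  · intro B h1 h2
    rw [encard_bdry_compl, ← encard_bdry_compl Γ B, crossNum_compl, ← crossNum_compl Γ n B]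
    exact h.le' _ (Ultrafilter.compl_mem_iff_notMem.2 h2) (by rwa [Ultrafilter.compl_notMem_iff])

theorem compl_mem_nest {A : Set W} (h : A ∈ Γ.nest n) : Aᶜ ∈ Γ.nest n := by
  obtain ⟨𝒰, 𝒲, h⟩ := h
  exact ⟨𝒲, 𝒰, h.compl⟩

theorem IsMin.nonempty {𝒰 𝒲 : Ultrafilter W} {A : Set W} (h : Γ.IsMin n 𝒰 𝒲 A) : A.Nonempty :=
  Ultrafilter.nonempty_of_mem h.mem

theorem nonempty_of_mem_nest {A : Set W} (h : A ∈ Γ.nest n) : A.Nonempty := by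
  obtain ⟨𝒰, 𝒲, h⟩ := h
  exact h.nonempty

theorem IsMin.conn (hΓ : Γ.Conn Set.univ) {𝒰 𝒲 : Ultrafilter W} {A : Set W}
    (h : Γ.IsMin n 𝒰 𝒲 A) : Γ.Conn A := by
  have key : ∀ B ⊆ A, (A \ B).Nonempty → B ∈ 𝒰 → ∃ a ∈ B, ∃ b ∈ A \ B, Γ.R a b := by
    intro B hB h2 hBU
    by_contra hc
    push Not at hc
    have hBW : B ∉ 𝒲 := fun hb => h.notMem (Filter.mem_of_superset hb hB)
    have h3 : Γ.bdry B ⊂ Γ.bdry A := by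
      rw [Set.ssubset_iff_of_subset]
      · obtain ⟨z, hz⟩ := h2
        obtain ⟨w, hw⟩ := h.compl.nonempty
        obtain ⟨a, ha, b, hb, hab⟩ := hΓ (A \ B) (Set.subset_univ _) ⟨z, hz⟩
          ⟨w, trivial, fun h => hw h.1⟩
        refine ⟨(a, b), ⟨ha.1, fun hbA => ?_, hab⟩, fun h => ha.2 h.1⟩
        refine hc b ?_ a ha (Γ.symm _ _ hab)
        by_contra hbB
        exact hb.2 ⟨hbA, hbB⟩
      · rintro ⟨a, b⟩ ⟨h3, h4, h5⟩
        exact ⟨hB h3, fun hbA => hc a h3 b ⟨hbA, h4⟩ h5, h5⟩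
    have hfin : (Γ.bdry B).Finite := (Set.finite_of_encard_le_coe h.card).subset h3.subset
    exact (hfin.encard_lt_encard h3).not_ge (h.le B hBU hBW)
  intro B hB h1 h2
  by_cases hBU : B ∈ 𝒰
  · exact key B hB h2 hBU
  · have h3 : A \ B ∈ 𝒰 := Filter.inter_mem h.mem (Ultrafilter.compl_mem_iff_notMem.2 hBU)
    have h4 : A \ (A \ B) = B := by rw [Set.sdiff_sdiff_cancel_left hB]
    obtain ⟨a, ha, b, hb, hab⟩ := key (A \ B) Set.sdiff_subset (by rwa [h4]) h3
    rw [h4] at hb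
    exact ⟨b, hb, a, ha, Γ.symm _ _ hab⟩

theorem IsMin.tight (hΓ : Γ.Conn Set.univ) {𝒰 𝒲 : Ultrafilter W} {A : Set W}
    (h : Γ.IsMin n 𝒰 𝒲 A) : Γ.Tight n A := ⟨h.conn hΓ, h.compl.conn hΓ, h.card⟩

theorem tight_of_mem_nest (hΓ : Γ.Conn Set.univ) {A : Set W} (h : A ∈ Γ.nest n) : Γ.Tight n A := by
  obtain ⟨𝒰, 𝒲, h⟩ := h
  exact h.tight hΓ

theorem finite_nest_sep (hΓ : Γ.Conn Set.univ) (x y : W) :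
    {A | A ∈ Γ.nest n ∧ x ∈ A ∧ y ∉ A}.Finite :=
  (finite_tight_sep n Γ x y).subset fun _ h => ⟨tight_of_mem_nest hΓ h.1, h.2⟩

theorem exists_isMin {𝒰 𝒲 : Ultrafilter W} {B : Set W} (h1 : B ∈ 𝒰) (h2 : B ∉ 𝒲)
    (h3 : (Γ.bdry B).encard ≤ n) : ∃ A, Γ.IsMin n 𝒰 𝒲 A := by
  set S : Set (Set W) := {A | A ∈ 𝒰 ∧ A ∉ 𝒲} with hS
  obtain ⟨A₀, hA₀, hmin⟩ := (InvImage.wf (fun A => (Γ.bdry A).encard)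
    (wellFounded_lt : WellFounded fun a b : ℕ∞ => a < b)).has_min S ⟨B, h1, h2⟩
  obtain ⟨A, hA, hmin'⟩ := (InvImage.wf (fun A => Γ.crossNum n A)
    (wellFounded_lt : WellFounded fun a b : ℕ => a < b)).has_min
    {A ∈ S | (Γ.bdry A).encard ≤ (Γ.bdry A₀).encard} ⟨A₀, hA₀, le_rfl⟩
  refine ⟨A, hA.1.1, hA.1.2, ?_, fun C h1 h2 => ?_, fun C h1 h2 h3 => ?_⟩
  · exact hA.2.trans ((not_lt.1 (hmin B ⟨h1, h2⟩)).trans h3)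
  · exact hA.2.trans (not_lt.1 (hmin C ⟨h1, h2⟩))
  · exact not_lt.1 (hmin' C ⟨⟨h1, h2⟩, h3.trans hA.2⟩)

theorem IsMin.uncross (hΓ : Γ.Conn Set.univ) {𝒰 𝒲 𝒵 𝒯 : Ultrafilter W} {A B : Set W}
    (hA : Γ.IsMin n 𝒰 𝒲 A) (hB : Γ.IsMin n 𝒵 𝒯 B) (h1 : A ∩ B ∈ 𝒰) (h2 : A ∩ B ∉ 𝒲)
    (h3 : A ∪ B ∈ 𝒵) (h4 : A ∪ B ∉ 𝒯) : ¬ Cross A B := by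
  intro hc
  have hsub := Γ.bdry_submodular A B
  have hC := hA.le _ h1 h2
  have hD := hB.le _ h3 h4
  have fA : (Γ.bdry A).encard ≠ ⊤ := (Set.encard_lt_top_iff.2 (hA.tight hΓ).finite).ne
  have fB : (Γ.bdry B).encard ≠ ⊤ := (Set.encard_lt_top_iff.2 (hB.tight hΓ).finite).ne
  have hC' : (Γ.bdry (A ∩ B)).encard ≤ (Γ.bdry A).encard :=
    (ENat.add_le_add_iff_right fB).1 ((add_le_add le_rfl hD).trans hsub)
  have hD' : (Γ.bdry (A ∪ B)).encard ≤ (Γ.bdry B).encard :=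
    (ENat.add_le_add_iff_left fA).1 ((add_le_add hC le_rfl).trans hsub)
  have h5 := hA.le' _ h1 h2 hC'
  have h6 := hB.le' _ h3 h4 hD'
  have := crossNum_lt n (hA.tight hΓ) (hB.tight hΓ) hc
  omega

theorem not_cross_of_mem_nest (hΓ : Γ.Conn Set.univ) {A B : Set W} (hA : A ∈ Γ.nest n)
    (hB : B ∈ Γ.nest n) : ¬ Cross A B := by
  obtain ⟨𝒰, 𝒲, hA⟩ := hA
  obtain ⟨𝒵, 𝒯, hB⟩ := hB
  have key : ∀ {B : Set W} {𝒵 𝒯 : Ultrafilter W}, Γ.IsMin n 𝒵 𝒯 B → B ∈ 𝒰 → ¬ Cross A B := by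
    intro B 𝒵 𝒯 hB hBU hc
    have hnu : ∀ {ℱ : Ultrafilter W} {C D : Set W}, C ∉ ℱ → D ∉ ℱ → C ∪ D ∉ ℱ := by
      intro ℱ C D h1 h2 h
      rcases Ultrafilter.union_mem_iff.1 h with h | h
      exacts [h1 h, h2 h]
    have hni : ∀ {ℱ : Ultrafilter W} {C D : Set W}, C ∉ ℱ → C ∩ D ∉ ℱ :=
      fun h1 h => h1 (Filter.mem_of_superset h Set.inter_subset_left)
    have hul : ∀ {ℱ : Ultrafilter W} {C D : Set W}, C ∈ ℱ → C ∪ D ∈ ℱ :=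
      fun h => Filter.mem_of_superset h Set.subset_union_left
    by_cases h1 : A ∈ 𝒯
    · by_cases h2 : B ∈ 𝒲
      · have hB' : Bᶜ ∈ 𝒯 := Ultrafilter.compl_mem_iff_notMem.2 hB.notMem
        exact hB.compl.uncross hΓ hA (Filter.inter_mem hB' h1) (hni hB.compl.notMem)
          (by rw [Set.union_comm]; exact hul hA.mem)
          (hnu (Ultrafilter.compl_notMem_iff.2 h2) hA.notMem) hc.compl_right.symm
      · by_cases h3 : A ∈ 𝒵
        · exact hB.uncross hΓ hA (Filter.inter_mem hB.mem h3) (hni hB.notMem) (hul hBU)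
            (hnu h2 hA.notMem) hc.symm
        · have h4 := hA.le B hBU h2
          have hZ : Aᶜ ∈ 𝒵 := Ultrafilter.compl_mem_iff_notMem.2 h3
          have hT : Aᶜ ∉ 𝒯 := Ultrafilter.compl_notMem_iff.2 h1
          have h5 := hB.le Aᶜ hZ hT
          rw [encard_bdry_compl] at h5
          have h6 := hB.le' Aᶜ hZ hT (by rw [encard_bdry_compl]; exact h4)
          rw [crossNum_compl] at h6
          have hB' : Γ.IsMin n 𝒰 𝒲 B := ⟨hBU, h2, hB.card,
            fun C hC hC' => h5.trans (hA.le C hC hC'),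
            fun C hC hC' h => h6.trans (hA.le' C hC hC' (h.trans h5))⟩
          exact hA.uncross hΓ hB' (Filter.inter_mem hA.mem hBU) (hni hA.notMem) (hul hA.mem)
            (hnu hA.notMem h2) hc
    · exact hA.uncross hΓ hB (Filter.inter_mem hA.mem hBU) (hni hA.notMem)
        (by rw [Set.union_comm]; exact hul hB.mem) (hnu h1 hB.notMem) hc
  intro hc
  by_cases hBU : B ∈ 𝒰
  · exact key hB hBU hc
  · exact key hB.compl (Ultrafilter.compl_mem_iff_notMem.2 hBU) hc.compl_right

section Automorphism

variable {e : W ≃ W}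

theorem bdry_preimage (A : Set W) (he : ∀ x y, Γ.R (e x) (e y) ↔ Γ.R x y) :
    Γ.bdry (e ⁻¹' A) = (e.prodCongr e) ⁻¹' Γ.bdry A := by
  ext ⟨x, y⟩
  simp [bdry, he]

theorem encard_bdry_preimage (A : Set W) (he : ∀ x y, Γ.R (e x) (e y) ↔ Γ.R x y) :
    (Γ.bdry (e ⁻¹' A)).encard = (Γ.bdry A).encard := by
  rw [bdry_preimage A he]
  exact Set.encard_preimage_of_bijective (e.prodCongr e).bijective _

theorem Conn.preimage {A : Set W} (hA : Γ.Conn A) (he : ∀ x y, Γ.R (e x) (e y) ↔ Γ.R x y) :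
    Γ.Conn (e ⁻¹' A) := by
  rintro B hB ⟨x, hx⟩ ⟨y, hy⟩
  obtain ⟨a, ha, b, hb, hab⟩ := hA (e '' B) (by rwa [Set.image_subset_iff]) ⟨e x, x, hx, rfl⟩
    ⟨e y, hy.1, fun ⟨z, hz, hzy⟩ => hy.2 (e.injective hzy ▸ hz)⟩
  obtain ⟨a, ha, rfl⟩ := ha
  refine ⟨a, ha, e.symm b, ⟨by simpa using hb.1, fun h => hb.2 ⟨_, h, by simp⟩⟩, ?_⟩
  rw [← he]
  simpa using hab

theorem Tight.preimage {A : Set W} (hA : Γ.Tight n A) (he : ∀ x y, Γ.R (e x) (e y) ↔ Γ.R x y) :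
    Γ.Tight n (e ⁻¹' A) :=
  ⟨hA.conn.preimage he, by rw [← Set.preimage_compl]; exact hA.conn_compl.preimage he,
    by rw [encard_bdry_preimage A he]; exact hA.card⟩

theorem cross_preimage {A B : Set W} : Cross (e ⁻¹' A) (e ⁻¹' B) ↔ Cross A B := by
  have key : ∀ C : Set W, (e ⁻¹' C).Nonempty ↔ C.Nonempty := fun C =>
    e.surjective.nonempty_preimage
  simp only [Cross, ← Set.preimage_compl, ← Set.preimage_inter, key]

theorem symm_iff (he : ∀ x y, Γ.R (e x) (e y) ↔ Γ.R x y) (x y : W) :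
    Γ.R (e.symm x) (e.symm y) ↔ Γ.R x y := by
  rw [← he]; simp

theorem crossNum_preimage (A : Set W) (he : ∀ x y, Γ.R (e x) (e y) ↔ Γ.R x y) :
    Γ.crossNum n (e ⁻¹' A) = Γ.crossNum n A := by
  have : Γ.crossing n (e ⁻¹' A) = (fun B => e ⁻¹' B) '' Γ.crossing n A := by
    ext B
    constructor
    · rintro ⟨hB, hc⟩
      refine ⟨e.symm ⁻¹' B, ⟨hB.preimage (symm_iff he), ?_⟩, by ext; simp⟩
      rw [← cross_preimage (e := e)]
      convert hc using 1
      ext; simp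
    · rintro ⟨B, ⟨hB, hc⟩, rfl⟩
      exact ⟨hB.preimage he, cross_preimage.2 hc⟩
  rw [crossNum, this, Set.ncard_image_of_injective _ e.surjective.preimage_injective]
  rfl

theorem preimage_mem_nest {A : Set W} (hA : A ∈ Γ.nest n)
    (he : ∀ x y, Γ.R (e x) (e y) ↔ Γ.R x y) : e ⁻¹' A ∈ Γ.nest n := by
  obtain ⟨𝒰, 𝒲, h⟩ := hA
  have key : ∀ (ℱ : Ultrafilter W) (B : Set W), B ∈ ℱ.map e.symm ↔ e.symm ⁻¹' B ∈ ℱ :=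
    fun ℱ B => Iff.rfl
  have hA' : e.symm ⁻¹' (e ⁻¹' A) = A := by ext; simp
  refine ⟨𝒰.map e.symm, 𝒲.map e.symm, ?_, ?_, ?_, ?_, ?_⟩
  · rw [key, hA']; exact h.mem
  · rw [key, hA']; exact h.notMem
  · rw [encard_bdry_preimage A he]; exact h.card
  · intro B h1 h2
    rw [encard_bdry_preimage A he, ← encard_bdry_preimage B (symm_iff he)]
    exact h.le _ h1 h2
  · intro B h1 h2
    rw [encard_bdry_preimage A he, ← encard_bdry_preimage B (symm_iff he),
      crossNum_preimage A he, ← crossNum_preimage B (symm_iff he)]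
    exact h.le' _ h1 h2

end Automorphism

end CutGraph

/-- A nested family of subsets, closed under complements, separating points, and such that any two
points are separated by finitely many members. -/
structure CutNest (W : Type) where
  E : Set (Set W)
  compl_mem : ∀ A ∈ E, Aᶜ ∈ E
  nonempty : ∀ A ∈ E, A.Nonempty
  nested : ∀ A ∈ E, ∀ B ∈ E, A ⊆ B ∨ A ⊆ Bᶜ ∨ Aᶜ ⊆ B ∨ B ⊆ A
  finite_sep : ∀ x y, {A | A ∈ E ∧ x ∉ A ∧ y ∈ A}.Finite
  exists_sep : ∀ x y, x ≠ y → ∃ A ∈ E, x ∉ A ∧ y ∈ A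

namespace CutNest

theorem compl_ssubset_compl' {W : Type} {A B : Set W} : Aᶜ ⊂ Bᶜ ↔ B ⊂ A :=
  compl_lt_compl_iff_lt (x := B) (y := A)

variable {W : Type} (N : CutNest W)

/-- The orientation of the family by the source of a cut. -/
def ori (A : Set W) : Set (Set W) := {B | B ∈ N.E ∧ (A ⊆ B ∨ Aᶜ ⊂ B)}

/-- The orientation of the family by a point. -/
def pt (v : W) : Set (Set W) := {B | B ∈ N.E ∧ v ∈ B}

/-- The cuts separating two points. -/
def sep (x y : W) : Set (Set W) := {A | A ∈ N.E ∧ x ∉ A ∧ y ∈ A}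

variable {N}

theorem not_compl_subset {A B : Set W} (hA : A ∈ N.E) (h1 : A ⊆ B) (h2 : A ⊆ Bᶜ) : False := by
  obtain ⟨a, ha⟩ := N.nonempty A hA
  exact h2 ha (h1 ha)

theorem pt_injective : Function.Injective N.pt := by
  intro x y h
  by_contra hne
  obtain ⟨A, hA, hx, hy⟩ := N.exists_sep x y hne
  have : A ∈ N.pt x := by rw [h]; exact ⟨hA, hy⟩
  exact hx this.2

theorem mem_ori_or {A B : Set W} (hA : A ∈ N.E) (hB : B ∈ N.E) : B ∈ N.ori A ∨ Bᶜ ∈ N.ori A := by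
  have hB' := N.compl_mem B hB
  rcases N.nested A hA B hB with h | h | h | h
  · exact Or.inl ⟨hB, Or.inl h⟩
  · exact Or.inr ⟨hB', Or.inl h⟩
  · rcases eq_or_ssubset_of_subset h with h | h
    · right; rw [← h, compl_compl]; exact ⟨hA, Or.inl subset_rfl⟩
    · exact Or.inl ⟨hB, Or.inr h⟩
  · rcases eq_or_ssubset_of_subset h with h | h
    · left; rw [h]; exact ⟨hA, Or.inl subset_rfl⟩
    · exact Or.inr ⟨hB', Or.inr (compl_ssubset_compl'.2 h)⟩

theorem ori_subset_of_adjacent {A B : Set W} (hA : A ∈ N.E) (hB : B ∈ N.E) (hAB : A ⊂ B)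
    (h : ∀ D ∈ N.E, ¬ (A ⊂ D ∧ D ⊂ B)) : N.ori B ⊆ N.ori Aᶜ := by
  rintro D ⟨hD, h1 | h1⟩
  · exact ⟨hD, Or.inr (by rw [compl_compl]; exact hAB.trans_subset h1)⟩
  · have hno : ¬ Bᶜ ⊆ A := fun h2 => not_compl_subset (N.compl_mem B hB) (h2.trans hAB.1) subset_rfl
    refine ⟨hD, ?_⟩
    rw [compl_compl]
    rcases N.nested A hA D hD with h2 | h2 | h2 | h2
    · rcases eq_or_ssubset_of_subset h2 with h2 | h2
      · exact absurd (h2 ▸ h1.1) hno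
      · exact Or.inr h2
    · have h3 : Dᶜ ⊂ B := by rwa [← compl_ssubset_compl', compl_compl]
      rcases eq_or_ssubset_of_subset h2 with h2 | h2
      · left; rw [h2, compl_compl]
      · exact absurd ⟨h2, h3⟩ (h _ (N.compl_mem D hD))
    · exact Or.inl h2
    · exact absurd (h1.1.trans h2) hno

theorem ori_eq_of_adjacent {A B : Set W} (hA : A ∈ N.E) (hB : B ∈ N.E) (hAB : A ⊂ B)
    (h : ∀ D ∈ N.E, ¬ (A ⊂ D ∧ D ⊂ B)) : N.ori B = N.ori Aᶜ := by
  refine (ori_subset_of_adjacent hA hB hAB h).antisymm ?_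
  have := ori_subset_of_adjacent (N.compl_mem B hB) (N.compl_mem A hA)
    (compl_ssubset_compl'.2 hAB) fun D hD h' => h Dᶜ (N.compl_mem D hD)
      ⟨by rw [← compl_ssubset_compl', compl_compl]; exact h'.2,
        by rw [← compl_ssubset_compl', compl_compl]; exact h'.1⟩
  rwa [compl_compl] at this

theorem ori_eq_pt {A : Set W} (hA : A ∈ N.E) {y : W} (hy : y ∈ A)
    (h : ∀ D ∈ N.E, y ∈ D → ¬ D ⊂ A) : N.ori A = N.pt y := by
  ext D
  constructor
  · rintro ⟨hD, h1 | h1⟩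
    · exact ⟨hD, h1 hy⟩
    · refine ⟨hD, ?_⟩
      by_contra hyD
      exact h _ (N.compl_mem D hD) hyD (by rwa [← compl_ssubset_compl', compl_compl])
  · rintro ⟨hD, hyD⟩
    refine ⟨hD, ?_⟩
    rcases N.nested A hA D hD with h2 | h2 | h2 | h2
    · exact Or.inl h2
    · exact absurd hyD (h2 hy)
    · rcases eq_or_ssubset_of_subset h2 with h2 | h2
      · rw [← h2] at hyD; exact absurd hy hyD
      · exact Or.inr h2
    · rcases eq_or_ssubset_of_subset h2 with h2 | h2
      · left; rw [h2]
      · exact absurd h2 (h D hD hyD)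

theorem sep_total {x y : W} {A B : Set W} (hA : A ∈ N.sep x y) (hB : B ∈ N.sep x y) :
    A ⊆ B ∨ B ⊆ A := by
  rcases N.nested A hA.1 B hB.1 with h | h | h | h
  · exact Or.inl h
  · exact absurd hB.2.2 (h hA.2.2)
  · exact absurd (h hA.2.1) hB.2.1
  · exact Or.inr h

theorem sum_above (p : Set (Set W) → ℚ) (x y : W) (m : ℕ) : ∀ A ∈ N.sep x y,
    {B | B ∈ N.sep x y ∧ A ⊂ B}.ncard = m →
    ∑ᶠ B ∈ {B | B ∈ N.sep x y ∧ A ⊆ B}, (p (N.ori B) - p (N.ori Bᶜ)) =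
      p (N.ori A) - p (N.pt x) := by
  induction m using Nat.strong_induction_on with
  | _ m ih =>
  intro A hA hm
  have hfin : {B | B ∈ N.sep x y ∧ A ⊂ B}.Finite := (N.finite_sep x y).subset fun B h => h.1
  have hins : {B | B ∈ N.sep x y ∧ A ⊆ B} = insert A {B | B ∈ N.sep x y ∧ A ⊂ B} := by
    ext B
    simp only [Set.mem_ofPred_eq, Set.mem_insert_iff]
    constructor
    · rintro ⟨h1, h2⟩
      rcases eq_or_ssubset_of_subset h2 with h | h
      exacts [Or.inl h.symm, Or.inr ⟨h1, h⟩]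
    · rintro (rfl | ⟨h1, h2⟩)
      exacts [⟨hA, subset_rfl⟩, ⟨h1, h2.1⟩]
  rw [hins, finsum_mem_insert _ (fun h => h.2.ne rfl) hfin]
  rcases Set.eq_empty_or_nonempty {B | B ∈ N.sep x y ∧ A ⊂ B} with h0 | h0
  · rw [h0, finsum_mem_empty, add_zero]
    congr 2
    refine ori_eq_pt (N.compl_mem A hA.1) hA.2.1 fun D hD hxD hDA => ?_
    have : Dᶜ ∈ {B | B ∈ N.sep x y ∧ A ⊂ B} := by
      have h1 : A ⊂ Dᶜ := by rwa [← compl_ssubset_compl', compl_compl]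
      exact ⟨⟨N.compl_mem D hD, fun h => h hxD, h1.1 hA.2.2⟩, h1⟩
    rw [h0] at this
    exact this
  · obtain ⟨B, hB⟩ := hfin.exists_minimal h0
    have hset : {D | D ∈ N.sep x y ∧ A ⊂ D} = {D | D ∈ N.sep x y ∧ B ⊆ D} := by
      ext D
      constructor
      · rintro ⟨h1, h2⟩
        refine ⟨h1, ?_⟩
        rcases sep_total hB.1.1 h1 with h | h
        · exact h
        · exact hB.2 (y := D) ⟨h1, h2⟩ h
      · rintro ⟨h1, h2⟩
        exact ⟨h1, hB.1.2.trans_subset h2⟩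
    have hlt : {D | D ∈ N.sep x y ∧ B ⊂ D}.ncard < m := by
      rw [← hm]
      refine Set.ncard_lt_ncard ?_ hfin
      rw [Set.ssubset_iff_of_subset]
      · exact ⟨B, hB.1, fun h => h.2.ne rfl⟩
      · rintro D ⟨h1, h2⟩
        exact ⟨h1, hB.1.2.trans h2⟩
    rw [hset, ih _ hlt B hB.1.1 rfl, ori_eq_of_adjacent hA.1 hB.1.1.1 hB.1.2]
    · ring
    · rintro D hD ⟨h1, h2⟩
      exact h2.not_subset (hB.2 (y := D) ⟨⟨hD, fun h => hB.1.1.2.1 (h2.1 h), h1.1 hA.2.2⟩, h1⟩ h2.1)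

theorem sum_sep (p : Set (Set W) → ℚ) (x y : W) :
    ∑ᶠ B ∈ N.sep x y, (p (N.ori B) - p (N.ori Bᶜ)) = p (N.pt y) - p (N.pt x) := by
  rcases Set.eq_empty_or_nonempty (N.sep x y) with h0 | h0
  · have : x = y := by
      by_contra hne
      obtain ⟨A, hA⟩ := N.exists_sep x y hne
      have : A ∈ N.sep x y := hA
      rw [h0] at this
      exact this
    rw [h0, this]; simp
  · obtain ⟨A, hA⟩ := Set.Finite.exists_minimal (N.finite_sep x y) h0
    have hset : N.sep x y = {B | B ∈ N.sep x y ∧ A ⊆ B} := by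
      ext D
      refine ⟨fun h => ⟨h, ?_⟩, fun h => h.1⟩
      rcases sep_total hA.1 h with h' | h'
      exacts [h', hA.2 h h']
    rw [hset, sum_above p x y _ A hA.1 rfl, ori_eq_pt hA.1.1 hA.1.2.2]
    intro D hD hyD hDA
    exact hDA.not_subset (hA.2 (y := D) ⟨hD, fun h => hA.1.2.1 (hDA.1 h), hyD⟩ hDA.1)

end CutNest

open Pointwise

/-- A potential with prescribed increments along orbits. -/
theorem exists_increment {Q X : Type} [Group Q] [MulAction Q X] (H : Subgroup Q) (u : Q → ℚ)
    (hu : ∀ g ∈ H, ∀ h ∈ H, u (g * h) = u g + u h) :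
    ∃ F : X → ℚ, ∀ x, (∀ h ∈ H, h • x = x → u h = 0) → ∀ h ∈ H, F (h • x) = F x + u h := by
  have h0 : ∀ x : X, ∃ h : H, h • (Quotient.mk (MulAction.orbitRel H X) x).out = x := by
    intro x
    have := Quotient.mk_out (s := MulAction.orbitRel H X) x
    obtain ⟨h, hh⟩ := this
    exact ⟨h⁻¹, by rw [← hh]; exact inv_smul_smul h x⟩
  choose c hc using h0
  have u1 : u 1 = 0 := by
    have := hu 1 H.one_mem 1 H.one_mem
    rw [mul_one] at this; linarith
  have uinv : ∀ g ∈ H, u g⁻¹ = - u g := by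
    intro g hg
    have := hu g⁻¹ (H.inv_mem hg) g hg
    rw [inv_mul_cancel, u1] at this; linarith
  refine ⟨fun x => u (c x : Q), fun x hx h hh => ?_⟩
  have hq : Quotient.mk (MulAction.orbitRel H X) (h • x) = Quotient.mk (MulAction.orbitRel H X) x :=
    Quotient.sound ⟨⟨h, hh⟩, rfl⟩
  have e1 := hc (h • x)
  rw [hq] at e1
  have e2 := hc x
  set r := (Quotient.mk (MulAction.orbitRel H X) x).out
  have e1' : (c (h • x) : Q) • r = h • x := e1
  have e2' : (c x : Q) • r = x := e2
  have e3 : (h⁻¹ * ((c (h • x) : Q) * (c x : Q)⁻¹)) • x = x := by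
    rw [mul_smul, mul_smul]
    have e5 : (c x : Q)⁻¹ • x = r := by rw [inv_smul_eq_iff, e2']
    rw [e5, e1', inv_smul_smul]
  have m1 := (c (h • x)).2
  have m2 := (c x).2
  have e4 := hx _ (H.mul_mem (H.inv_mem hh) (H.mul_mem m1 (H.inv_mem m2))) e3
  rw [hu _ (H.inv_mem hh) _ (H.mul_mem m1 (H.inv_mem m2)), hu _ m1 _ (H.inv_mem m2), uinv _ hh,
    uinv _ m2] at e4
  show u (c (h • x)) = u (c x) + u h
  linarith

/-- A group acting on a nested family of cuts, normalised by an automorphism fixing a base point. -/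
structure NestAction (W Q : Type) [Group Q] [MulAction Q W] extends CutNest W where
  P : Subgroup Q
  f : Q
  o : W
  smul_E : ∀ g ∈ P, ∀ A ∈ E, g • A ∈ E
  f_E : ∀ A ∈ E, f • A ∈ E
  inv_f_E : ∀ A ∈ E, f⁻¹ • A ∈ E
  conj_mem : ∀ g ∈ P, f * g * f⁻¹ ∈ P
  f_o : f • o = o
  fix_or : ∀ g ∈ P, (∃ x : W, g • x = x) ∨ ∃ D ∈ E,
    (∃ᶠ N : ℕ in Filter.atTop, g ^ (N.factorial : ℤ) • o ∈ D) ∧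
    ∃ᶠ N : ℕ in Filter.atTop, g ^ (-(N.factorial : ℤ)) • o ∉ D
  fix_two : ∀ g ∈ P, ∀ x y : W, g • x = x → g • y = y → x ≠ y → g = 1
  fix_mul : ∀ g ∈ P, ∀ h ∈ P, g ≠ 1 → h ≠ 1 → ∀ x y : W, g • x = x → h • y = y → x ≠ y →
    ∀ z : W, (g * h) • z ≠ z

namespace NestAction

variable {W Q : Type} [Group Q] [MulAction Q W] (N : NestAction W Q)

/-- The elements of `P` commuting with `f`. -/
def H : Subgroup Q := N.P ⊓ Subgroup.centralizer {N.f}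

variable {N}

theorem mem_H {h : Q} : h ∈ N.H ↔ h ∈ N.P ∧ N.f * h = h * N.f := by
  simp only [H, Subgroup.mem_inf, Subgroup.mem_centralizer_iff, Set.mem_singleton_iff, forall_eq]

theorem smul_ori {σ : Q} (h1 : ∀ A ∈ N.E, σ • A ∈ N.E) (h2 : ∀ A ∈ N.E, σ⁻¹ • A ∈ N.E)
    (A : Set W) : σ • N.ori A = N.ori (σ • A) := by
  ext B
  rw [Set.mem_smul_set_iff_inv_smul_mem]
  have e1 : ∀ C : Set W, C ⊆ σ⁻¹ • B ↔ σ • C ⊆ B := fun C => by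
    rw [Set.subset_smul_set_iff, inv_inv]
  have e2 : ∀ C : Set W, C ⊂ σ⁻¹ • B ↔ σ • C ⊂ B := fun C => by
    have e3 : σ⁻¹ • B ⊆ C ↔ B ⊆ σ • C := by
      rw [Set.smul_set_subset_iff_subset_inv_smul_set, inv_inv]
    rw [ssubset_iff_subset_not_subset, ssubset_iff_subset_not_subset, e1, e3]
  constructor
  · rintro ⟨h, h'⟩
    refine ⟨by simpa using h1 _ h, ?_⟩
    rwa [e1, e2, Set.smul_set_compl] at h'
  · rintro ⟨h, h'⟩
    refine ⟨h2 _ h, ?_⟩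
    rwa [e1, e2, Set.smul_set_compl]

theorem inv_smul_E {g : Q} (hg : g ∈ N.P) : ∀ A ∈ N.E, g⁻¹ • A ∈ N.E :=
  N.smul_E _ (N.P.inv_mem hg)

theorem smul_pt {σ : Q} (h1 : ∀ A ∈ N.E, σ • A ∈ N.E) (h2 : ∀ A ∈ N.E, σ⁻¹ • A ∈ N.E)
    (v : W) : σ • N.pt v = N.pt (σ • v) := by
  ext B
  rw [Set.mem_smul_set_iff_inv_smul_mem]
  constructor
  · rintro ⟨h, h'⟩
    refine ⟨by simpa using h1 _ h, ?_⟩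
    rwa [Set.mem_smul_set_iff_inv_smul_mem, inv_inv] at h'
  · rintro ⟨h, h'⟩
    refine ⟨h2 _ h, ?_⟩
    rwa [Set.mem_smul_set_iff_inv_smul_mem, inv_inv]

theorem zpow_smul_E {g : Q} (hg : g ∈ N.P) {D : Set W} (hD : D ∈ N.E) (j : ℤ) :
    g ^ j • D ∈ N.E := N.smul_E _ (N.P.zpow_mem hg j) _ hD

theorem finite_sep_zpow {g : Q} (hg : g ∈ N.P) {D : Set W} (hD : D ∈ N.E)
    (hinj : Function.Injective fun j : ℤ => g ^ j • D) (x y : W) :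
    {j : ℤ | ¬ (x ∈ g ^ j • D ↔ y ∈ g ^ j • D)}.Finite := by
  refine (((N.finite_sep x y).union (N.finite_sep y x)).preimage hinj.injOn).subset ?_
  intro j hj
  have := zpow_smul_E hg hD j
  by_cases hx : x ∈ g ^ j • D
  · exact Or.inr ⟨this, fun hy => hj (iff_of_true hx hy), hx⟩
  · exact Or.inl ⟨this, hx, by_contra fun hy => hj (iff_of_false hx hy)⟩

theorem zpow_mem_ori {g : Q} {A D : Set W} (hD : D ∈ N.ori A)
    (h : g • N.ori A = N.ori A) (j : ℤ) : g ^ j • D ∈ N.ori A := by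
  have h1 : g ^ j ∈ MulAction.stabilizer Q (N.ori A) := Subgroup.zpow_mem _ h j
  have h2 : g ^ j • N.ori A = N.ori A := h1
  rw [← h2]
  exact Set.smul_mem_smul_set hD

theorem finite_notMem_of_mem_ori {g : Q} (hg : g ∈ N.P) {A D : Set W} (hA : A ∈ N.E)
    (hD : D ∈ N.ori A) (h : g • N.ori A = N.ori A)
    (hinj : Function.Injective fun j : ℤ => g ^ j • D) (x : W) :
    {j : ℤ | x ∉ g ^ j • D}.Finite := by
  obtain ⟨a, ha⟩ := N.nonempty A hA
  obtain ⟨b, hb⟩ := N.nonempty Aᶜ (N.compl_mem A hA)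
  refine ((finite_sep_zpow hg hD.1 hinj x a).union (finite_sep_zpow hg hD.1 hinj x b)).subset ?_
  intro j hj
  have hj' : x ∉ g ^ j • D := hj
  rcases (zpow_mem_ori hD h j).2 with h1 | h1
  · exact Or.inl fun h2 => hj' (h2.2 (h1 ha))
  · exact Or.inr fun h2 => hj' (h2.2 (h1.1 hb))

theorem not_finite_of_frequently {S : Set ℤ} (hS : S.Finite) (s : ℤ) (hs : s = 1 ∨ s = -1)
    (h : ∃ᶠ N : ℕ in Filter.atTop, s * (N.factorial : ℤ) ∈ S) : False := by
  obtain ⟨M, hM⟩ := (hS.image Int.natAbs).bddAbove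
  obtain ⟨k, hk, hkS⟩ := (Filter.frequently_atTop.1 h) (M + 1)
  have h1 := hM ⟨_, hkS, rfl⟩
  have h2 := Nat.self_le_factorial k
  rcases hs with rfl | rfl <;> simp at h1 <;> omega

theorem exists_fix {g : Q} (hg : g ∈ N.P) {A : Set W} (hA : A ∈ N.E)
    (h : g • N.ori A = N.ori A) : ∃ x : W, g • x = x := by
  rcases N.fix_or g hg with h1 | ⟨D, hD, h1, h2⟩
  · exact h1
  exfalso
  have hno : ∀ m : ℤ, 0 < m → g ^ m • D ≠ D := by
    intro m hm he
    have key : ∀ k : ℕ, m.natAbs ≤ k → g ^ (k.factorial : ℤ) • D = D := by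
      intro k hk
      obtain ⟨c, hc⟩ := Nat.dvd_factorial (Int.natAbs_pos.2 hm.ne') hk
      have : g ^ (k.factorial : ℤ) ∈ MulAction.stabilizer Q D := by
        have h3 : ((k.factorial : ℕ) : ℤ) = m * c := by rw [hc]; push_cast; rw [abs_of_pos hm]
        rw [h3, zpow_mul]
        exact Subgroup.zpow_mem _ (show g ^ m ∈ MulAction.stabilizer Q D from he) _
      exact this
    obtain ⟨k, hk, hk'⟩ := Filter.frequently_atTop.1 h1 m.natAbs
    obtain ⟨l, hl, hl'⟩ := Filter.frequently_atTop.1 h2 m.natAbs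
    rw [← key k hk, Set.smul_mem_smul_set_iff] at hk'
    apply hl'
    rw [zpow_neg, ← Set.mem_smul_set_iff_inv_smul_mem, key l hl]
    exact hk'
  have hinj : Function.Injective fun j : ℤ => g ^ j • D := by
    have aux : ∀ i j : ℤ, g ^ i • D = g ^ j • D → i < j → False := by
      intro i j hij hlt
      refine hno (j - i) (by omega) ?_
      rw [sub_eq_neg_add, zpow_add, mul_smul, ← hij, zpow_neg, inv_smul_smul]
    intro i j hij
    rcases lt_trichotomy i j with h3 | h3 | h3
    · exact (aux i j hij h3).elim
    · exact h3
    · exact (aux j i hij.symm h3).elim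
  rcases CutNest.mem_ori_or hA hD with h3 | h3
  · refine not_finite_of_frequently (finite_notMem_of_mem_ori hg hA h3 h hinj N.o) 1 (Or.inl rfl) ?_
    refine h2.mono fun k hk => ?_
    rw [one_mul]
    show N.o ∉ g ^ (k.factorial : ℤ) • D
    rwa [Set.mem_smul_set_iff_inv_smul_mem, ← zpow_neg]
  · have hinj' : Function.Injective fun j : ℤ => g ^ j • Dᶜ := by
      intro i j hij
      apply hinj
      simpa [Set.smul_set_compl] using hij
    refine not_finite_of_frequently (finite_notMem_of_mem_ori hg hA h3 h hinj' N.o) (-1)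
      (Or.inr rfl) ?_
    refine h1.mono fun k hk => ?_
    rw [neg_one_mul]
    show N.o ∉ g ^ (-(k.factorial : ℤ)) • Dᶜ
    rw [Set.mem_smul_set_iff_inv_smul_mem, zpow_neg, inv_inv]
    exact fun h => h hk

theorem smul_ori_of_mem {g : Q} (hg : g ∈ N.P) (A : Set W) : g • N.ori A = N.ori (g • A) :=
  smul_ori (N.smul_E g hg) (inv_smul_E hg) A

theorem smul_pt_of_mem {g : Q} (hg : g ∈ N.P) (x : W) : g • N.pt x = N.pt (g • x) :=
  smul_pt (N.smul_E g hg) (inv_smul_E hg) x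

theorem smul_eq_of_smul_pt {g : Q} (hg : g ∈ N.P) {x : W} (h : g • N.pt x = N.pt x) :
    g • x = x := by
  rw [smul_pt_of_mem hg] at h
  exact CutNest.pt_injective h

variable (N) in
/-- The fixed point `x` of `f` is attached to the orientation `w`. -/
def Att (w : Set (Set W)) (x : W) : Prop :=
  N.f • x = x ∧ (w = N.pt x ∨ ∃ g ∈ N.P, g ≠ 1 ∧ g • w = w ∧ g • x = x)

variable (N) in
/-- Every group element that stabilises the orientation has a fixed point. -/
def Good (w : Set (Set W)) : Prop := ∀ g ∈ N.P, g • w = w → ∃ x : W, g • x = x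

theorem good_ori {A : Set W} (hA : A ∈ N.E) : N.Good (N.ori A) := fun _ hg h => exists_fix hg hA h

theorem good_pt (x : W) : N.Good (N.pt x) := fun _ hg h => ⟨x, smul_eq_of_smul_pt hg h⟩

theorem Good.smul {w : Set (Set W)} (hw : N.Good w) {g : Q} (hg : g ∈ N.P) : N.Good (g • w) := by
  intro k hk hkw
  obtain ⟨x, hx⟩ := hw (g⁻¹ * (k * g)) (N.P.mul_mem (N.P.inv_mem hg) (N.P.mul_mem hk hg))
    (by rw [mul_smul, mul_smul, hkw, inv_smul_smul])
  refine ⟨g • x, ?_⟩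
  rwa [mul_smul, mul_smul, inv_smul_eq_iff] at hx

theorem Good.eq_of_fix {w : Set (Set W)} (hw : N.Good w) {g h : Q} (hg : g ∈ N.P) (hh : h ∈ N.P)
    (hg1 : g ≠ 1) (hh1 : h ≠ 1) (hgw : g • w = w) (hhw : h • w = w) {x y : W} (hx : g • x = x)
    (hy : h • y = y) : x = y := by
  by_contra hne
  obtain ⟨z, hz⟩ := hw (g * h) (N.P.mul_mem hg hh) (by rw [mul_smul, hhw, hgw])
  exact N.fix_mul g hg h hh hg1 hh1 x y hx hy hne z hz

theorem Att.unique {w : Set (Set W)} (hw : N.Good w) {x y : W} (hx : N.Att w x)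
    (hy : N.Att w y) : x = y := by
  obtain ⟨-, hx⟩ := hx
  obtain ⟨-, hy⟩ := hy
  have key : ∀ {x y : W} {g : Q}, w = N.pt x → g ∈ N.P → g ≠ 1 → g • w = w → g • y = y → x = y := by
    intro x y g h1 hg hg1 hgw hgy
    by_contra hne
    exact hg1 (N.fix_two g hg x y (smul_eq_of_smul_pt hg (by rw [← h1, hgw])) hgy hne)
  rcases hx with hx | ⟨g, hg, hg1, hgw, hgx⟩
  · rcases hy with hy | ⟨h, hh, hh1, hhw, hhy⟩
    · exact CutNest.pt_injective (hx.symm.trans hy)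
    · exact key hx hh hh1 hhw hhy
  · rcases hy with hy | ⟨h, hh, hh1, hhw, hhy⟩
    · exact (key hy hg hg1 hgw hgx).symm
    · exact hw.eq_of_fix hg hh hg1 hh1 hgw hhw hgx hhy

theorem smul_fixed {h : Q} (hh : h ∈ N.H) {x : W} (hx : N.f • x = x) : N.f • h • x = h • x := by
  rw [← mul_smul, (mem_H.1 hh).2, mul_smul, hx]

theorem Att.smul {w : Set (Set W)} {x : W} (hx : N.Att w x) {h : Q} (hh : h ∈ N.H) :
    N.Att (h • w) (h • x) := by
  have hP := (mem_H.1 hh).1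
  refine ⟨smul_fixed hh hx.1, ?_⟩
  rcases hx.2 with hx | ⟨g, hg, hg1, hgw, hgx⟩
  · left; rw [hx, smul_pt_of_mem hP]
  · right
    refine ⟨h * g * h⁻¹, N.P.mul_mem (N.P.mul_mem hP hg) (N.P.inv_mem hP), ?_, ?_, ?_⟩
    · rwa [Ne, conj_eq_one_iff]
    · rw [mul_smul, inv_smul_smul, mul_smul, hgw]
    · rw [mul_smul, inv_smul_smul, mul_smul, hgx]

theorem Good.exists_att {w : Set (Set W)} (hw : N.Good w) (hf : N.f • w = w) {g : Q} (hg : g ∈ N.P)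
    (hg1 : g ≠ 1) (hgw : g • w = w) : ∃ x, N.Att w x ∧ g • x = x := by
  obtain ⟨x, hx⟩ := hw g hg hgw
  refine ⟨x, ⟨?_, Or.inr ⟨g, hg, hg1, hgw, hx⟩⟩, hx⟩
  refine hw.eq_of_fix (N.conj_mem g hg) hg ?_ hg1 ?_ hgw ?_ hx
  · rwa [Ne, conj_eq_one_iff]
  · have h1 : N.f⁻¹ • w = w := by rw [inv_smul_eq_iff, hf]
    rw [mul_smul, mul_smul, h1, hgw, hf]
  · rw [mul_smul, inv_smul_smul, mul_smul, hx]

theorem exists_orientation_potential (F : W → ℚ)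
    (hF : ∀ h ∈ N.H, ∀ v, N.f • v = v → F (h • v) = F v + F (h • N.o)) :
    ∃ Φ : Set (Set W) → ℚ, (∀ w x, N.Good w → N.Att w x → Φ w = F x) ∧
      ∀ w, N.Good w → N.f • w = w → ∀ h ∈ N.H, Φ (h • w) = Φ w + F (h • N.o) := by
  classical
  have hFo : F N.o = 0 := by
    have := hF 1 N.H.one_mem N.o N.f_o
    rw [one_smul] at this; linarith
  obtain ⟨Ψ, hΨ⟩ := exists_increment (X := Set (Set W)) N.H (fun h => F (h • N.o)) (by
    intro g hg h hh
    show F ((g * h) • N.o) = _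
    rw [mul_smul, hF g hg _ (smul_fixed hh N.f_o), add_comm])
  have hval : ∀ w x, N.Good w → N.Att w x →
      (if h : ∃ x, N.Att w x then F h.choose else Ψ w) = F x := by
    intro w x hw hx
    have h : ∃ x, N.Att w x := ⟨x, hx⟩
    rw [dif_pos h, h.choose_spec.unique hw hx]
  refine ⟨fun w => if h : ∃ x, N.Att w x then F h.choose else Ψ w, hval, fun w hw hf h hh => ?_⟩
  have hP := (mem_H.1 hh).1
  by_cases hx : ∃ x, N.Att w x
  · obtain ⟨x, hx⟩ := hx
    show (if h : _ then _ else _) = (if h : _ then _ else _) + _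
    rw [hval w x hw hx, hval _ _ (hw.smul hP) (hx.smul hh), hF h hh x hx.1]
  · have hx' : ¬ ∃ x, N.Att (h • w) x := by
      rintro ⟨x, hx'⟩
      have := hx'.smul (N.H.inv_mem hh)
      rw [inv_smul_smul] at this
      exact hx ⟨_, this⟩
    show (if h : _ then _ else _) = (if h : _ then _ else _) + _
    rw [dif_neg hx, dif_neg hx']
    refine hΨ w (fun k hk hkw => ?_) h hh
    by_cases hk1 : k = 1
    · rw [hk1, one_smul, hFo]
    · obtain ⟨x, hx', -⟩ := hw.exists_att hf (mem_H.1 hk).1 hk1 hkw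
      exact absurd ⟨x, hx'⟩ hx

variable (N) in
/-- The cuts separating two fixed points of `f`. -/
def fixedSep : Set (Set W) := {A | ∃ x y : W, N.f • x = x ∧ N.f • y = y ∧ A ∈ N.sep x y}

theorem mem_E_of_fixedSep {A : Set W} (hA : A ∈ N.fixedSep) : A ∈ N.E := by
  obtain ⟨x, y, hx, hy, h⟩ := hA
  exact h.1

theorem compl_mem_fixedSep {A : Set W} (hA : A ∈ N.fixedSep) : Aᶜ ∈ N.fixedSep := by
  obtain ⟨x, y, hx, hy, h⟩ := hA
  exact ⟨y, x, hy, hx, N.compl_mem A h.1, fun h' => h' h.2.2, h.2.1⟩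

theorem f_smul_of_fixedSep {A : Set W} (hA : A ∈ N.fixedSep) : N.f • A = A := by
  obtain ⟨x, y, hx, hy, hA⟩ := hA
  have hstep : ∀ B, B ∈ N.sep x y → N.f • B ∈ N.sep x y := by
    intro B hB
    refine ⟨N.f_E B hB.1, fun h => hB.2.1 ?_, ?_⟩
    · rwa [← hx, Set.smul_mem_smul_set_iff] at h
    · rw [← hy, Set.smul_mem_smul_set_iff]; exact hB.2.2
  have hpow : ∀ k : ℕ, N.f ^ k • A ∈ N.sep x y := by
    intro k
    induction k with
    | zero => rwa [pow_zero, one_smul]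
    | succ k ih => rw [pow_succ', mul_smul]; exact hstep _ ih
  by_contra hne
  refine Set.infinite_of_injective_forall_mem (f := fun k : ℕ => N.f ^ k • A) ?_ hpow
    (N.finite_sep x y)
  rcases CutNest.sep_total (hstep A hA) hA with h | h
  · have h1 : StrictAnti fun k : ℕ => N.f ^ k • A := by
      refine strictAnti_nat_of_succ_lt fun k => ?_
      show N.f ^ (k + 1) • A < N.f ^ k • A
      refine lt_of_le_of_ne ?_ ?_
      · rw [pow_succ, mul_smul]; exact Set.smul_set_subset_smul_set_iff.2 h
      · rw [pow_succ, mul_smul]; exact fun h => hne (smul_left_cancel _ h)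
    exact h1.injective
  · have h1 : StrictMono fun k : ℕ => N.f ^ k • A := by
      refine strictMono_nat_of_lt_succ fun k => ?_
      show N.f ^ k • A < N.f ^ (k + 1) • A
      refine lt_of_le_of_ne ?_ ?_
      · rw [pow_succ, mul_smul]; exact Set.smul_set_subset_smul_set_iff.2 h
      · rw [pow_succ, mul_smul]; exact fun h => hne (smul_left_cancel _ h).symm
    exact h1.injective

theorem exists_weight (F : W → ℚ)
    (hF : ∀ h ∈ N.H, ∀ v, N.f • v = v → F (h • v) = F v + F (h • N.o)) :
    ∃ Φ : Set (Set W) → ℚ, (∀ x, N.f • x = x → Φ (N.pt x) = F x) ∧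
      ∀ A ∈ N.fixedSep, ∀ g ∈ N.P, g • A ∈ N.fixedSep →
        Φ (N.ori (g • A)) - Φ (N.ori (g • A)ᶜ) = Φ (N.ori A) - Φ (N.ori Aᶜ) := by
  obtain ⟨Φ, h1, h2⟩ := exists_orientation_potential F hF
  refine ⟨Φ, fun x hx => h1 _ x (good_pt x) ⟨hx, Or.inl rfl⟩, fun A hA g hg hgA => ?_⟩
  have hfo : ∀ {B : Set W}, B ∈ N.fixedSep → N.f • N.ori B = N.ori B := fun hB => by
    rw [smul_ori N.f_E N.inv_f_E, f_smul_of_fixedSep hB]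
  have hzero : ∀ {B : Set W} {k : Q}, B ∈ N.fixedSep → k ∈ N.P → k ≠ 1 → k • B = B →
      Φ (N.ori B) - Φ (N.ori Bᶜ) = 0 := by
    intro B k hB hk hk1 hkB
    obtain ⟨x, hx, hkx⟩ := (good_ori (mem_E_of_fixedSep hB)).exists_att (hfo hB) hk hk1
      (by rw [smul_ori_of_mem hk, hkB])
    obtain ⟨y, hy, hky⟩ := (good_ori (mem_E_of_fixedSep (compl_mem_fixedSep hB))).exists_att
      (hfo (compl_mem_fixedSep hB)) hk hk1
      (by rw [smul_ori_of_mem hk, Set.smul_set_compl, hkB])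
    have hxy : x = y := by
      by_contra hne
      exact hk1 (N.fix_two k hk x y hkx hky hne)
    rw [h1 _ x (good_ori (mem_E_of_fixedSep hB)) hx,
      h1 _ y (good_ori (mem_E_of_fixedSep (compl_mem_fixedSep hB))) hy, hxy, sub_self]
  have hconj : (N.f * g * N.f⁻¹) • A = g • A := by
    have : N.f⁻¹ • A = A := by rw [inv_smul_eq_iff, f_smul_of_fixedSep hA]
    rw [mul_smul, mul_smul, this, f_smul_of_fixedSep hgA]
  have hcP := N.conj_mem g hg
  by_cases hk : N.f * g * N.f⁻¹ = g
  · have hgH : g ∈ N.H := mem_H.2 ⟨hg, by rwa [mul_inv_eq_iff_eq_mul] at hk⟩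
    rw [← Set.smul_set_compl, ← smul_ori_of_mem hg, ← smul_ori_of_mem hg,
      h2 _ (good_ori (mem_E_of_fixedSep hA)) (hfo hA) g hgH,
      h2 _ (good_ori (mem_E_of_fixedSep (compl_mem_fixedSep hA)))
        (hfo (compl_mem_fixedSep hA)) g hgH]
    ring
  · rw [hzero hA (N.P.mul_mem (N.P.inv_mem hg) hcP), hzero hgA (N.P.mul_mem hcP (N.P.inv_mem hg))]
    · rwa [Ne, mul_inv_eq_one]
    · rw [mul_smul, inv_smul_smul, hconj]
    · rw [Ne, inv_mul_eq_one]; exact fun h => hk h.symm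
    · rw [mul_smul, hconj, inv_smul_smul]

theorem exists_invariant_weight (a : Set W → ℚ)
    (ha : ∀ A ∈ N.fixedSep, ∀ g ∈ N.P, g • A ∈ N.fixedSep → a (g • A) = a A) :
    ∃ b : Set W → ℚ, (∀ A ∈ N.fixedSep, b A = a A) ∧ ∀ g ∈ N.P, ∀ A, b (g • A) = b A := by
  classical
  have key : ∀ A, ∀ g ∈ N.P, g • A ∈ N.fixedSep →
      (if h : ∃ g ∈ N.P, g • A ∈ N.fixedSep then a (h.choose • A) else 0) = a (g • A) := by
    intro A g hg hgA
    have h : ∃ g ∈ N.P, g • A ∈ N.fixedSep := ⟨g, hg, hgA⟩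
    rw [dif_pos h]
    have := ha _ hgA (h.choose * g⁻¹) (N.P.mul_mem h.choose_spec.1 (N.P.inv_mem hg))
    rw [mul_smul, inv_smul_smul] at this
    exact this h.choose_spec.2
  refine ⟨fun A => if h : ∃ g ∈ N.P, g • A ∈ N.fixedSep then a (h.choose • A) else 0,
    fun A hA => ?_, fun g hg A => ?_⟩
  · have := key A 1 N.P.one_mem (by rwa [one_smul])
    rw [one_smul] at this
    exact this
  · show (if h : _ then _ else _) = (if h : _ then _ else _)
    by_cases h : ∃ k ∈ N.P, k • A ∈ N.fixedSep
    · obtain ⟨k, hk, hkA⟩ := h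
      rw [key A k hk hkA, key (g • A) (k * g⁻¹) (N.P.mul_mem hk (N.P.inv_mem hg)), mul_smul,
        inv_smul_smul]
      rwa [mul_smul, inv_smul_smul]
    · rw [dif_neg h, dif_neg]
      rintro ⟨k, hk, hkA⟩
      exact h ⟨k * g, N.P.mul_mem hk hg, by rwa [mul_smul]⟩

theorem exists_extension (F : W → ℚ)
    (hF : ∀ h ∈ N.H, ∀ v, N.f • v = v → F (h • v) = F v + F (h • N.o)) :
    ∃ D : W → ℚ, (∀ v, N.f • v = v → D v = F v) ∧
      ∀ g ∈ N.P, ∀ v, D (g • v) = D v + D (g • N.o) := by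
  classical
  obtain ⟨Φ, h1, h2⟩ := exists_weight F hF
  obtain ⟨b, hb, hb'⟩ := exists_invariant_weight
    (fun A => Φ (N.ori A) - Φ (N.ori Aᶜ)) h2
  have hFo : F N.o = 0 := by
    have := hF 1 N.H.one_mem N.o N.f_o
    rw [one_smul] at this; linarith
  set c : W → W → Set W → ℚ := fun x y A =>
    (N.sep x y).indicator b A - (N.sep y x).indicator b A with hc
  have hfin : ∀ x y, Function.HasFiniteSupport ((N.sep x y).indicator b) := fun x y =>
    (N.finite_sep x y).subset Set.support_indicator_subset
  have hcfin : ∀ x y, Function.HasFiniteSupport (c x y) := by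
    intro x y
    refine ((N.finite_sep x y).union (N.finite_sep y x)).subset ?_
    intro A hA
    by_contra hn
    rw [Set.mem_union, not_or] at hn
    apply hA
    show (N.sep x y).indicator b A - (N.sep y x).indicator b A = 0
    have n1 : A ∉ N.sep x y := hn.1
    have n2 : A ∉ N.sep y x := hn.2
    rw [Set.indicator_of_notMem n1, Set.indicator_of_notMem n2, sub_zero]
  have hadd : ∀ x y z, ∑ᶠ A, c x z A = ∑ᶠ A, c x y A + ∑ᶠ A, c y z A := by
    intro x y z
    rw [← finsum_add_distrib (hcfin x y) (hcfin y z)]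
    refine finsum_congr fun A => ?_
    simp only [hc, Set.indicator_apply, CutNest.sep, Set.mem_ofPred_eq]
    by_cases hA : A ∈ N.E <;> by_cases hx : x ∈ A <;> by_cases hy : y ∈ A <;>
      by_cases hz : z ∈ A <;> simp [hA, hx, hy, hz]
  have hinv : ∀ g ∈ N.P, ∀ x y, ∑ᶠ A, c (g • x) (g • y) A = ∑ᶠ A, c x y A := by
    intro g hg x y
    rw [← finsum_comp_equiv (MulAction.toPerm g : Equiv.Perm (Set W))]
    refine finsum_congr fun A => ?_
    have hs : ∀ x y, g • A ∈ N.sep (g • x) (g • y) ↔ A ∈ N.sep x y := by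
      intro x y
      have h3 : g • A ∈ N.E ↔ A ∈ N.E :=
        ⟨fun h => by simpa using inv_smul_E hg _ h, N.smul_E g hg A⟩
      simp only [CutNest.sep, Set.mem_ofPred_eq, Set.smul_mem_smul_set_iff, h3]
    show (N.sep (g • x) (g • y)).indicator b (g • A) - (N.sep (g • y) (g • x)).indicator b (g • A) =
      (N.sep x y).indicator b A - (N.sep y x).indicator b A
    simp only [Set.indicator_apply, hs, hb' g hg A]
  have hval : ∀ x y, N.f • x = x → N.f • y = y → ∑ᶠ A, (N.sep x y).indicator b A = F y - F x := by
    intro x y hx hy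
    rw [← finsum_mem_def, ← h1 x hx, ← h1 y hy, ← CutNest.sum_sep Φ x y]
    exact finsum_mem_congr rfl fun A hA => hb A ⟨x, y, hx, hy, hA⟩
  refine ⟨fun v => (∑ᶠ A, c N.o v A) / 2, fun v hv => ?_, fun g hg v => ?_⟩
  · show (∑ᶠ A, c N.o v A) / 2 = F v
    rw [hc, finsum_sub_distrib (hfin _ _) (hfin _ _), hval _ _ N.f_o hv, hval _ _ hv N.f_o, hFo]
    ring
  · show (∑ᶠ A, c N.o (g • v) A) / 2 = (∑ᶠ A, c N.o v A) / 2 + (∑ᶠ A, c N.o (g • N.o) A) / 2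
    rw [hadd N.o (g • N.o) (g • v), hinv g hg]
    ring

end NestAction

namespace FreeTree

variable {G V ι : Type} [Group G] [MulAction G V]

/-- The orbit of the base point together with the points with nontrivial stabilizer. -/
def core (T : FreeTree G V ι) (H : Subgroup G) : SubMulAction H V where
  carrier := {v | (∃ g ∈ H, g • T.o = v) ∨ ∃ g ∈ H, g ≠ 1 ∧ g • v = v}
  smul_mem' := by
    rintro ⟨h, hh⟩ v (⟨g, hg, rfl⟩ | ⟨g, hg, hg1, hgv⟩)
    · exact Or.inl ⟨h * g, H.mul_mem hh hg, mul_smul _ _ _⟩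
    · refine Or.inr ⟨h * g * h⁻¹, H.mul_mem (H.mul_mem hh hg) (H.inv_mem hh), ?_, ?_⟩
      · rwa [Ne, conj_eq_one_iff]
      · show (h * g * h⁻¹) • h • v = h • v
        rw [mul_smul, inv_smul_smul, mul_smul, hgv]

namespace Transversal

variable {T : FreeTree G V ι} {H : Subgroup G} (R : T.Transversal H)

/-- The indices that contribute a generator of the subgroup. -/
def IsGen (k : V ⊕ (G × ι)) : Prop :=
  R.IsIndex k ∧ ∀ y, k = Sum.inl y → ∃ g ∈ H, g ≠ 1 ∧ g • y = y

theorem vert_mem_core {k : V ⊕ (G × ι)} (hk : R.IsGen k) : R.vert k ∈ T.core H := by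
  rcases k with y | l
  · exact Or.inr (hk.2 y rfl)
  · exact Or.inl ⟨_, R.τ_mem _, rfl⟩

theorem gen_induction (q : V → Prop)
    (hq : ∀ g ∈ H, ∀ k, R.IsGen k → (q (g • T.o) ↔ q (g • R.vert k))) {v : V}
    (hv : v ∈ T.core H) : q v ↔ q T.o := by
  classical
  let S : Subgroup G :=
    { carrier := {g | g ∈ H ∧ ∀ g' ∈ H, (q (g' • T.o) ↔ q ((g' * g) • T.o))}
      one_mem' := ⟨H.one_mem, by simp⟩
      mul_mem' := by
        rintro a b ⟨ha, ha'⟩ ⟨hb, hb'⟩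
        refine ⟨H.mul_mem ha hb, fun g hg => ?_⟩
        rw [ha' g hg, hb' (g * a) (H.mul_mem hg ha), mul_assoc]
      inv_mem' := by
        rintro a ⟨ha, ha'⟩
        refine ⟨H.inv_mem ha, fun g hg => ?_⟩
        rw [ha' (g * a⁻¹) (H.mul_mem hg (H.inv_mem ha)), inv_mul_cancel_right] }
  have hS : H ≤ S := by
    refine R.le_of_generators S ?_ ?_
    · intro y hy a ha hay
      refine ⟨ha, fun g hg => ?_⟩
      by_cases h1 : a = 1
      · rw [h1, mul_one]
      · by_cases h2 : y = T.o
        · exact absurd (T.free _ (h2 ▸ hay)) h1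
        · have hk : R.IsGen (Sum.inl y) :=
            ⟨⟨hy, h2⟩, fun y' hy' => by obtain rfl := Sum.inl.inj hy'; exact ⟨a, ha, h1, hay⟩⟩
          have e1 := hq g hg _ hk
          have e2 := hq (g * a) (H.mul_mem hg ha) _ hk
          have e3 : (g * a) • R.vert (Sum.inl y) = g • R.vert (Sum.inl y) := by
            rw [mul_smul]; exact congrArg _ hay
          rw [e1, e2, e3]
    · intro l hl
      refine ⟨R.τ_mem _, fun g hg => ?_⟩
      by_cases h1 : T.tgt l ∈ R.Y
      · rw [R.τ_of_mem _ h1, mul_one]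
      · have hk : R.IsGen (Sum.inr l) := ⟨⟨hl, h1⟩, fun y hy => by cases hy⟩
        rw [hq g hg _ hk, mul_smul]; rfl
  have horb : ∀ g ∈ H, (q (g • T.o) ↔ q T.o) := fun g hg => by
    have := (hS hg).2 1 H.one_mem
    rw [one_smul, one_mul] at this
    exact this.symm
  rcases hv with ⟨g, hg, rfl⟩ | ⟨g, hg, hg1, hgv⟩
  · exact horb g hg
  · have h3 := R.τ_smul_rep v
    by_cases h2 : R.rep v = T.o
    · rw [← h3, h2]; exact horb _ (R.τ_mem _)
    · have hk : R.IsGen (Sum.inl (R.rep v)) :=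
        ⟨⟨R.rep_mem _, h2⟩, fun y' hy' => by
          obtain rfl := Sum.inl.inj hy'
          refine ⟨(R.τ v)⁻¹ * g * R.τ v, H.mul_mem (H.mul_mem (H.inv_mem (R.τ_mem _)) hg)
            (R.τ_mem _), ?_, ?_⟩
          · intro h
            apply hg1
            have : g = R.τ v * ((R.τ v)⁻¹ * g * R.τ v) * (R.τ v)⁻¹ := by group
            rw [this, h]; group
          · rw [mul_smul, mul_smul, h3, hgv, inv_smul_eq_iff, h3]⟩
      have e1 := hq _ (R.τ_mem v) _ hk
      have e2 : R.τ v • R.vert (Sum.inl (R.rep v)) = v := h3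
      rw [e2] at e1
      rw [← e1]; exact horb _ (R.τ_mem _)

end Transversal

/-- The graph on the core joining the translates of the base point to those of a set. -/
def coreGraph (T : FreeTree G V ι) (H : Subgroup G) (U : Set V) : CutGraph (T.core H) where
  R x y := ∃ g ∈ H, ∃ u ∈ U, ((x : V) = g • T.o ∧ (y : V) = g • u) ∨
    ((y : V) = g • T.o ∧ (x : V) = g • u)
  symm := by
    rintro x y ⟨g, hg, u, hu, h⟩
    exact ⟨g, hg, u, hu, h.symm⟩

theorem exists_bdry_le (T : FreeTree G V ι) (H : Subgroup G) {U : Set V} (hU : U.Finite) :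
    ∃ n : ℕ, ∀ s, ((T.coreGraph H U).bdry {w | (w : V) ∈ T.side s}).encard ≤ n := by
  have hX : (⋃ u ∈ U, (fun e => (u, e)) '' {e | ¬ (T.o ∈ T.half e ↔ u ∈ T.half e)}).Finite :=
    hU.biUnion fun u _ => (T.finite_sep _ _).image _
  set X := ⋃ u ∈ U, (fun e => (u, e)) '' {e | ¬ (T.o ∈ T.half e ↔ u ∈ T.half e)} with hXdef
  have hXB := hX.prod (Set.finite_univ (α := Bool))
  refine ⟨(X ×ˢ (Set.univ : Set Bool)).ncard, fun s => ?_⟩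
  rw [hXB.cast_ncard_eq]
  let γ : G × ι → G := fun e => s.1.1 * e.1⁻¹
  let Φ : (V × (G × ι)) × Bool → V × V := fun p =>
    bif p.2 then (γ p.1.2 • T.o, γ p.1.2 • p.1.1) else (γ p.1.2 • p.1.1, γ p.1.2 • T.o)
  have hsub : (fun p : T.core H × T.core H => ((p.1 : V), (p.2 : V))) ''
      ((T.coreGraph H U).bdry {w | (w : V) ∈ T.side s}) ⊆ Φ '' (X ×ˢ (Set.univ : Set Bool)) := by
    rintro _ ⟨⟨x, y⟩, ⟨hx, hy, g, hg, u, hu, h⟩, rfl⟩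
    have hγ : γ (esmul g⁻¹ s.1) = g := by simp [γ, esmul]
    have hmem : ¬ (g • T.o ∈ T.half s.1 ↔ g • u ∈ T.half s.1) →
        (u, esmul g⁻¹ s.1) ∈ X := by
      intro h1
      simp only [hXdef, Set.mem_iUnion]
      refine ⟨u, hu, _, ?_, rfl⟩
      have h2 : ∀ v, v ∈ T.half (esmul g⁻¹ s.1) ↔ g • v ∈ T.half s.1 := fun v => by
        have := T.smul_mem_half (g := g) (e := esmul g⁻¹ s.1) (v := v)
        rw [esmul_esmul, mul_inv_cancel, esmul_one] at this
        exact this.symm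
      rw [Set.mem_ofPred_eq, h2, h2]; exact h1
    have hx' : (x : V) ∈ T.half s.1 ↔ s.2 = true := hx
    have hy' : ¬ ((y : V) ∈ T.half s.1 ↔ s.2 = true) := hy
    rcases h with ⟨e1, e2⟩ | ⟨e1, e2⟩
    · refine ⟨((u, esmul g⁻¹ s.1), true), ⟨hmem ?_, trivial⟩, ?_⟩
      · rw [← e1, ← e2]; tauto
      · simp only [Φ, hγ, cond_true]; exact Prod.ext e1.symm e2.symm
    · refine ⟨((u, esmul g⁻¹ s.1), false), ⟨hmem ?_, trivial⟩, ?_⟩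
      · rw [← e1, ← e2]; tauto
      · simp only [Φ, hγ, cond_false]; exact Prod.ext e2.symm e1.symm
  have hinj : Function.Injective
      (fun p : T.core H × T.core H => ((p.1 : V), (p.2 : V))) := by
    rintro ⟨a, b⟩ ⟨c, d⟩ h
    simp only [Prod.mk.injEq] at h
    rw [Subtype.ext h.1, Subtype.ext h.2]
  rw [← hinj.encard_image]
  exact (Set.encard_le_encard hsub).trans (Set.encard_image_le _ _)

theorem coreGraph_conn {T : FreeTree G V ι} {H : Subgroup G} (R : T.Transversal H) {U : Set V}
    (hU : ∀ k, R.IsGen k → R.vert k ∈ U) : (T.coreGraph H U).Conn Set.univ := by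
  intro B _ hB hB'
  by_contra hc
  push Not at hc
  have hadj : ∀ x y, (T.coreGraph H U).R x y → (x ∈ B ↔ y ∈ B) := by
    intro x y hxy
    constructor
    · intro hx
      by_contra hy
      exact hc x hx y ⟨trivial, hy⟩ hxy
    · intro hy
      by_contra hx
      exact hc y hy x ⟨trivial, hx⟩ ((T.coreGraph H U).symm _ _ hxy)
  have key : ∀ v, v ∈ T.core H → ((∃ h : v ∈ T.core H, (⟨v, h⟩ : T.core H) ∈ B) ↔
      (∃ h : T.o ∈ T.core H, (⟨T.o, h⟩ : T.core H) ∈ B)) := by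
    intro v hv
    refine R.gen_induction (fun v => ∃ h : v ∈ T.core H, (⟨v, h⟩ : T.core H) ∈ B) ?_ hv
    intro g hg k hk
    have m1 : g • T.o ∈ T.core H := Or.inl ⟨g, hg, rfl⟩
    have m2 : g • R.vert k ∈ T.core H := (T.core H).smul_mem ⟨g, hg⟩ (R.vert_mem_core hk)
    have := hadj ⟨_, m1⟩ ⟨_, m2⟩ ⟨g, hg, _, hU k hk, Or.inl ⟨rfl, rfl⟩⟩
    constructor
    · rintro ⟨_, h⟩; exact ⟨m2, this.1 h⟩
    · rintro ⟨_, h⟩; exact ⟨m1, this.2 h⟩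
  obtain ⟨⟨x, hx⟩, hxB⟩ := hB
  obtain ⟨⟨y, hy⟩, -, hyB⟩ := hB'
  obtain ⟨_, h⟩ := (key y hy).2 ((key x hx).1 ⟨hx, hxB⟩)
  exact hyB h

theorem coreGraph_smul {T : FreeTree G V ι} {H : Subgroup G} {U : Set V} (p : H)
    (x y : T.core H) : (T.coreGraph H U).R (p • x) (p • y) ↔ (T.coreGraph H U).R x y := by
  have key : ∀ (p : H) (x y : T.core H), (T.coreGraph H U).R x y →
      (T.coreGraph H U).R (p • x) (p • y) := by
    rintro ⟨p, hp⟩ x y ⟨g, hg, u, hu, h⟩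
    refine ⟨p * g, H.mul_mem hp hg, u, hu, ?_⟩
    simp only [SubMulAction.val_smul, Subgroup.mk_smul, mul_smul, smul_left_cancel_iff]
    exact h
  refine ⟨fun h => ?_, key p x y⟩
  have := key p⁻¹ _ _ h
  rwa [inv_smul_smul, inv_smul_smul] at this

end FreeTree

namespace FreeTree

variable {G V ι : Type} [Group G] [MulAction G V]

theorem perSubgroup_map_mem {φ : G →* G} {g : G} (hg : g ∈ perSubgroup φ) :
    φ g ∈ perSubgroup φ := by
  obtain ⟨N, hN, h⟩ := hg
  exact ⟨N, hN, h.apply⟩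

theorem perSubgroup_exists_map {φ : G →* G} {g : G} (hg : g ∈ perSubgroup φ) :
    ∃ g' ∈ perSubgroup φ, φ g' = g := by
  obtain ⟨N, hN, h⟩ := hg
  refine ⟨φ^[N - 1] g, ⟨N, hN, h.apply_iterate _⟩, ?_⟩
  rw [← Function.iterate_succ_apply' φ, Nat.succ_eq_add_one, Nat.sub_add_cancel hN]
  exact h

/-- A map of the tree compatible with an injective endomorphism of the group. -/
structure Equivariant (T : FreeTree G V ι) (φ : G →* G) (f : V → V) : Prop where
  inj : Function.Injective φ
  smul : ∀ g v, f (g • v) = φ g • f v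
  map_o : f T.o = T.o

namespace Equivariant

variable {T : FreeTree G V ι} {φ : G →* G} {f : V → V} (E : T.Equivariant φ f)

theorem iterate_smul (E : T.Equivariant φ f) (N : ℕ) (g : G) (v : V) :
    f^[N] (g • v) = φ^[N] g • f^[N] v := by
  induction N generalizing g v with
  | zero => rfl
  | succ N ih => rw [Function.iterate_succ_apply, E.smul, ih]; rfl

theorem eq_of_stab (E : T.Equivariant φ f) {N : ℕ} {g : G} (hg : φ^[N] g = g) (hg1 : g ≠ 1)
    {v : V} (hv : g • v = v) :
    f^[N] v = v := by
  by_contra hne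
  refine hg1 (T.eq_one_of_fix_two (x := f^[N] v) (y := v) ?_ hv hne)
  have := E.iterate_smul N g v
  rw [hv, hg] at this
  exact this.symm

theorem map_mem_core (E : T.Equivariant φ f) {v : V} (hv : v ∈ T.core (perSubgroup φ)) :
    f v ∈ T.core (perSubgroup φ) := by
  rcases hv with ⟨g, hg, rfl⟩ | ⟨g, hg, hg1, hgv⟩
  · exact Or.inl ⟨φ g, perSubgroup_map_mem hg, by rw [E.smul, E.map_o]⟩
  · refine Or.inr ⟨φ g, perSubgroup_map_mem hg, ?_, ?_⟩
    · rwa [Ne, map_eq_one_iff φ E.inj]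
    · rw [← E.smul, hgv]

theorem exists_period (E : T.Equivariant φ f) {v : V} (hv : v ∈ T.core (perSubgroup φ)) :
    ∃ N, 0 < N ∧ f^[N] v = v := by
  rcases hv with ⟨g, ⟨N, hN, hg⟩, rfl⟩ | ⟨g, ⟨N, hN, hg⟩, hg1, hgv⟩
  · refine ⟨N, hN, ?_⟩
    rw [E.iterate_smul, Function.iterate_fixed E.map_o]
    exact congrArg (· • T.o) hg
  · exact ⟨N, hN, E.eq_of_stab hg hg1 hgv⟩

theorem exists_iterate (E : T.Equivariant φ f) {v : V} (hv : v ∈ T.core (perSubgroup φ)) :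
    ∃ N, f^[N] (f v) = v := by
  obtain ⟨N, hN, h⟩ := E.exists_period hv
  refine ⟨N - 1, ?_⟩
  rw [← Function.iterate_succ_apply, Nat.succ_eq_add_one, Nat.sub_add_cancel hN]
  exact h

theorem iterate_mem_core (E : T.Equivariant φ f) {v : V} (hv : v ∈ T.core (perSubgroup φ)) (N : ℕ) :
    f^[N] v ∈ T.core (perSubgroup φ) := by
  induction N with
  | zero => exact hv
  | succ N ih => rw [Function.iterate_succ_apply']; exact E.map_mem_core ih

theorem injOn_core (E : T.Equivariant φ f) {v w : V} (hv : v ∈ T.core (perSubgroup φ))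
    (hw : w ∈ T.core (perSubgroup φ)) (h : f v = f w) : v = w := by
  obtain ⟨N, hN, h1⟩ := E.exists_period hv
  obtain ⟨M, hM, h2⟩ := E.exists_period hw
  have h3 : Function.IsPeriodicPt f (N * M) v := Function.IsPeriodicPt.mul_const h1 M
  have h4 : Function.IsPeriodicPt f (N * M) w := Function.IsPeriodicPt.const_mul h2 N
  have h5 : f^[N * M] v = f^[N * M] w := by
    obtain ⟨k, hk⟩ := Nat.exists_eq_succ_of_ne_zero (Nat.mul_pos hN hM).ne'
    rw [hk, Function.iterate_succ_apply, Function.iterate_succ_apply, h]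
  rw [← h3.eq, h5, h4.eq]

/-- The permutation of the core. -/
noncomputable def perm (E : T.Equivariant φ f) : Equiv.Perm (T.core (perSubgroup φ)) :=
  Equiv.ofBijective (fun v => ⟨f v, E.map_mem_core v.2⟩) (by
    constructor
    · intro v w h
      exact Subtype.ext (E.injOn_core v.2 w.2 (congrArg Subtype.val h))
    · intro v
      obtain ⟨N, h⟩ := E.exists_iterate v.2
      refine ⟨⟨f^[N] v, E.iterate_mem_core v.2 N⟩, Subtype.ext ?_⟩
      show f (f^[N] v) = v
      rw [← Function.iterate_succ_apply' f, Function.iterate_succ_apply, h])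

theorem val_perm (E : T.Equivariant φ f) (v : T.core (perSubgroup φ)) :
    ((E.perm v : T.core (perSubgroup φ)) : V) = f v := rfl

theorem coreGraph_perm (E : T.Equivariant φ f) {U : Set V} (hU : U ⊆ T.core (perSubgroup φ))
    (hfU : f '' U = U) (x y : T.core (perSubgroup φ)) :
    (T.coreGraph (perSubgroup φ) U).R (E.perm x) (E.perm y) ↔
      (T.coreGraph (perSubgroup φ) U).R x y := by
  constructor
  · rintro ⟨g, hg, u, hu, h⟩
    obtain ⟨g', hg', rfl⟩ := perSubgroup_exists_map hg
    rw [← hfU] at hu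
    obtain ⟨u', hu', rfl⟩ := hu
    refine ⟨g', hg', u', hu', ?_⟩
    have m1 : g' • T.o ∈ T.core (perSubgroup φ) := Or.inl ⟨g', hg', rfl⟩
    have m2 : g' • u' ∈ T.core (perSubgroup φ) := (T.core _).smul_mem ⟨g', hg'⟩ (hU hu')
    have key : ∀ x y : T.core (perSubgroup φ), (E.perm x : V) = φ g' • T.o →
        (E.perm y : V) = φ g' • f u' → (x : V) = g' • T.o ∧ (y : V) = g' • u' := by
      intro x y h1 h2
      refine ⟨E.injOn_core x.2 m1 ?_, E.injOn_core y.2 m2 ?_⟩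
      · rw [E.smul, E.map_o]; exact h1
      · rw [E.smul]; exact h2
    rcases h with ⟨h1, h2⟩ | ⟨h1, h2⟩
    · exact Or.inl (key _ _ h1 h2)
    · exact Or.inr (key _ _ h1 h2)
  · rintro ⟨g, hg, u, hu, h⟩
    refine ⟨φ g, perSubgroup_map_mem hg, f u, hfU ▸ Set.mem_image_of_mem f hu, ?_⟩
    rw [val_perm, val_perm]
    rcases h with ⟨h1, h2⟩ | ⟨h1, h2⟩
    · left; rw [h1, h2, E.smul, E.smul, E.map_o]; exact ⟨rfl, rfl⟩
    · right; rw [h1, h2, E.smul, E.smul, E.map_o]; exact ⟨rfl, rfl⟩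

theorem exists_invariant (E : T.Equivariant φ f) {K : Set V} (hK : K.Finite)
    (hKc : K ⊆ T.core (perSubgroup φ)) :
    ∃ U : Set V, U.Finite ∧ K ⊆ U ∧ U ⊆ T.core (perSubgroup φ) ∧ f '' U = U := by
  refine ⟨⋃ v ∈ K, Set.range fun N => f^[N] v, ?_, ?_, ?_, ?_⟩
  · refine hK.biUnion fun v hv => ?_
    obtain ⟨N, hN, h⟩ := E.exists_period (hKc hv)
    refine ((Set.finite_lt_nat N).image fun M => f^[M] v).subset ?_
    rintro _ ⟨M, rfl⟩
    exact ⟨M % N, Nat.mod_lt _ hN, Function.IsPeriodicPt.iterate_mod_apply h M⟩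
  · intro v hv
    exact Set.mem_biUnion hv ⟨0, rfl⟩
  · intro w hw
    simp only [Set.mem_iUnion] at hw
    obtain ⟨v, hv, N, rfl⟩ := hw
    exact E.iterate_mem_core (hKc hv) N
  · ext w
    simp only [Set.mem_image, Set.mem_iUnion, Set.mem_range]
    constructor
    · rintro ⟨_, ⟨v, hv, N, rfl⟩, rfl⟩
      exact ⟨v, hv, N + 1, Function.iterate_succ_apply' _ _ _⟩
    · rintro ⟨v, hv, N, rfl⟩
      obtain ⟨M, hM⟩ := E.exists_iterate (E.iterate_mem_core (hKc hv) N)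
      refine ⟨_, ⟨v, hv, M + N, rfl⟩, ?_⟩
      rw [Function.iterate_add_apply, ← Function.iterate_succ_apply' f,
        Function.iterate_succ_apply, hM]

end Equivariant

end FreeTree

namespace FreeTree

variable {G V ι : Type} [Group G] [MulAction G V]

namespace Equivariant

variable {T : FreeTree G V ι} {φ : G →* G} {f : V → V}

theorem exists_nestAction [Fintype ι] (E : T.Equivariant φ f)
    (R : T.Transversal (perSubgroup φ)) :
    ∃ N : NestAction (T.core (perSubgroup φ)) (Equiv.Perm (T.core (perSubgroup φ))),
      N.P = (MulAction.toPermHom (perSubgroup φ) (T.core (perSubgroup φ))).range ∧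
      N.f = E.perm ∧ (N.o : V) = T.o := by
  classical
  have hfin : {k | R.IsGen k}.Finite := by
    by_contra hinf
    obtain ⟨s, hs, hcard⟩ := Set.Infinite.exists_subset_card_eq hinf (Fintype.card ι + 1)
    have := T.card_index_le E.inj E.smul E.map_o R s fun k hk => hs hk
    omega
  obtain ⟨U, hUfin, hKU, hUc, hfU⟩ := E.exists_invariant (hfin.image R.vert)
    (by rintro _ ⟨k, hk, rfl⟩; exact R.vert_mem_core hk)
  obtain ⟨n, hn⟩ := T.exists_bdry_le (perSubgroup φ) hUfin
  set Γ := T.coreGraph (perSubgroup φ) U with hΓ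
  have hconn : Γ.Conn Set.univ := coreGraph_conn R fun k hk => hKU ⟨k, hk, rfl⟩
  set ρ := MulAction.toPermHom (perSubgroup φ) (T.core (perSubgroup φ)) with hρ
  have ho : T.o ∈ T.core (perSubgroup φ) := Or.inl ⟨1, one_mem _, one_smul _ _⟩
  have hpre : ∀ (e : Equiv.Perm (T.core (perSubgroup φ))), (∀ x y, Γ.R (e x) (e y) ↔ Γ.R x y) →
      ∀ A ∈ Γ.nest n, e⁻¹ • A ∈ Γ.nest n := by
    intro e he A hA
    have := CutGraph.preimage_mem_nest (e := e) hA he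
    rwa [← Set.preimage_smul]
  have hperm : ∀ x y, Γ.R (E.perm x) (E.perm y) ↔ Γ.R x y := E.coreGraph_perm hUc hfU
  have fixmem : ∀ (g : perSubgroup φ) (v : V), g ≠ 1 → (g : G) • v = v →
      v ∈ T.core (perSubgroup φ) := fun g v hg hv =>
    Or.inr ⟨g, g.2, fun h => hg (Subtype.ext h), hv⟩
  have hval : ∀ (g : perSubgroup φ) (x : T.core (perSubgroup φ)),
      ((ρ g • x : T.core (perSubgroup φ)) : V) = (g : G) • (x : V) := fun g x => rfl
  have hfix : ∀ (g : perSubgroup φ) (x : T.core (perSubgroup φ)), ρ g • x = x →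
      (g : G) • (x : V) = x := fun g x h => congrArg Subtype.val h
  have hne : ∀ g : perSubgroup φ, ρ g ≠ 1 → (g : G) ≠ 1 := fun g h h1 =>
    h (by rw [show g = 1 from Subtype.ext h1, map_one])
  have hfρ : ∀ (g : perSubgroup φ),
      E.perm * ρ g * E.perm⁻¹ = ρ ⟨φ g, perSubgroup_map_mem g.2⟩ := by
    intro g
    rw [mul_inv_eq_iff_eq_mul]
    ext x
    exact E.smul g x
  refine ⟨{
    E := Γ.nest n
    compl_mem := fun A hA => CutGraph.compl_mem_nest hA
    nonempty := fun A hA => CutGraph.nonempty_of_mem_nest hA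
    nested := ?_
    finite_sep := fun x y => (CutGraph.finite_nest_sep (n := n) hconn y x).subset
      fun A hA => ⟨hA.1, hA.2.2, hA.2.1⟩
    exists_sep := ?_
    P := ρ.range
    f := E.perm
    o := ⟨T.o, ho⟩
    smul_E := ?_
    f_E := ?_
    inv_f_E := fun A hA => hpre _ hperm A hA
    conj_mem := ?_
    f_o := Subtype.ext E.map_o
    fix_or := ?_
    fix_two := ?_
    fix_mul := ?_ }, rfl, rfl, rfl⟩
  · intro A hA B hB
    by_contra hc
    push Not at hc
    obtain ⟨c1, c2, c3, c4⟩ := hc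
    refine CutGraph.not_cross_of_mem_nest hconn hA hB ⟨?_, ?_, ?_, ?_⟩
    · rw [← Set.not_disjoint_iff_nonempty_inter]
      exact fun h => c2 h.subset_compl_right
    · rw [← Set.sdiff_eq, Set.sdiff_nonempty]; exact c1
    · rw [Set.inter_comm, ← Set.sdiff_eq, Set.sdiff_nonempty]; exact c4
    · rw [← Set.sdiff_eq, Set.sdiff_nonempty]; exact c3
  · intro x y hxy
    obtain ⟨s, h1, h2, -⟩ := T.exists_side (x := (y : V)) (y := x) fun h => hxy (Subtype.ext h.symm)
    obtain ⟨A, hA⟩ := CutGraph.exists_isMin (Γ := Γ) (n := n) (𝒰 := pure y) (𝒲 := pure x)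
      (B := {w | (w : V) ∈ T.side s}) (Ultrafilter.mem_pure.2 h1)
      (fun h => h2 (Ultrafilter.mem_pure.1 h)) (hn s)
    exact ⟨A, ⟨_, _, hA⟩, fun h => hA.notMem (Ultrafilter.mem_pure.2 h),
      Ultrafilter.mem_pure.1 hA.mem⟩
  · rintro _ ⟨g, rfl⟩ A hA
    have := hpre (ρ g⁻¹) (coreGraph_smul g⁻¹) A hA
    rwa [map_inv, inv_inv] at this
  · intro A hA
    have := hpre E.perm⁻¹ (fun x y => by
      have h := hperm (E.perm⁻¹ x) (E.perm⁻¹ y)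
      rw [show E.perm (E.perm⁻¹ x) = x from E.perm.apply_symm_apply x,
        show E.perm (E.perm⁻¹ y) = y from E.perm.apply_symm_apply y] at h
      exact h.symm) A hA
    rwa [inv_inv] at this
  · rintro _ ⟨g, rfl⟩
    rw [hfρ]; exact ⟨_, rfl⟩
  · rintro _ ⟨g, rfl⟩
    by_cases hg : g = 1
    · left; exact ⟨⟨T.o, ho⟩, by rw [hg, map_one, one_smul]⟩
    by_cases hv : ∃ v : V, (g : G) • v = v
    · obtain ⟨v, hv⟩ := hv
      exact Or.inl ⟨⟨v, fixmem g v hg hv⟩, Subtype.ext hv⟩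
    · right
      push Not at hv
      obtain ⟨s, hs⟩ := T.exists_ssubset_of_not_fix hv
      obtain ⟨N₀, hN₀⟩ := T.eventually_mem_side hs T.o
      let a : ℕ → T.core (perSubgroup φ) := fun N => ρ g ^ (N.factorial : ℤ) • ⟨T.o, ho⟩
      let b : ℕ → T.core (perSubgroup φ) := fun N => ρ g ^ (-(N.factorial : ℤ)) • ⟨T.o, ho⟩
      have ha : ∀ N, ((a N : T.core (perSubgroup φ)) : V) = (g : G) ^ N.factorial • T.o := by
        intro N
        show ((ρ g ^ (N.factorial : ℤ) • (⟨T.o, ho⟩ : T.core (perSubgroup φ)) :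
          T.core (perSubgroup φ)) : V) = _
        rw [zpow_natCast, ← map_pow, hval, SubmonoidClass.coe_pow]
      have hb : ∀ N, ((b N : T.core (perSubgroup φ)) : V) = (g : G)⁻¹ ^ N.factorial • T.o := by
        intro N
        show ((ρ g ^ (-(N.factorial : ℤ)) • (⟨T.o, ho⟩ : T.core (perSubgroup φ)) :
          T.core (perSubgroup φ)) : V) = _
        rw [zpow_neg, ← inv_zpow, zpow_natCast, ← map_inv, ← map_pow, hval,
          SubmonoidClass.coe_pow, InvMemClass.coe_inv]
      let 𝒰 := Ultrafilter.of (Filter.map a Filter.atTop)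
      let 𝒲 := Ultrafilter.of (Filter.map b Filter.atTop)
      have hU1 : ∀ A : Set (T.core (perSubgroup φ)), (∀ᶠ N in Filter.atTop, a N ∈ A) → A ∈ 𝒰 :=
        fun A hA => Ultrafilter.of_le _ hA
      have hW1 : ∀ A : Set (T.core (perSubgroup φ)), (∀ᶠ N in Filter.atTop, b N ∈ A) → A ∈ 𝒲 :=
        fun A hA => Ultrafilter.of_le _ hA
      obtain ⟨A, hA⟩ := CutGraph.exists_isMin (Γ := Γ) (n := n) (𝒰 := 𝒰) (𝒲 := 𝒲)
        (B := {w | (w : V) ∈ T.side s})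
        (hU1 _ (by
          filter_upwards [Filter.eventually_ge_atTop N₀] with N hN
          show (a N : V) ∈ T.side s
          rw [ha]
          exact (hN₀ _ (hN.trans (Nat.self_le_factorial N))).1))
        (Ultrafilter.compl_mem_iff_notMem.1 (hW1 _ (by
          filter_upwards [Filter.eventually_ge_atTop N₀] with N hN
          show (b N : V) ∉ T.side s
          rw [hb]
          exact (hN₀ _ (hN.trans (Nat.self_le_factorial N))).2))) (hn s)
      refine ⟨A, ⟨_, _, hA⟩, fun h => ?_, fun h => ?_⟩
      · exact Ultrafilter.compl_mem_iff_notMem.1 (hU1 Aᶜ h) hA.mem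
      · refine hA.notMem (hW1 A ?_)
        filter_upwards [h] with N hN
        exact not_not.1 hN
  · rintro _ ⟨g, rfl⟩ x y hx hy hxy
    have := T.eq_one_of_fix_two (hfix _ _ hx) (hfix _ _ hy) fun h => hxy (Subtype.ext h)
    rw [show g = 1 from Subtype.ext this, map_one]
  · rintro _ ⟨g, rfl⟩ _ ⟨h, rfl⟩ hg hh x y hx hy hxy z hz
    refine T.mul_not_fix (hne g hg) (hne h hh) (hfix _ _ hx) (hfix _ _ hy)
      (fun h => hxy (Subtype.ext h)) z ?_
    rw [← map_mul] at hz
    exact hfix _ _ hz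

theorem map_eq_of_mem_core (E : T.Equivariant φ f) {v : V}
    (hv : v ∈ T.core (fixedSubgroup φ)) : f v = v := by
  rcases hv with ⟨g, hg, rfl⟩ | ⟨g, hg, hg1, hgv⟩
  · rw [E.smul, E.map_o, show φ g = g from hg]
  · exact E.eq_of_stab (N := 1) (show φ g = g from hg) hg1 hgv

theorem fixedSubgroup_le_perSubgroup (φ : G →* G) : fixedSubgroup φ ≤ perSubgroup φ :=
  fun g hg => ⟨1, one_pos, show φ g = g from hg⟩

end Equivariant

namespace Transversal

variable {T : FreeTree G V ι} {H : Subgroup G} (R : T.Transversal H)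

/-- There are potentials dual to the generators. -/
theorem exists_dual (k : V ⊕ (G × ι)) (hk : R.IsGen k) : ∃ F : V → ℚ,
    (∀ h ∈ H, ∀ v, F (h • v) = F v + F (h • T.o)) ∧ F (R.vert k) = 1 ∧
    ∀ k', R.IsGen k' → k' ≠ k → F (R.vert k') = 0 := by
  classical
  rcases k with y | l
  · refine ⟨fun v => if R.rep v = y then 1 else 0, ?_, ?_, ?_⟩
    · intro h hh v
      have h1 : R.rep T.o ≠ y := fun h => hk.1.2 (by rw [← h, ← R.o_eq])
      simp only [R.rep_smul hh, if_neg h1, add_zero]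
    · have : R.rep y = y := R.rep_of_mem hk.1.1
      simp [vert, this]
    · rintro (y' | l') hk' hne
      · have : R.rep y' = y' := R.rep_of_mem hk'.1.1
        have h2 : y' ≠ y := fun h => hne (congrArg Sum.inl h)
        simp [vert, this, h2]
      · have h1 : R.rep T.o ≠ y := fun h => hk.1.2 (by rw [← h, ← R.o_eq])
        simp [vert, R.rep_smul (R.τ_mem _), h1]
  · obtain ⟨μ, hμ1, hμ2⟩ := R.exists_hom (K := Multiplicative ℚ) (fun _ _ => 1)
      (fun _ _ _ _ _ _ _ _ => (mul_one _).symm)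
      (fun e => if e = l then Multiplicative.ofAdd 1 else 1)
      (fun e h1 h2 => if_neg fun (h : e = l) => hk.1.2 (h ▸ h2))
    have hF : ∀ h (hh : h ∈ H) v,
        μ ⟨R.τ (h • v), R.τ_mem _⟩ = μ ⟨h, hh⟩ * μ ⟨R.τ v, R.τ_mem _⟩ := by
      intro h hh v
      have h1 := R.mem_stab v hh
      have h2 := hμ1 _ (R.rep_mem v) ⟨_, h1.1⟩ h1.2
      have h3 : (⟨R.τ (h • v), R.τ_mem _⟩ : H) = ⟨h, hh⟩ * ⟨R.τ v, R.τ_mem _⟩ *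
          ⟨(R.τ v)⁻¹ * h⁻¹ * R.τ (h • v), h1.1⟩ := by
        apply Subtype.ext
        show R.τ (h • v) = h * R.τ v * ((R.τ v)⁻¹ * h⁻¹ * R.τ (h • v))
        group
      rw [h3, map_mul, map_mul, h2, mul_one]
    have hY : ∀ y ∈ R.Y, μ ⟨R.τ y, R.τ_mem _⟩ = 1 := fun y hy => by
      rw [show (⟨R.τ y, R.τ_mem _⟩ : H) = 1 from Subtype.ext (R.τ_of_mem y hy), map_one]
    have hl : ∀ l', T.src l' ∈ R.Y → μ ⟨R.τ (R.vert (Sum.inr l')), R.τ_mem _⟩ =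
        if l' = l then Multiplicative.ofAdd 1 else 1 := by
      intro l' hl'
      have h1 := hF _ (R.τ_mem (T.tgt l')) T.o
      rw [hY _ R.o_mem, mul_one, hμ2 l' hl'] at h1
      exact h1
    refine ⟨fun v => (μ ⟨R.τ v, R.τ_mem _⟩).toAdd, ?_, ?_, ?_⟩
    · intro h hh v
      simp only
      rw [hF h hh v, hF h hh T.o, hY _ R.o_mem, mul_one, toAdd_mul, add_comm]
    · simp only
      rw [hl l hk.1.1, if_pos rfl]; rfl
    · rintro (y' | l') hk' hne
      · simp only
        rw [hY _ (show R.vert (Sum.inl y') ∈ R.Y from hk'.1.1)]; rfl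
      · simp only
        rw [hl l' hk'.1.1, if_neg fun h => hne (congrArg Sum.inr h)]; rfl

end Transversal

/-- The generators of the fixed subgroup are at most as many as the orbits of edges. -/
theorem Equivariant.card_le [Fintype ι] {T : FreeTree G V ι} {φ : G →* G} {f : V → V}
    (E : T.Equivariant φ f) (R : T.Transversal (fixedSubgroup φ)) (s : Finset (V ⊕ (G × ι)))
    (hs : ∀ k ∈ s, R.IsGen k) : s.card ≤ Fintype.card ι := by
  classical
  obtain ⟨S⟩ := T.exists_transversal (perSubgroup φ)
  obtain ⟨N, hNP, hNf, hNo⟩ := E.exists_nestAction S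
  have hfin : {k | S.IsGen k}.Finite := by
    by_contra hinf
    obtain ⟨s, hs, hcard⟩ := Set.Infinite.exists_subset_card_eq hinf (Fintype.card ι + 1)
    have := T.card_index_le E.inj E.smul E.map_o S s fun k hk => hs hk
    omega
  have hcard : hfin.toFinset.card ≤ Fintype.card ι :=
    T.card_index_le E.inj E.smul E.map_o S _ fun k hk => hfin.mem_toFinset.1 hk
  refine le_trans ?_ hcard
  set ρ := MulAction.toPermHom (perSubgroup φ) (T.core (perSubgroup φ)) with hρ
  have hle := fixedSubgroup_le_perSubgroup φ
  have hH : ∀ h ∈ N.H, ∃ g : perSubgroup φ, (g : G) ∈ fixedSubgroup φ ∧ ρ g = h := by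
    intro h hh
    obtain ⟨h1, h2⟩ := NestAction.mem_H.1 hh
    rw [hNP] at h1
    obtain ⟨g, rfl⟩ := h1
    refine ⟨g, ?_, rfl⟩
    have h3 : ∀ x : T.core (perSubgroup φ), f ((g : G) • (x : V)) = (g : G) • f (x : V) := by
      intro x
      rw [hNf] at h2
      exact congrArg Subtype.val (DFunLike.congr_fun h2 x)
    have h4 := h3 N.o
    rw [hNo, E.smul, E.map_o] at h4
    have h5 := T.free ((g : G)⁻¹ * φ g) (by rw [mul_smul, h4, inv_smul_smul])
    exact (inv_mul_eq_one.1 h5).symm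
  have hD : ∀ k : s, ∃ D : T.core (perSubgroup φ) → ℚ,
      (∀ g : perSubgroup φ, ∀ v, D (g • v) = D v + D (g • N.o)) ∧
      ∀ k' (hk' : R.IsGen k') (hm : R.vert k' ∈ T.core (perSubgroup φ)),
        D ⟨R.vert k', hm⟩ = if k' = k then 1 else 0 := by
    rintro ⟨k, hk⟩
    obtain ⟨F, hF1, hF2, hF3⟩ := R.exists_dual k (hs k hk)
    obtain ⟨D, hD1, hD2⟩ := N.exists_extension (fun v => F v) (by
      intro h hh v hv
      obtain ⟨g, hg, rfl⟩ := hH h hh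
      have := hF1 g hg v
      rw [← hNo] at this
      exact this)
    refine ⟨D, fun g v => hD2 (ρ g) (by rw [hNP]; exact ⟨g, rfl⟩) v, fun k' hk' hm => ?_⟩
    rw [hD1 _ (by rw [hNf]; exact Subtype.ext (E.map_eq_of_mem_core (R.vert_mem_core hk')))]
    split_ifs with h
    · subst h; exact hF2
    · exact hF3 k' hk' h
  choose D hD1 hD2 using hD
  have hmem : ∀ k : hfin.toFinset, S.vert k ∈ T.core (perSubgroup φ) := fun k =>
    S.vert_mem_core (hfin.mem_toFinset.1 k.2)
  let L : (s → ℚ) →ₗ[ℚ] (hfin.toFinset → ℚ) :=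
    { toFun := fun c j => ∑ k, c k * D k ⟨S.vert j, hmem j⟩
      map_add' := fun a b => by
        funext j
        simp [add_mul, Finset.sum_add_distrib]
      map_smul' := fun a b => by
        funext j
        simp [Finset.mul_sum, mul_assoc] }
  have hL : Function.Injective L := by
    rw [injective_iff_map_eq_zero]
    intro c hc
    set Z : T.core (perSubgroup φ) → ℚ := fun v => ∑ k, c k * D k v with hZ
    have hZ1 : ∀ g : perSubgroup φ, ∀ v, Z (g • v) = Z v + Z (g • N.o) := by
      intro g v
      simp only [hZ, ← Finset.sum_add_distrib, ← mul_add]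
      exact Finset.sum_congr rfl fun k _ => by rw [hD1]
    have hZo : Z N.o = 0 := by
      have := hZ1 1 N.o
      rw [one_smul] at this
      linarith
    have hZ2 : ∀ v, v ∈ T.core (perSubgroup φ) →
        ((∀ h : v ∈ T.core (perSubgroup φ), Z ⟨v, h⟩ = 0) ↔
          ∀ h : T.o ∈ T.core (perSubgroup φ), Z ⟨T.o, h⟩ = 0) := by
      intro v hv
      refine S.gen_induction (fun v => ∀ h : v ∈ T.core (perSubgroup φ), Z ⟨v, h⟩ = 0) ?_ hv
      intro g hg k hk
      have m0 := S.vert_mem_core hk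
      have e1 := hZ1 ⟨g, hg⟩ ⟨S.vert k, m0⟩
      have e2 : Z ⟨S.vert k, m0⟩ = 0 := congrFun hc ⟨k, hfin.mem_toFinset.2 hk⟩
      rw [e2, zero_add] at e1
      have m1 : g • T.o ∈ T.core (perSubgroup φ) := Or.inl ⟨g, hg, rfl⟩
      have m2 : g • S.vert k ∈ T.core (perSubgroup φ) := (T.core _).smul_mem ⟨g, hg⟩ m0
      have e3 : (⟨g • T.o, m1⟩ : T.core (perSubgroup φ)) = (⟨g, hg⟩ : perSubgroup φ) • N.o :=
        Subtype.ext (by rw [SubMulAction.val_smul, hNo]; rfl)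
      have e4 : (⟨g • S.vert k, m2⟩ : T.core (perSubgroup φ)) =
        (⟨g, hg⟩ : perSubgroup φ) • ⟨S.vert k, m0⟩ := rfl
      constructor
      · intro h _
        rw [e4, e1, ← e3]; exact h _
      · intro h _
        rw [e3, ← e1, ← e4]; exact h _
    have hZ0 : ∀ v, Z v = 0 := fun v => (hZ2 v v.2).2 (fun h => by
      rw [show (⟨T.o, h⟩ : T.core (perSubgroup φ)) = N.o from Subtype.ext hNo.symm, hZo]) v.2
    funext k
    have hm : R.vert k ∈ T.core (perSubgroup φ) := by
      rcases R.vert_mem_core (hs k k.2) with ⟨g, hg, h⟩ | ⟨g, hg, h⟩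
      · exact Or.inl ⟨g, hle hg, h⟩
      · exact Or.inr ⟨g, hle hg, h⟩
    have := hZ0 ⟨R.vert k, hm⟩
    simp only [hZ, hD2 _ k.1 (hs k k.2) hm] at this
    simpa [Subtype.val_inj] using this
  have := LinearMap.finrank_le_finrank_of_injective hL
  simpa using this

end FreeTree

section CoprodTree

variable {ι : Type} (M : ι → Type) [∀ i, Group (M i)]

/-- The vertices: group elements, and cosets of the factors that are not infinite cyclic. -/
abbrev CoprodVertex : Type :=
  CoprodI M ⊕ Σ i : {i // ¬ Nonempty (M i ≃* Multiplicative ℤ)},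
    CoprodI M ⧸ (factorSubgroup (i : ι) : Subgroup (CoprodI M))

variable {M}

theorem exists_coprod_cocycle {N : Type} [Group N]
    (x : ∀ i, Nonempty (M i ≃* Multiplicative ℤ) → M i)
    (hx : ∀ i h m, ∃ k : ℤ, x i h ^ k = m)
    (hx' : ∀ i h (K : Type) [Group K] (κ : K), ∃ ψ : M i →* K, ψ (x i h) = κ)
    (b : CoprodI M → ι → N) : ∃ B : CoprodI M → N,
      (∀ g i h, B (g * CoprodI.of (x i h)) = B g * b g i) ∧
      ∀ g i, ¬ Nonempty (M i ≃* Multiplicative ℤ) → ∀ m : M i,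
        B (g * CoprodI.of m) * b (g * CoprodI.of m) i = B g * b g i := by
  classical
  have h1 : ∀ i, ∃ ψ : M i →* Equiv.Perm (N × CoprodI M),
      (∀ m p, (ψ m p).2 = p.2 * (CoprodI.of m)⁻¹) ∧
      (∀ h p, ψ (x i h)⁻¹ p = (p.1 * b p.2 i, p.2 * CoprodI.of (x i h))) ∧
      (¬ Nonempty (M i ≃* Multiplicative ℤ) → ∀ m p, (ψ m⁻¹ p).1 * b (p.2 * CoprodI.of m) i =
        p.1 * b p.2 i) := by
    intro i
    by_cases h : Nonempty (M i ≃* Multiplicative ℤ)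
    · let π : Equiv.Perm (N × CoprodI M) :=
        { toFun := fun p => (p.1 * b p.2 i, p.2 * CoprodI.of (x i h))
          invFun := fun p => (p.1 * (b (p.2 * (CoprodI.of (x i h))⁻¹) i)⁻¹,
            p.2 * (CoprodI.of (x i h))⁻¹)
          left_inv := fun p => by simp
          right_inv := fun p => by simp }
      obtain ⟨ψ, hψ⟩ := hx' i h _ π⁻¹
      refine ⟨ψ, ?_, fun h' p => ?_, fun h' => absurd h h'⟩
      · let S : Subgroup (M i) :=
          { carrier := {m | ∀ p, (ψ m p).2 = p.2 * (CoprodI.of m)⁻¹}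
            one_mem' := fun p => by simp
            mul_mem' := fun {a c} ha hc p => by
              rw [map_mul, Equiv.Perm.mul_apply, ha, hc, map_mul, mul_inv_rev, mul_assoc]
            inv_mem' := fun {a} ha p => by
              have := ha (ψ a⁻¹ p)
              rw [← Equiv.Perm.mul_apply, ← map_mul, mul_inv_cancel, map_one] at this
              rw [map_inv (CoprodI.of (M := M) (i := i)), inv_inv]
              exact (eq_mul_inv_iff_mul_eq.1 this).symm }
        have hxS : x i h ∈ S := fun p => by rw [hψ]; rfl
        intro m
        obtain ⟨k, rfl⟩ := hx i h m
        exact S.zpow_mem hxS k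
      · rw [map_inv, hψ, inv_inv]; rfl
    · let D : M i →* Function.End (N × CoprodI M) :=
        { toFun := fun m p => (p.1 * (b p.2 i * (b (p.2 * (CoprodI.of m)⁻¹) i)⁻¹),
            p.2 * (CoprodI.of m)⁻¹)
          map_one' := by
            funext p; simp; rfl
          map_mul' := fun a c => by
            funext p
            refine Prod.ext ?_ ?_
            · show _ = p.1 * (b p.2 i * (b (p.2 * (CoprodI.of c)⁻¹) i)⁻¹) *
                (b (p.2 * (CoprodI.of c)⁻¹) i *
                  (b (p.2 * (CoprodI.of c)⁻¹ * (CoprodI.of a)⁻¹) i)⁻¹)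
              simp [mul_assoc]
            · show _ = p.2 * (CoprodI.of c)⁻¹ * (CoprodI.of a)⁻¹
              simp [mul_assoc] }
      refine ⟨D.toHomPerm, fun m p => rfl, fun h' => absurd h' h, fun _ m p => ?_⟩
      show p.1 * (b p.2 i * (b (p.2 * (CoprodI.of m⁻¹)⁻¹) i)⁻¹) * b (p.2 * CoprodI.of m) i = _
      simp [mul_assoc]
  choose ψ hψ1 hψ2 hψ3 using h1
  set ρ : CoprodI M →* Equiv.Perm (N × CoprodI M) := CoprodI.lift ψ with hρ
  have hρof : ∀ {i} (m : M i), ρ (CoprodI.of m) = ψ i m := fun m => CoprodI.lift_of _ m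
  have hρ2 : ∀ w p, (ρ w p).2 = p.2 * w⁻¹ := by
    intro w
    induction w using CoprodI.induction_on with
    | one => simp
    | of i m => intro p; rw [hρof, hψ1]
    | mul a c ha hc =>
      intro p
      rw [map_mul, Equiv.Perm.mul_apply, ha, hc, mul_inv_rev, mul_assoc]
  have hstep : ∀ g i (m : M i), ρ (g * CoprodI.of m)⁻¹ (1, 1) =
      ψ i m⁻¹ ((ρ g⁻¹ (1, 1)).1, g) := by
    intro g i m
    rw [mul_inv_rev, map_mul, Equiv.Perm.mul_apply, ← map_inv, hρof]
    congr 1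
    exact Prod.ext rfl (by rw [hρ2]; simp)
  refine ⟨fun g => (ρ g⁻¹ (1, 1)).1, fun g i h => ?_, fun g i h m => ?_⟩
  · simp only [hstep, hψ2]
  · simp only [hstep]
    exact hψ3 i h m _

open Classical in
/-- The Bass-Serre tree of a free product, with the infinite cyclic factors treated as free. -/
theorem exists_coprodTree (M : ι → Type) [∀ i, Group (M i)] :
    ∃ T : FreeTree (CoprodI M) (CoprodVertex M) ι, T.o = Sum.inl 1 := by
  have h0 : ∀ i (h : Nonempty (M i ≃* Multiplicative ℤ)), ∃ x : M i,
      (∀ m, ∃ k : ℤ, x ^ k = m) ∧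
      ∀ (K : Type) [Group K] (κ : K), ∃ ψ : M i →* K, ψ x = κ := by
    rintro i ⟨e⟩
    refine ⟨e.symm (Multiplicative.ofAdd 1), fun m => ⟨(e m).toAdd, ?_⟩, fun K _ κ => ?_⟩
    · rw [← map_zpow, ← ofAdd_zsmul, smul_eq_mul, mul_one, ofAdd_toAdd, e.symm_apply_apply]
    · exact ⟨(zpowersHom K κ).comp e.toMonoidHom, by simp⟩
  choose x hx hx' using h0
  let t : ι → CoprodVertex M := fun i =>
    if h : Nonempty (M i ≃* Multiplicative ℤ) then Sum.inl (CoprodI.of (x i h))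
    else Sum.inr ⟨⟨i, h⟩, ((1 : CoprodI M) : CoprodI M ⧸ factorSubgroup i)⟩
  have ht1 : ∀ i h, t i = Sum.inl (CoprodI.of (x i h)) := fun i h => dif_pos h
  have ht2 : ∀ i h, t i = Sum.inr ⟨⟨i, h⟩, ((1 : CoprodI M) : CoprodI M ⧸ factorSubgroup i)⟩ :=
    fun i h => dif_neg h
  have hmk : ∀ (g : CoprodI M) i h, g • t i =
      Sum.inr ⟨⟨i, h⟩, (g : CoprodI M ⧸ factorSubgroup i)⟩ := fun g i h => by
    rw [ht2 i h]
    show (Sum.inr ⟨⟨i, h⟩, ((g * 1 : CoprodI M) : CoprodI M ⧸ factorSubgroup i)⟩ :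
      CoprodVertex M) = _
    rw [mul_one]
  have hinl : ∀ g h : CoprodI M, g • (Sum.inl h : CoprodVertex M) = Sum.inl (g * h) :=
    fun g h => rfl
  have hcoset : ∀ (g : CoprodI M) i (m : M i), ((g * CoprodI.of m : CoprodI M) :
      CoprodI M ⧸ factorSubgroup i) = g := fun g i m => by
    rw [QuotientGroup.eq]
    exact MonoidHom.mem_range.2 ⟨m⁻¹, by rw [map_inv]; group⟩
  refine ⟨{ o := Sum.inl 1, t := t, free := ?_, conn := ?_, integ := ?_ }, rfl⟩
  · intro g h
    rw [hinl, mul_one] at h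
    exact Sum.inl_injective h
  · intro Q hQ hQt
    simp only [hinl, mul_one] at hQt
    have key : ∀ w g : CoprodI M, Q (Sum.inl g) ↔ Q (Sum.inl (g * w)) := by
      intro w
      induction w using CoprodI.induction_on with
      | one => simp
      | of i m =>
        intro g
        by_cases h : Nonempty (M i ≃* Multiplicative ℤ)
        · let S : Subgroup (M i) :=
            { carrier := {m | ∀ g, Q (Sum.inl g) ↔ Q (Sum.inl (g * CoprodI.of m))}
              one_mem' := fun p => by simp
              mul_mem' := fun {a c} ha hc p => by
                rw [ha p, hc, map_mul, mul_assoc]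
              inv_mem' := fun {a} ha p => by
                rw [ha (p * CoprodI.of a⁻¹), map_inv, inv_mul_cancel_right] }
          have hxS : x i h ∈ S := fun g => by
            have := hQt g i
            rwa [ht1 i h] at this
          obtain ⟨k, rfl⟩ := hx i h m
          exact S.zpow_mem hxS k g
        · rw [hQt g i, hQt (g * CoprodI.of m) i, hmk _ _ h, hmk _ _ h, hcoset]
      | mul a c ha hc => intro g; rw [ha, hc, mul_assoc]
    have hg : ∀ g, Q (Sum.inl g) := fun g => by
      have := key g 1
      rw [one_mul] at this
      exact this.1 hQ
    rintro (g | ⟨⟨i, h⟩, q⟩)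
    · exact hg g
    · induction q using QuotientGroup.induction_on with
      | H g => rw [← hmk g i h]; exact (hQt g i).1 (hg g)
  · intro N _ b
    obtain ⟨B, hB1, hB2⟩ := exists_coprod_cocycle x hx (fun i h => hx' i h) b
    refine ⟨Sum.elim B fun p => Quotient.liftOn' p.2 (fun g => B g * b g p.1) ?_, ?_⟩
    · intro g g' h
      obtain ⟨m, hm⟩ := QuotientGroup.leftRel_apply.1 h
      have : g' = g * CoprodI.of m := by rw [hm]; group
      rw [this]
      exact (hB2 g p.1 p.1.2 m).symm
    · intro g i
      by_cases h : Nonempty (M i ≃* Multiplicative ℤ)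
      · rw [ht1 i h, hinl, hinl, mul_one]
        exact hB1 g i h
      · rw [hmk g i h, hinl, mul_one]
        rfl

end CoprodTree

/-- A free product splits off any of its factors. -/
theorem exists_coprodI_split {X : Type} (M : X → Type) [∀ x, Group (M x)] (x : X) :
    Nonempty (CoprodI M ≃* Coprod (M x) (CoprodI fun j : {j // j ≠ x} => M j)) := by
  classical
  let F : ∀ j, M j →* Coprod (M x) (CoprodI fun j : {j // j ≠ x} => M j) := fun j =>
    if h : j = x then h ▸ Coprod.inl
    else Coprod.inr.comp (CoprodI.of (M := fun j : {j // j ≠ x} => M j) (i := ⟨j, h⟩))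
  have hF1 : F x = Coprod.inl := by simp [F]
  have hF2 : ∀ j : {j // j ≠ x}, F j =
      Coprod.inr.comp (CoprodI.of (M := fun j : {j // j ≠ x} => M j) (i := j)) :=
    fun j => dif_neg j.2
  let A : CoprodI M →* Coprod (M x) (CoprodI fun j : {j // j ≠ x} => M j) := CoprodI.lift F
  let B : Coprod (M x) (CoprodI fun j : {j // j ≠ x} => M j) →* CoprodI M :=
    Coprod.lift CoprodI.of (CoprodI.lift fun j => CoprodI.of (M := M) (i := (j : X)))
  have hA : ∀ j (m : M j), A (CoprodI.of m) = F j m := fun j m => CoprodI.lift_of _ m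
  refine ⟨MonoidHom.toMulEquiv A B ?_ ?_⟩
  · refine CoprodI.ext_hom _ _ fun j => ?_
    ext m
    simp only [MonoidHom.comp_apply, hA, MonoidHom.id_apply]
    by_cases h : j = x
    · subst h
      rw [hF1]; simp [B]
    · rw [hF2 ⟨j, h⟩]; simp [B]
  · refine Coprod.hom_ext ?_ ?_
    · ext m
      simp [B, hA, hF1]
    · refine CoprodI.ext_hom _ _ fun j => ?_
      ext m
      simp [B, hA, hF2]

theorem freelyIndecomposable_congr {A B : Type} [Group A] [Group B] (e : A ≃* B)
    (h : FreelyIndecomposable A) : FreelyIndecomposable B := by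
  rintro ⟨C, D, _, _, hC, hD, ⟨e'⟩⟩
  exact h ⟨C, D, _, _, hC, hD, ⟨e.trans e'⟩⟩

theorem subsingleton_of_freelyIndecomposable {X : Type} (M : X → Type) [∀ x, Group (M x)]
    (hM : ∀ x, Nontrivial (M x)) (h : FreelyIndecomposable (CoprodI M)) : Subsingleton X := by
  refine ⟨fun x y => ?_⟩
  by_contra hxy
  refine h ⟨M x, CoprodI fun j : {j // j ≠ x} => M j, inferInstance, inferInstance, hM x, ?_,
    exists_coprodI_split M x⟩
  have := hM y
  exact (CoprodI.of_injective (M := fun j : {j // j ≠ x} => M j)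
    ⟨y, fun h => hxy h.symm⟩).nontrivial

theorem CoprodI.of_surjective {X : Type} [Subsingleton X] (M : X → Type) [∀ x, Group (M x)]
    (x : X) : Function.Surjective (CoprodI.of (M := M) (i := x)) := by
  intro w
  induction w using CoprodI.induction_on with
  | one => exact ⟨1, map_one _⟩
  | of i m => obtain rfl := Subsingleton.elim x i; exact ⟨m, rfl⟩
  | mul a c ha hc =>
    obtain ⟨a, rfl⟩ := ha
    obtain ⟨c, rfl⟩ := hc
    exact ⟨a * c, map_mul _ _ _⟩

namespace FreeTree

variable {G V ι : Type} [Group G] [MulAction G V]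

/-- A freely indecomposable subgroup that is not infinite cyclic fixes a vertex. -/
theorem exists_fixed_vertex (T : FreeTree G V ι) (H : Subgroup G) (hH : FreelyIndecomposable H)
    (hZ : ¬ Nonempty (H ≃* Multiplicative ℤ)) : ∃ v : V, ∀ h ∈ H, h • v = v := by
  classical
  obtain ⟨R⟩ := T.exists_transversal H
  let α := {v : V // v ∈ R.Y ∧ ∃ h ∈ H, h ≠ 1 ∧ h • v = v}
  let β := {e : G × ι // T.src e ∈ R.Y ∧ T.tgt e ∉ R.Y}
  let A : α → Type := fun a => ↥(H ⊓ MulAction.stabilizer G (a : V))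
  obtain ⟨e, he⟩ := R.exists_mulEquiv A (fun a => (a : V)) Subtype.val_injective
    (fun a => a.2.1) (fun v hv hst => ⟨⟨v, hv, hst⟩, rfl⟩) (fun a => Subgroup.subtype _)
    (fun a => Subtype.val_injective)
    (fun a g => by rw [Subgroup.range_subtype, Subgroup.mem_inf, MulAction.mem_stabilizer_iff])
    (fun b : β => (b : G × ι)) Subtype.val_injective
    (fun e => ⟨fun ⟨b, hb⟩ => hb ▸ b.2, fun h => ⟨⟨e, h⟩, rfl⟩⟩)
  have hsub := subsingleton_of_freelyIndecomposable
    (Sum.elim A (fun _ : β => Multiplicative ℤ)) (by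
      rintro (a | b)
      · obtain ⟨h, hh, h1, hv⟩ := a.2.2
        exact ⟨⟨h, hh, hv⟩, 1, fun h' => h1 (congrArg Subtype.val h')⟩
      · exact inferInstanceAs (Nontrivial (Multiplicative ℤ)))
    (freelyIndecomposable_congr e hH)
  by_cases hα : Nonempty α
  · obtain ⟨a⟩ := hα
    refine ⟨a, fun h hh => ?_⟩
    obtain ⟨x, hx⟩ := CoprodI.of_surjective (Sum.elim A (fun _ : β => Multiplicative ℤ))
      (Sum.inl a) (e ⟨h, hh⟩)
    have h1 := he a x
    rw [hx, e.symm_apply_apply] at h1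
    have h2 : (h : G) = (x : A a).1 := h1
    rw [h2]; exact (x : A a).2.2
  · by_cases hβ : Nonempty β
    · obtain ⟨b⟩ := hβ
      refine absurd ⟨e.trans (MulEquiv.ofBijective (CoprodI.of (M := Sum.elim A
        (fun _ : β => Multiplicative ℤ)) (i := Sum.inr b))
        ⟨CoprodI.of_injective _, CoprodI.of_surjective _ _⟩).symm⟩ hZ
    · refine ⟨T.o, fun h hh => ?_⟩
      have h1 : ∀ w : CoprodI (Sum.elim A (fun _ : β => Multiplicative ℤ)), w = 1 := by
        intro w
        induction w using CoprodI.induction_on with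
        | one => rfl
        | of i m =>
          rcases i with a | b
          · exact absurd ⟨a⟩ hα
          · exact absurd ⟨b⟩ hβ
        | mul a c ha hc => rw [ha, hc, mul_one]
      have h2 : (⟨h, hh⟩ : H) = 1 := e.injective (by rw [h1 (e _), map_one])
      rw [show h = 1 from congrArg Subtype.val h2, one_smul]

end FreeTree

section CoprodTree

variable {ι : Type} {M : ι → Type} [∀ i, Group (M i)]

theorem coprodVertex_smul_inr (g h : CoprodI M)
    (i : {i // ¬ Nonempty (M i ≃* Multiplicative ℤ)}) :
    g • (Sum.inr ⟨i, (h : CoprodI M ⧸ factorSubgroup (i : ι))⟩ : CoprodVertex M) =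
      Sum.inr ⟨i, ((g * h : CoprodI M) : CoprodI M ⧸ factorSubgroup (i : ι))⟩ := rfl

theorem mem_conj_factor {g h : CoprodI M} {i : {i // ¬ Nonempty (M i ≃* Multiplicative ℤ)}} :
    g ∈ conjSubgroup h (factorSubgroup (i : ι)) ↔
      g • (Sum.inr ⟨i, (h : CoprodI M ⧸ factorSubgroup (i : ι))⟩ : CoprodVertex M) =
        Sum.inr ⟨i, (h : CoprodI M ⧸ factorSubgroup (i : ι))⟩ := by
  rw [coprodVertex_smul_inr, conjSubgroup, Subgroup.mem_map_equiv]
  simp only [Sum.inr.injEq, Sigma.mk.injEq, heq_eq_eq, true_and]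
  rw [eq_comm, QuotientGroup.eq]
  rw [MulAut.conj_symm_apply, mul_assoc]

theorem exists_equivariant (T : FreeTree (CoprodI M) (CoprodVertex M) ι) (hT : T.o = Sum.inl 1)
    (hM : ∀ i, FreelyIndecomposable (M i)) (φ : CoprodI M →* CoprodI M)
    (hφ : Function.Injective φ) : ∃ f, T.Equivariant φ f := by
  have h1 : ∀ i : {i // ¬ Nonempty (M i ≃* Multiplicative ℤ)}, ∃ v : CoprodVertex M,
      ∀ m : M i, φ (CoprodI.of m) • v = v := by
    intro i
    have hinj : Function.Injective (φ.comp (CoprodI.of (M := M) (i := (i : ι)))) :=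
      hφ.comp (CoprodI.of_injective _)
    let e := MonoidHom.ofInjective hinj
    obtain ⟨v, hv⟩ := T.exists_fixed_vertex _ (freelyIndecomposable_congr e (hM i))
      (fun ⟨e'⟩ => i.2 ⟨e.trans e'⟩)
    exact ⟨v, fun m => hv _ ⟨m, rfl⟩⟩
  choose y hy using h1
  refine ⟨Sum.elim (fun g => Sum.inl (φ g))
    fun p => Quotient.liftOn' p.2 (fun g => φ g • y p.1) ?_, hφ, ?_, ?_⟩
  · intro g g' h
    obtain ⟨m, hm⟩ := QuotientGroup.leftRel_apply.1 h
    have : g' = g * CoprodI.of m := by rw [hm]; group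
    rw [this, map_mul, mul_smul, hy]
  · rintro g (h | ⟨i, q⟩)
    · show (Sum.inl (φ (g * h)) : CoprodVertex M) = Sum.inl (φ g * φ h)
      rw [map_mul]
    · induction q using QuotientGroup.induction_on with
      | H h =>
        show φ (g * h) • y i = φ g • φ h • y i
        rw [map_mul, mul_smul]
  · rw [hT]
    show (Sum.inl (φ 1) : CoprodVertex M) = Sum.inl 1
    rw [map_one]

end CoprodTree

/-- Corollary of the paper. Let `φ` be a monomorphism of a free
product `G = G_1 * … * G_n` of freely indecomposable groups.  Then `Fix(φ)` has Kurosh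
rank at most `n` with respect to this splitting of `G`. -/
theorem kurosh_rank_fixedSubgroup_of_monomorphism {n : ℕ}
    (Gf : Fin n → Type) [∀ i, Group (Gf i)]
    (hG : ∀ i, FreelyIndecomposable (Gf i))
    (φ : CoprodI Gf →* CoprodI Gf)
    (hinj : Function.Injective φ) :
    HasKuroshRankLE (fixedSubgroup φ) n := by
  classical
  obtain ⟨T, hT⟩ := exists_coprodTree Gf
  obtain ⟨f, E⟩ := exists_equivariant T hT hG φ hinj
  obtain ⟨R⟩ := T.exists_transversal (fixedSubgroup φ)
  have hfin : {k | R.IsGen k}.Finite := by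
    by_contra hinf
    obtain ⟨s, hs, hcard⟩ := Set.Infinite.exists_subset_card_eq hinf (Fintype.card (Fin n) + 1)
    have := E.card_le R s fun k hk => hs hk
    omega
  have hcard := E.card_le R hfin.toFinset fun k hk => hfin.mem_toFinset.1 hk
  rw [Fintype.card_fin] at hcard
  let SY : Set (CoprodVertex Gf) := {y | R.IsGen (Sum.inl y)}
  let SL : Set (CoprodI Gf × Fin n) := {l | R.IsGen (Sum.inr l)}
  have hY : SY.Finite := hfin.preimage Sum.inl_injective.injOn
  have hL : SL.Finite := hfin.preimage Sum.inr_injective.injOn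
  let eY := hY.toFinset.equivFin
  let eL := hL.toFinset.equivFin
  have hsum : hY.toFinset.card + hL.toFinset.card ≤ n := by
    refine le_trans (le_of_eq ?_) hcard
    rw [← Finset.card_disjSum]
    congr 1
    ext (y | l) <;> simp [SY, SL]
  have hinr : ∀ a : Fin hY.toFinset.card,
      ∃ (i : {i // ¬ Nonempty (Gf i ≃* Multiplicative ℤ)}) (g : CoprodI Gf),
        ((eY.symm a : CoprodVertex Gf)) =
          Sum.inr ⟨i, (g : CoprodI Gf ⧸ factorSubgroup (i : Fin n))⟩ := by
    intro a
    obtain ⟨g, -, hg1, hg⟩ := (hY.mem_toFinset.1 (eY.symm a).2).2 _ rfl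
    rcases h : (eY.symm a : CoprodVertex Gf) with w | ⟨i, q⟩
    · rw [h] at hg
      have : g * w = w := Sum.inl_injective hg
      exact absurd (mul_eq_right.1 this) hg1
    · induction q using QuotientGroup.induction_on with
      | H w => exact ⟨i, w, rfl⟩
  choose J g hJ using hinr
  have hmem : ∀ a x, x ∈ conjSubgroup (g a) (factorSubgroup (J a : Fin n)) ⊓ fixedSubgroup φ ↔
      x ∈ fixedSubgroup φ ∧ x • (eY.symm a : CoprodVertex Gf) = eY.symm a := by
    intro a x
    rw [Subgroup.mem_inf, mem_conj_factor, ← hJ, and_comm]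
  obtain ⟨e, he⟩ := R.exists_mulEquiv
    (fun a => ↥(conjSubgroup (g a) (factorSubgroup (J a : Fin n)) ⊓ fixedSubgroup φ))
    (fun a => (eY.symm a : CoprodVertex Gf))
    (Subtype.val_injective.comp eY.symm.injective)
    (fun a => (hY.mem_toFinset.1 (eY.symm a).2).1.1)
    (fun v hv hst => by
      have hv' : v ∈ hY.toFinset := hY.mem_toFinset.2 ⟨⟨hv, fun h => by
        obtain ⟨x, -, hx1, hx⟩ := hst
        exact hx1 (T.free x (h ▸ hx))⟩, fun y hy => Sum.inl_injective hy ▸ hst⟩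
      exact ⟨eY ⟨v, hv'⟩, by simp⟩)
    (fun a => Subgroup.subtype _) (fun a => Subtype.val_injective)
    (fun a x => by rw [Subgroup.range_subtype, hmem])
    (fun b => (eL.symm b : CoprodI Gf × Fin n)) (Subtype.val_injective.comp eL.symm.injective)
    (fun l => ⟨fun ⟨b, hb⟩ => hb ▸ (hL.mem_toFinset.1 (eL.symm b).2).1, fun h => by
      have hl' : l ∈ hL.toFinset := hL.mem_toFinset.2 ⟨h, fun y hy => by cases hy⟩
      exact ⟨eL ⟨l, hl'⟩, by simp⟩⟩)
  refine ⟨_, _, fun a => J a, g, e, hsum, fun a => ?_, fun a x => he a x⟩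
  obtain ⟨x, hx, hx1, hxy⟩ := (hY.mem_toFinset.1 (eY.symm a).2).2 _ rfl
  exact ⟨⟨x, (hmem a x).2 ⟨hx, hxy⟩⟩, 1, fun h => hx1 (congrArg Subtype.val h)⟩
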